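/- arXiv:math/9404238 — 3 statements merged into one kernel-verified Lean document; each statement's English description precedes it below -/
import Mathlib

section
/- For every irrational ρ ∈ (0,1) there exists a continuous map F̃ : X̃ → X̃, where X̃ := { (x, y) ∈ ℝ² : x ∈ ℤ or y ∈ ℤ } is the lift of the one-dimensional skeleton of the torus, satisfying F̃(x + v) = F̃(x) + v for all x ∈ X̃ and v ∈ ℤ², whose rotation set ρ(F̃) equals Ω_ρ. -/
open Filter Topology

noncomputable def alphaSeq (ρ : ℝ) (n : ℕ) : ℝ := (⌈(n : ℝ) * ρ⌉ : ℝ) - (n : ℝ) * ρ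

noncomputable def vecRho (ρ : ℝ) (m n : ℕ) : ℝ × ℝ :=
  ((⌈(m : ℝ) * ρ⌉ : ℝ) / ((m : ℝ) + (n : ℝ) + 1),
   (⌈(n : ℝ) * ρ⌉ : ℝ) / ((m : ℝ) + (n : ℝ) + 1))

/-- The closure of the convex hull of the admissible vectors `vecRho ρ m n`. -/
noncomputable def OmegaSet (ρ : ℝ) : Set (ℝ × ℝ) :=
  closure (convexHull ℝ
    {p : ℝ × ℝ | ∃ m n : ℕ, alphaSeq ρ m < ρ ∧ alphaSeq ρ n < ρ ∧ p = vecRho ρ m n})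

/-- The lift of the one-dimensional skeleton of the torus. -/
def skel : Set (ℝ × ℝ) :=
  {p : ℝ × ℝ | (∃ k : ℤ, p.1 = (k : ℝ)) ∨ (∃ k : ℤ, p.2 = (k : ℝ))}

/-- The rotation set of a map, with initial points ranging over a subset `X`. -/
def rotSetOn (F : ℝ × ℝ → ℝ × ℝ) (X : Set (ℝ × ℝ)) : Set (ℝ × ℝ) :=
  ⋂ m : ℕ, closure (⋃ n ∈ Set.Ioi m,
    {w : ℝ × ℝ | ∃ x ∈ X, w = ((n : ℝ))⁻¹ • (F^[n] x - x)})

/-- A degree one circle map with rotation number `ρ` that is constant around the integers, together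
with a semiconjugacy to the translation by `ρ` that vanishes around `0`. -/
structure PlateauMap (ρ : ℝ) where
  h : CircleDeg1Lift
  π : CircleDeg1Lift
  continuous_h : Continuous h
  semiconj : ∀ x, π (h x) = π x + ρ
  π_eq_zero : ∀ x, |x| ≤ 1 / 4 → π x = 0
  h_eq : ∀ x, |x| ≤ 1 / 4 → h x = h 0

section Existence

open CircleDeg1Lift

/-- The degree one map that vanishes on `[-1/4, 1/4]` and has slope `2` on `[1/4, 3/4]`. -/
noncomputable def plateauLift : CircleDeg1Lift where
  toFun x := ⌊x + 1 / 4⌋ + max 0 (2 * Int.fract (x + 1 / 4) - 1)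
  monotone' x y hxy := by
    have hx := Int.fract_lt_one (x + 1 / 4)
    have hy := Int.fract_nonneg (y + 1 / 4)
    have hle : ⌊x + 1 / 4⌋ ≤ ⌊y + 1 / 4⌋ := Int.floor_mono (by linarith)
    rcases hle.eq_or_lt with h | h
    · have : Int.fract (x + 1 / 4) ≤ Int.fract (y + 1 / 4) := by
        unfold Int.fract; rw [h]; linarith
      dsimp only
      rw [h]
      gcongr
    · have h' : (⌊x + 1 / 4⌋ : ℝ) + 1 ≤ ⌊y + 1 / 4⌋ := by exact_mod_cast h
      have h1 : max 0 (2 * Int.fract (x + 1 / 4) - 1) ≤ 1 := max_le (by norm_num) (by linarith)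
      have h2 : 0 ≤ max 0 (2 * Int.fract (y + 1 / 4) - 1) := le_max_left _ _
      dsimp only
      linarith
  map_add_one' x := by
    have : x + 1 + 1 / 4 = x + 1 / 4 + 1 := by ring
    rw [this, Int.floor_add_one, Int.fract_add_one]
    push_cast
    ring

lemma plateauLift_apply (x : ℝ) :
    plateauLift x = ⌊x + 1 / 4⌋ + max 0 (2 * Int.fract (x + 1 / 4) - 1) := rfl

lemma continuous_plateauLift : Continuous plateauLift := by
  rw [continuous_iff_surjective]
  intro y
  have h0 := Int.fract_nonneg y
  have h1 := Int.fract_lt_one y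
  have hv : ⌊(⌊y⌋ : ℝ) + (Int.fract y + 1) / 2⌋ = ⌊y⌋ := by
    have h2 : ⌊(Int.fract y + 1) / 2⌋ = 0 := Int.floor_eq_zero_iff.2 ⟨by linarith, by linarith⟩
    rw [Int.floor_intCast_add, h2, add_zero]
  refine ⟨⌊y⌋ + (Int.fract y + 1) / 2 - 1 / 4, ?_⟩
  rw [plateauLift_apply, sub_add_cancel, Int.fract.eq_1 (_ + _), hv, add_sub_cancel_left,
    max_eq_right (by linarith)]
  linarith [Int.floor_add_fract y]

lemma plateauLift_eq_zero {x : ℝ} (hx : |x| ≤ 1 / 4) : plateauLift x = 0 := by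
  obtain ⟨h1, h2⟩ := abs_le.1 hx
  have hf : ⌊x + 1 / 4⌋ = 0 := Int.floor_eq_zero_iff.2 ⟨by linarith, by linarith⟩
  rw [plateauLift_apply, Int.fract, hf, max_eq_left (by push_cast; linarith)]
  simp

/-- The translates of `plateauLift`. -/
noncomputable def shiftedPlateau (c : ℝ) : CircleDeg1Lift :=
  translate (Multiplicative.ofAdd c) * plateauLift

lemma shiftedPlateau_apply (c x : ℝ) : shiftedPlateau c x = c + plateauLift x := by
  rw [shiftedPlateau, mul_apply, translate_apply]

lemma continuous_iterate_shiftedPlateau (n : ℕ) :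
    Continuous fun c => (shiftedPlateau c ^ n) 0 := by
  induction n with
  | zero => simpa using continuous_const
  | succ n ih =>
    simp only [pow_succ', mul_apply, shiftedPlateau_apply]
    exact continuous_id.add (continuous_plateauLift.comp ih)

lemma continuous_translationNumber_shiftedPlateau :
    Continuous fun c => translationNumber (shiftedPlateau c) := by
  have : TendstoUniformly (fun (n : ℕ) c => (shiftedPlateau c ^ n) 0 / n)
      (fun c => translationNumber (shiftedPlateau c)) atTop := by
    rw [Metric.tendstoUniformly_iff]
    intro ε hε
    filter_upwards [(tendsto_one_div_atTop_nhds_zero_nat (𝕜 := ℝ)).eventually_lt_const hε,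
      eventually_gt_atTop 0] with n hn hn0 c
    have hn0' : (0 : ℝ) < n := by exact_mod_cast hn0
    have h := dist_pow_map_zero_mul_translationNumber_le (shiftedPlateau c) n
    refine lt_of_le_of_lt ?_ hn
    rw [dist_comm, Real.dist_eq] at *
    have e : (shiftedPlateau c ^ n) 0 / n - translationNumber (shiftedPlateau c) =
        ((shiftedPlateau c ^ n) 0 - n * translationNumber (shiftedPlateau c)) / n := by
      field_simp
    rw [abs_sub_comm] at h
    rw [e, abs_div, abs_of_pos hn0']
    gcongr
  exact this.continuous (Frequently.of_forall fun n =>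
    (continuous_iterate_shiftedPlateau n).div_const _)

lemma exists_translationNumber_shiftedPlateau {ρ : ℝ} (h0 : 0 < ρ) (h1 : ρ < 1) :
    ∃ c, translationNumber (shiftedPlateau c) = ρ := by
  have e0 : translationNumber (shiftedPlateau 0) = (0 : ℤ) :=
    translationNumber_of_eq_add_int _ (x := 0) (by
      rw [shiftedPlateau_apply, plateauLift_eq_zero (by norm_num)]; simp)
  have e1 : translationNumber (shiftedPlateau 1) = (1 : ℤ) :=
    translationNumber_of_eq_add_int _ (x := 0) (by
      rw [shiftedPlateau_apply, plateauLift_eq_zero (by norm_num)]; simp)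
  obtain ⟨c, -, hc⟩ := intermediate_value_Icc zero_le_one
    continuous_translationNumber_shiftedPlateau.continuousOn
    (show ρ ∈ Set.Icc _ _ by rw [e0, e1]; simpa using ⟨h0.le, h1.le⟩)
  exact ⟨c, hc⟩

lemma abs_iterate_sub_le (f : CircleDeg1Lift) (n : ℕ) (x : ℝ) :
    |f^[n] x - n * translationNumber f - x| ≤ 2 := by
  have h := dist_pow_map_zero_mul_translationNumber_le f n
  rw [Real.dist_eq, abs_le] at h
  have h1 := (f ^ n).map_le_of_map_zero x
  have h2 := (f ^ n).le_map_of_map_zero x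
  have h3 := Int.ceil_lt_add_one x
  have h4 := Int.sub_one_lt_floor x
  rw [coe_pow] at *
  rw [abs_le]
  constructor <;> linarith

/-- A degree one map is semiconjugate to the translation by its translation number. -/
lemma exists_semiconj_translation (f : CircleDeg1Lift) :
    ∃ g : CircleDeg1Lift, (∀ x, g (f x) = g x + translationNumber f) ∧
      ∀ x y, f x = f y → g x = g y := by
  set t := translationNumber f
  let u : ℝ → ℕ → ℝ := fun x n => f^[n] x - n * t
  have hu : ∀ x n, u x n ∈ Set.Icc (x - 2) (x + 2) := fun x n => by
    have := abs_le.1 (abs_iterate_sub_le f n x)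
    exact ⟨by linarith [this.1], by linarith [this.2]⟩
  have hba : ∀ x, IsBoundedUnder (· ≤ ·) atTop (u x) := fun x =>
    isBoundedUnder_of ⟨x + 2, fun n => (hu x n).2⟩
  have hbb : ∀ x, IsBoundedUnder (· ≥ ·) atTop (u x) := fun x =>
    isBoundedUnder_of ⟨x - 2, fun n => (hu x n).1⟩
  have hadd : ∀ x a, limsup (fun n => u x n + a) atTop = limsup (u x) atTop + a := fun x a =>
    limsup_add_const atTop (u x) a (hba x) (hbb x).isCoboundedUnder_le
  let g : CircleDeg1Lift :=
    { toFun := fun x => limsup (u x) atTop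
      monotone' := fun x y hxy => limsup_le_limsup
        (Eventually.of_forall fun n => sub_le_sub_right (f.monotone.iterate n hxy) _)
        (hbb x).isCoboundedUnder_le (hba y)
      map_add_one' := fun x => by
        rw [← hadd]
        congr 1
        ext n
        have := (f ^ n).map_add_one x
        rw [coe_pow] at this
        simp only [u, this]
        ring }
  have hg : ∀ x, g x = limsup (u x) atTop := fun _ => rfl
  have hsemi : ∀ x, g (f x) = g x + t := fun x => by
    rw [hg, hg, ← limsup_nat_add (u x) 1, ← limsup_add_const]
    · congr 1
      ext n
      simp only [u, Function.iterate_succ_apply]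
      push_cast
      ring
    · exact isBoundedUnder_of ⟨x + 2, fun n => (hu x _).2⟩
    · exact (isBoundedUnder_of ⟨x - 2, fun n => (hu x _).1⟩ :
        IsBoundedUnder (· ≥ ·) atTop _).isCoboundedUnder_le
  refine ⟨g, hsemi, fun x y hxy => ?_⟩
  have := hsemi x
  rw [hxy, hsemi] at this
  linarith

lemma exists_plateauMap {ρ : ℝ} (h0 : 0 < ρ) (h1 : ρ < 1) :
    Nonempty (PlateauMap ρ) := by
  obtain ⟨c, hc⟩ := exists_translationNumber_shiftedPlateau h0 h1
  have hcont : Continuous (shiftedPlateau c) := by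
    have : ⇑(shiftedPlateau c) = fun x => c + plateauLift x :=
      funext (shiftedPlateau_apply c)
    rw [this]
    exact continuous_const.add continuous_plateauLift
  have hconst : ∀ x, |x| ≤ 1 / 4 → shiftedPlateau c x = shiftedPlateau c 0 := fun x hx => by
    rw [shiftedPlateau_apply, shiftedPlateau_apply, plateauLift_eq_zero hx,
      plateauLift_eq_zero (by norm_num)]
  obtain ⟨g, hs, hfib⟩ := exists_semiconj_translation (shiftedPlateau c)
  have hπ : ∀ x, (translate (Multiplicative.ofAdd (-g 0)) * g : CircleDeg1Lift) x = -g 0 + g x :=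
    fun x => by rw [mul_apply, translate_apply]
  refine ⟨⟨shiftedPlateau c, translate (Multiplicative.ofAdd (-g 0)) * g, hcont, fun x => ?_,
    fun x hx => ?_, hconst⟩⟩
  · rw [hπ, hπ, hs, hc]
    ring
  · rw [hπ, hfib x 0 (hconst x hx)]
    ring

end Existence

section Bumps

open Real

/-- A `1`-periodic bump equal to `1` near the integers and to `0` away from them. -/
noncomputable def broadBump (y : ℝ) : ℝ := min 1 (max 0 (2 * cos (2 * π * y)))

/-- A `1`-periodic bump supported in the region where `broadBump` is `1`. -/
noncomputable def narrowBump (y : ℝ) : ℝ := max 0 (2 * cos (2 * π * y) - 1)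

lemma cos_two_pi_mul_add_int (y : ℝ) (k : ℤ) : cos (2 * π * (y + k)) = cos (2 * π * y) := by
  rw [mul_add, mul_comm (2 * π) (k : ℝ), cos_add_int_mul_two_pi]

lemma broadBump_add_int (y : ℝ) (k : ℤ) : broadBump (y + k) = broadBump y := by
  rw [broadBump, cos_two_pi_mul_add_int, broadBump]

lemma narrowBump_add_int (y : ℝ) (k : ℤ) : narrowBump (y + k) = narrowBump y := by
  rw [narrowBump, cos_two_pi_mul_add_int, narrowBump]

lemma continuous_broadBump : Continuous broadBump := by
  unfold broadBump; fun_prop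

lemma continuous_narrowBump : Continuous narrowBump := by
  unfold narrowBump; fun_prop

lemma broadBump_nonneg (y : ℝ) : 0 ≤ broadBump y := le_min zero_le_one (le_max_left _ _)

lemma broadBump_le_one (y : ℝ) : broadBump y ≤ 1 := min_le_left _ _

lemma narrowBump_nonneg (y : ℝ) : 0 ≤ narrowBump y := le_max_left _ _

lemma narrowBump_le_one (y : ℝ) : narrowBump y ≤ 1 :=
  max_le zero_le_one (by linarith [cos_le_one (2 * π * y)])

lemma narrowBump_zero : narrowBump 0 = 1 := by
  rw [narrowBump, mul_zero, cos_zero]; norm_num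

lemma broadBump_eq_one {y : ℝ} (h : narrowBump y ≠ 0) : broadBump y = 1 := by
  have h1 : 0 < 2 * cos (2 * π * y) - 1 := by
    by_contra h'
    exact h (max_eq_left (not_lt.1 h'))
  exact min_eq_left (le_max_of_le_right (by linarith))

lemma narrowBump_eq_zero {y : ℝ} (h : broadBump y = 0) : narrowBump y = 0 := by
  by_contra h'
  rw [broadBump_eq_one h'] at h
  exact one_ne_zero h

lemma exists_abs_sub_int_le {y : ℝ} (h : broadBump y ≠ 0) : ∃ k : ℤ, |y - k| ≤ 1 / 4 := by
  refine ⟨round y, ?_⟩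
  by_contra! h'
  have hr := abs_sub_round y
  refine h ?_
  have hc : cos (2 * π * y) < 0 := by
    rw [← cos_two_pi_mul_add_int y (-round y), ← cos_abs, abs_mul, abs_of_pos two_pi_pos]
    push_cast
    rw [← sub_eq_add_neg]
    have := pi_pos
    exact cos_neg_of_pi_div_two_lt_of_lt (by nlinarith) (by nlinarith)
  rw [broadBump, max_eq_left (by linarith), min_eq_right zero_le_one]

lemma exists_narrowBump_eq {t : ℝ} (h0 : 0 ≤ t) (h1 : t ≤ 1) :
    ∃ y ∈ Set.Icc (0 : ℝ) (1 / 4), narrowBump y = t := by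
  have e : narrowBump (1 / 4) = 0 := by
    rw [narrowBump, show 2 * π * (1 / 4) = π / 2 by ring, cos_pi_div_two]; norm_num
  exact intermediate_value_Icc' (by norm_num) continuous_narrowBump.continuousOn
    (show t ∈ Set.Icc _ _ by rw [e, narrowBump_zero]; exact ⟨h0, h1⟩)

lemma exists_broadBump_eq {t : ℝ} (h0 : 0 ≤ t) (h1 : t ≤ 1) :
    ∃ y ∈ Set.Icc (0 : ℝ) (1 / 4), narrowBump y = 0 ∧ broadBump y = t := by
  have e : broadBump (1 / 4) = 0 := by
    rw [broadBump, show 2 * π * (1 / 4) = π / 2 by ring, cos_pi_div_two]; norm_num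
  have e' : broadBump (1 / 6) = 1 := by
    rw [broadBump, show 2 * π * (1 / 6) = π / 3 by ring, cos_pi_div_three]; norm_num
  obtain ⟨y, hy, hyt⟩ := intermediate_value_Icc' (a := (1 / 6 : ℝ)) (b := 1 / 4) (by norm_num)
    continuous_broadBump.continuousOn
    (show t ∈ Set.Icc _ _ by rw [e, e']; exact ⟨h0, h1⟩)
  refine ⟨y, ⟨by linarith [hy.1], hy.2⟩, max_eq_left ?_, hyt⟩
  have hp := pi_pos
  have hc : cos (2 * π * y) ≤ cos (π / 3) :=
    cos_le_cos_of_nonneg_of_le_pi (by positivity) (by nlinarith [hy.2]) (by nlinarith [hy.1])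
  rw [cos_pi_div_three] at hc
  linarith

end Bumps

namespace PlateauMap

variable {ρ : ℝ} (P : PlateauMap ρ)

lemma abs_sub_le_of_map_zero {f : CircleDeg1Lift} (hf : f 0 = 0) (x : ℝ) : |f x - x| ≤ 1 := by
  have h1 := f.map_le_of_map_zero x
  have h2 := f.le_map_of_map_zero x
  have h3 := Int.ceil_lt_add_one x
  have h4 := Int.sub_one_lt_floor x
  rw [abs_le]
  constructor <;> linarith

/-- The conjugate of `P.h` by the translation by `P.h 0`; it is `0` on a plateau around
`-P.h 0`. -/
noncomputable def f : CircleDeg1Lift :=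
  ↑(CircleDeg1Lift.translate (Multiplicative.ofAdd (-P.h 0))) * P.h *
    ↑(CircleDeg1Lift.translate (Multiplicative.ofAdd (P.h 0)))

/-- The semiconjugacy from `P.f` to the translation by `ρ`, normalized to fix `0`. -/
noncomputable def φ : CircleDeg1Lift :=
  ↑(CircleDeg1Lift.translate (Multiplicative.ofAdd (-ρ))) * P.π *
    ↑(CircleDeg1Lift.translate (Multiplicative.ofAdd (P.h 0)))

lemma f_apply (x : ℝ) : P.f x = P.h (x + P.h 0) - P.h 0 := by
  simp only [f, CircleDeg1Lift.mul_apply, CircleDeg1Lift.translate_apply]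
  rw [add_comm x]; ring

lemma φ_apply (x : ℝ) : P.φ x = P.π (x + P.h 0) - ρ := by
  simp only [φ, CircleDeg1Lift.mul_apply, CircleDeg1Lift.translate_apply]
  rw [add_comm x]; ring

lemma continuous_f : Continuous P.f := by
  rw [funext P.f_apply]
  exact (P.continuous_h.comp (continuous_id.add continuous_const)).sub continuous_const

lemma π_zero : P.π 0 = 0 := P.π_eq_zero 0 (by norm_num)

lemma π_int (k : ℤ) : P.π k = k := by rw [P.π.map_int_of_map_zero, P.π_zero, zero_add]

lemma π_h_zero : P.π (P.h 0) = ρ := by rw [P.semiconj, P.π_zero, zero_add]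

lemma φ_zero : P.φ 0 = 0 := by rw [φ_apply, zero_add, π_h_zero, sub_self]

lemma φ_f (x : ℝ) : P.φ (P.f x) = P.φ x + ρ := by
  rw [φ_apply, f_apply, sub_add_cancel, P.semiconj, φ_apply]; ring

lemma π_iterate (n : ℕ) (x : ℝ) : P.π (P.h^[n] x) = P.π x + n * ρ := by
  induction n with
  | zero => simp
  | succ n ih => rw [Function.iterate_succ_apply', P.semiconj, ih]; push_cast; ring

lemma φ_iterate (n : ℕ) (x : ℝ) : P.φ (P.f^[n] x) = P.φ x + n * ρ := by
  induction n with
  | zero => simp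
  | succ n ih => rw [Function.iterate_succ_apply', P.φ_f, ih]; push_cast; ring

lemma π_eq_int {y : ℝ} {k : ℤ} (h : |y - k| ≤ 1 / 4) : P.π y = k := by
  have := P.π_eq_zero _ h
  rw [P.π.map_sub_int] at this
  linarith

lemma h_eq_of_near_int {y : ℝ} {k : ℤ} (h : |y - k| ≤ 1 / 4) : P.h y = P.h 0 + k := by
  have := P.h_eq _ h
  rw [P.h.map_sub_int] at this
  linarith

lemma f_eq_of_near_int {x : ℝ} {k : ℤ} (h : |x + P.h 0 - k| ≤ 1 / 4) : P.f x = k := by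
  rw [f_apply, P.h_eq_of_near_int h]; ring

lemma φ_eq_of_near_int {x : ℝ} {k : ℤ} (h : |x + P.h 0 - k| ≤ 1 / 4) : P.φ x = k - ρ := by
  rw [φ_apply, P.π_eq_int h]

lemma lt_of_π_lt {x y : ℝ} (h : P.π x < P.π y) : x < y := P.π.monotone.reflect_lt h

lemma lt_of_φ_lt {x y : ℝ} (h : P.φ x < P.φ y) : x < y := P.φ.monotone.reflect_lt h

variable (h0 : 0 < ρ)
include h0

lemma quarter_lt_h_zero : 1 / 4 < P.h 0 :=
  P.lt_of_π_lt (by rw [π_h_zero, P.π_eq_zero _ (by norm_num [abs_of_pos])]; exact h0)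

lemma f_zero_pos : 0 < P.f 0 := P.lt_of_φ_lt (by rw [φ_f, φ_zero]; linarith)

end PlateauMap

namespace PlateauMap

variable {ρ : ℝ} (P : PlateauMap ρ)

lemma broadBump_eq_zero_of_π {y : ℝ} (h : ∀ k : ℤ, P.π y ≠ k) : broadBump y = 0 := by
  by_contra h'
  obtain ⟨k, hk⟩ := exists_abs_sub_int_le h'
  exact h k (P.π_eq_int hk)

open Classical in
/-- The skeleton map: horizontal lines move by `P.f` and vertical lines by `P.h`, with excursions
into the transversal lines over the plateaus. -/
noncomputable def skelMap (p : ℝ × ℝ) : ℝ × ℝ :=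
  if ∃ k : ℤ, p.2 = k then (P.f p.1, p.2 + P.h 0 * narrowBump (p.1 + P.h 0))
  else (p.1 + P.f 0 * narrowBump p.2, P.h p.2 - P.h 0 * broadBump p.2)

lemma skelMap_horizontal (x : ℝ) (k : ℤ) :
    P.skelMap (x, k) = (P.f x, k + P.h 0 * narrowBump (x + P.h 0)) := by
  rw [skelMap, if_pos ⟨k, rfl⟩]

lemma mem_skel_horizontal (x : ℝ) (k : ℤ) : (x, (k : ℝ)) ∈ skel := Or.inr ⟨k, rfl⟩

lemma mem_skel_vertical (k : ℤ) (y : ℝ) : ((k : ℝ), y) ∈ skel := Or.inl ⟨k, rfl⟩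

/-- The image of a point on a horizontal line stays on this line or lies above a lattice point. -/
lemma skelMap_horizontal_cases (x : ℝ) (k : ℤ) :
    P.skelMap (x, k) = (P.f x, (k : ℝ)) ∨
      ∃ l : ℤ, P.φ x = l - ρ ∧
        P.skelMap (x, k) = ((l : ℝ), k + P.h 0 * narrowBump (x + P.h 0)) := by
  rw [skelMap_horizontal]
  by_cases h : narrowBump (x + P.h 0) = 0
  · left; rw [h, mul_zero, add_zero]
  · right
    obtain ⟨l, hl⟩ := exists_abs_sub_int_le (y := x + P.h 0) (by rw [broadBump_eq_one h]; simp)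
    exact ⟨l, P.φ_eq_of_near_int hl, by rw [P.f_eq_of_near_int hl]⟩

variable (hirr : Irrational ρ)
include hirr

lemma broadBump_h_zero : broadBump (P.h 0) = 0 :=
  P.broadBump_eq_zero_of_π fun k => by rw [π_h_zero]; exact hirr.ne_int k

lemma skelMap_vertical (k : ℤ) (y : ℝ) :
    P.skelMap (k, y) = (k + P.f 0 * narrowBump y, P.h y - P.h 0 * broadBump y) := by
  by_cases h : ∃ l : ℤ, y = l
  · obtain ⟨l, rfl⟩ := h
    have hn : narrowBump (l : ℝ) = 1 := by
      rw [← zero_add (l : ℝ), narrowBump_add_int, narrowBump_zero]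
    have hb : broadBump (l : ℝ) = 1 := broadBump_eq_one (by rw [hn]; exact one_ne_zero)
    rw [skelMap_horizontal, hn, hb, add_comm (k : ℝ) (P.h 0), narrowBump_add_int,
      narrowBump_eq_zero (P.broadBump_h_zero hirr), P.f.map_int_of_map_zero,
      P.h.map_int_of_map_zero]
    ext <;> simp [add_comm]
  · rw [skelMap, if_neg h]

lemma continuousOn_skelMap : ContinuousOn P.skelMap skel := by
  have hZ : IsClosed (Set.range ((↑) : ℤ → ℝ)) := Int.isClosedEmbedding_coe_real.isClosed_range
  have hs : skel = Prod.fst ⁻¹' Set.range ((↑) : ℤ → ℝ) ∪ Prod.snd ⁻¹' Set.range ((↑) : ℤ → ℝ) := by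
    ext p
    simp only [skel, Set.mem_ofPred_eq, Set.mem_union, Set.mem_preimage, Set.mem_range, eq_comm]
  have hf := P.continuous_f
  have hh := P.continuous_h
  have hn := continuous_narrowBump
  have hb := continuous_broadBump
  rw [hs]
  refine ContinuousOn.union_of_isClosed ?_ ?_ (hZ.preimage continuous_fst)
    (hZ.preimage continuous_snd)
  · refine ContinuousOn.congr (f := fun p : ℝ × ℝ =>
      (p.1 + P.f 0 * narrowBump p.2, P.h p.2 - P.h 0 * broadBump p.2)) ?_ ?_
    · exact Continuous.continuousOn (by fun_prop)
    · rintro ⟨_, y⟩ ⟨k, rfl⟩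
      exact P.skelMap_vertical hirr k y
  · refine ContinuousOn.congr (f := fun p : ℝ × ℝ =>
      (P.f p.1, p.2 + P.h 0 * narrowBump (p.1 + P.h 0))) ?_ ?_
    · exact Continuous.continuousOn (by fun_prop)
    · rintro ⟨x, _⟩ ⟨k, rfl⟩
      exact P.skelMap_horizontal x k

lemma skelMap_add_int {p : ℝ × ℝ} (hp : p ∈ skel) (v : ℤ × ℤ) :
    P.skelMap (p + ((v.1 : ℝ), (v.2 : ℝ))) = P.skelMap p + ((v.1 : ℝ), (v.2 : ℝ)) := by
  obtain ⟨x, y⟩ := p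
  obtain ⟨a, b⟩ := v
  rcases hp with ⟨k, hk⟩ | ⟨k, hk⟩ <;> dsimp only at hk <;> subst hk
  · have := P.skelMap_vertical hirr (k + a) (y + b)
    push_cast at this
    rw [Prod.mk_add_mk, this, P.skelMap_vertical hirr, narrowBump_add_int, broadBump_add_int,
      P.h.map_add_int]
    ext <;> simp <;> ring
  · have := P.skelMap_horizontal (x + a) (k + b)
    push_cast at this
    rw [Prod.mk_add_mk, this, P.skelMap_horizontal, add_right_comm x, narrowBump_add_int,
      P.f.map_add_int]
    ext <;> (simp; try ring)

/-- The image of a point on a vertical line stays on this line or lies beside a lattice point. -/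
lemma skelMap_vertical_cases (k : ℤ) (y : ℝ) :
    P.skelMap (k, y) = ((k : ℝ), P.h y - P.h 0 * broadBump y) ∨
      ∃ l : ℤ, P.π y = l ∧ P.skelMap (k, y) = (k + P.f 0 * narrowBump y, (l : ℝ)) := by
  rw [P.skelMap_vertical hirr]
  by_cases h : narrowBump y = 0
  · left; rw [h, mul_zero, add_zero]
  · right
    have hb := broadBump_eq_one h
    obtain ⟨l, hl⟩ := exists_abs_sub_int_le (y := y) (by rw [hb]; simp)
    exact ⟨l, P.π_eq_int hl, by rw [P.h_eq_of_near_int hl, hb]; ext <;> simp⟩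

lemma mapsTo_skelMap : Set.MapsTo P.skelMap skel skel := by
  rintro ⟨x, y⟩ (⟨k, hk⟩ | ⟨k, hk⟩) <;> dsimp only at hk <;> subst hk
  · rcases P.skelMap_vertical_cases hirr k y with h | ⟨l, -, h⟩ <;> rw [h]
    exacts [mem_skel_vertical _ _, mem_skel_horizontal _ _]
  · rcases P.skelMap_horizontal_cases x k with h | ⟨l, -, h⟩ <;> rw [h]
    exacts [mem_skel_horizontal _ _, mem_skel_vertical _ _]

lemma iterate_skelMap_mem {p : ℝ × ℝ} (hp : p ∈ skel) (n : ℕ) : P.skelMap^[n] p ∈ skel :=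
  (P.mapsTo_skelMap hirr).iterate n hp

lemma iterate_skelMap_add_int {p : ℝ × ℝ} (hp : p ∈ skel) (v : ℤ × ℤ) (n : ℕ) :
    P.skelMap^[n] (p + ((v.1 : ℝ), (v.2 : ℝ))) = P.skelMap^[n] p + ((v.1 : ℝ), (v.2 : ℝ)) := by
  induction n with
  | zero => rfl
  | succ n ih =>
    rw [Function.iterate_succ_apply', ih,
      P.skelMap_add_int hirr (P.iterate_skelMap_mem hirr hp n), Function.iterate_succ_apply']

variable (h0 : 0 < ρ)
include h0

lemma le_skelMap {p : ℝ × ℝ} (hp : p ∈ skel) :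
    P.φ p.1 ≤ P.φ (P.skelMap p).1 ∧ P.π p.2 ≤ P.π (P.skelMap p).2 := by
  have hh := P.quarter_lt_h_zero h0
  have hf := P.f_zero_pos h0
  obtain ⟨x, y⟩ := p
  rcases hp with ⟨k, hk⟩ | ⟨k, hk⟩ <;> dsimp only at hk <;> subst hk
  · rw [P.skelMap_vertical hirr]
    refine ⟨P.φ.monotone (le_add_of_nonneg_right (mul_nonneg hf.le (narrowBump_nonneg y))), ?_⟩
    by_cases h : broadBump y = 0
    · simp only [h, mul_zero, sub_zero, P.semiconj]
      linarith
    · obtain ⟨l, hl⟩ := exists_abs_sub_int_le h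
      dsimp only
      rw [P.π_eq_int hl, P.h_eq_of_near_int hl]
      refine (P.π_int l).ge.trans (P.π.monotone ?_)
      nlinarith [broadBump_le_one y]
  · rw [skelMap_horizontal]
    refine ⟨by dsimp only; rw [φ_f]; linarith, P.π.monotone ?_⟩
    exact le_add_of_nonneg_right (mul_nonneg (by linarith) (narrowBump_nonneg _))

lemma sub_two_le_iterate_skelMap {p : ℝ × ℝ} (hp : p ∈ skel) (n : ℕ) :
    p.1 - 2 ≤ (P.skelMap^[n] p).1 ∧ p.2 - 2 ≤ (P.skelMap^[n] p).2 := by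
  have key : P.φ p.1 ≤ P.φ (P.skelMap^[n] p).1 ∧ P.π p.2 ≤ P.π (P.skelMap^[n] p).2 := by
    induction n with
    | zero => exact ⟨le_rfl, le_rfl⟩
    | succ n ih =>
      have := P.le_skelMap hirr h0 (P.iterate_skelMap_mem hirr hp n)
      rw [Function.iterate_succ_apply']
      exact ⟨ih.1.trans this.1, ih.2.trans this.2⟩
  have a1 := abs_le.1 (abs_sub_le_of_map_zero P.φ_zero p.1)
  have a2 := abs_le.1 (abs_sub_le_of_map_zero P.φ_zero (P.skelMap^[n] p).1)
  have b1 := abs_le.1 (abs_sub_le_of_map_zero P.π_zero p.2)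
  have b2 := abs_le.1 (abs_sub_le_of_map_zero P.π_zero (P.skelMap^[n] p).2)
  constructor <;> linarith [key.1, key.2, a1.1, a1.2, a2.1, a2.2, b1.1, b1.2, b2.1, b2.2]

end PlateauMap

section Admissible

variable {ρ : ℝ} (hirr : Irrational ρ) (h0 : 0 < ρ) (h1 : ρ < 1)

include h0 h1 in
/-- Every natural number is the ceiling of an admissible multiple of `ρ`. -/
lemma exists_alphaSeq_lt (k : ℕ) :
    ∃ m : ℕ, alphaSeq ρ m < ρ ∧ (m : ℝ) * ρ ≤ k ∧ ⌈(m : ℝ) * ρ⌉ = k := by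
  have hk : (0 : ℝ) ≤ k / ρ := by positivity
  have ha : (⌊(k : ℝ) / ρ⌋₊ : ℝ) * ρ ≤ k := by
    rw [← le_div_iff₀ h0]; exact Nat.floor_le hk
  have hb : (k : ℝ) < (⌊(k : ℝ) / ρ⌋₊ + 1) * ρ := by
    rw [← div_lt_iff₀ h0]; exact Nat.lt_floor_add_one _
  have hc : ⌈(⌊(k : ℝ) / ρ⌋₊ : ℝ) * ρ⌉ = k := by
    rw [Int.ceil_eq_iff]
    push_cast
    exact ⟨by linarith, ha⟩
  refine ⟨⌊(k : ℝ) / ρ⌋₊, ?_, ha, hc⟩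
  rw [alphaSeq, hc]
  push_cast
  linarith

/-- The inequality defining a half-plane with normal `(α, β)` that contains the admissible
vectors. -/
def BoundsAdmissible (ρ α β M : ℝ) : Prop :=
  ∀ m n : ℕ, alphaSeq ρ m < ρ → alphaSeq ρ n < ρ →
    α * ⌈(m : ℝ) * ρ⌉ + β * ⌈(n : ℝ) * ρ⌉ ≤ M * (m + n + 1)

namespace BoundsAdmissible

variable {α β M : ℝ} (h : BoundsAdmissible ρ α β M)
include h

lemma swap : BoundsAdmissible ρ β α M := fun m n hm hn => by
  have := h n m hn hm
  linarith

include h0 in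
lemma nonneg : 0 ≤ M := by
  have := h 0 0 (by simpa [alphaSeq] using h0) (by simpa [alphaSeq] using h0)
  simpa using this

include h0 h1 in
lemma mul_le : α * ρ ≤ M := by
  have hM := h.nonneg h0
  by_contra! hlt
  obtain ⟨k, hk⟩ := exists_nat_gt (M / (α - M / ρ))
  have hpos : 0 < α - M / ρ := by
    rw [sub_pos, div_lt_iff₀ h0]; exact hlt
  rw [div_lt_iff₀ hpos] at hk
  obtain ⟨m, hm, hmk, hc⟩ := exists_alphaSeq_lt h0 h1 k
  have := h m 0 hm (by simpa [alphaSeq] using h0)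
  rw [hc] at this
  have hmk' : (m : ℝ) ≤ k / ρ := by rwa [le_div_iff₀ h0]
  have h3 : M * m ≤ M * (k / ρ) := by gcongr
  have h4 : M * (k / ρ) = k * (M / ρ) := by ring
  simp at this
  linarith

include hirr h0 h1 in
lemma floor_le (m n : ℕ) :
    α * ⌊ρ + m * ρ⌋ + β * ⌊ρ + n * ρ⌋ ≤ M * (m + n + 1) := by
  have key : ∀ m : ℕ, ∃ i : ℕ, i ≤ m ∧ alphaSeq ρ i < ρ ∧ ⌈(i : ℝ) * ρ⌉ = ⌊ρ + m * ρ⌋ := by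
    intro m
    have hnn : (0 : ℤ) ≤ ⌊ρ + m * ρ⌋ := Int.floor_nonneg.2 (by positivity)
    obtain ⟨k, hk⟩ := Int.eq_ofNat_of_zero_le hnn
    obtain ⟨i, hi, hik, hc⟩ := exists_alphaSeq_lt h0 h1 k
    refine ⟨i, ?_, hi, by rw [hc, hk]⟩
    have hle : (k : ℝ) ≤ ρ + m * ρ := by
      have := Int.floor_le (ρ + m * ρ)
      rw [hk] at this
      exact_mod_cast this
    have hne : (k : ℝ) ≠ ρ + m * ρ := fun he => by
      have h2 : Irrational (((m + 1 : ℕ) : ℝ) * ρ) := hirr.natCast_mul (by omega)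
      exact h2.ne_nat k (by rw [he]; push_cast; ring)
    have hlt : (i : ℝ) * ρ < (m + 1) * ρ :=
      lt_of_le_of_lt hik (by rw [add_mul, one_mul, add_comm]; exact lt_of_le_of_ne hle hne)
    have : (i : ℝ) < m + 1 := lt_of_mul_lt_mul_right hlt h0.le
    have : i < m + 1 := by exact_mod_cast this
    omega
  obtain ⟨i, him, hi, hci⟩ := key m
  obtain ⟨j, hjn, hj, hcj⟩ := key n
  rw [← hci, ← hcj]
  refine (h i j hi hj).trans ?_
  have := h.nonneg h0
  gcongr

end BoundsAdmissible

/-- The best value, over all future times, of the gain `γ` per lattice crossing minus the cost `M`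
per unit of time, for a point moving from `θ` with speed `ρ`. -/
noncomputable def optimalGain (ρ M γ θ : ℝ) : ℝ := ⨆ n : ℕ, (γ * ⌊θ + n * ρ⌋ - M * n)

section optimalGain

variable {M γ : ℝ} (hγ : 0 ≤ γ) (hM : γ * ρ ≤ M)
include hγ hM

lemma gain_le (θ : ℝ) (n : ℕ) : γ * ⌊θ + n * ρ⌋ - M * n ≤ γ * θ := by
  have h1 : γ * ⌊θ + n * ρ⌋ ≤ γ * (θ + n * ρ) := by gcongr; exact Int.floor_le _
  have h2 : (γ * ρ) * n ≤ M * n := by gcongr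
  linarith

lemma bddAbove_gain (θ : ℝ) : BddAbove (Set.range fun n : ℕ => γ * ⌊θ + n * ρ⌋ - M * n) :=
  ⟨γ * θ, by rintro _ ⟨n, rfl⟩; exact gain_le hγ hM θ n⟩

lemma optimalGain_le (θ : ℝ) : optimalGain ρ M γ θ ≤ γ * θ :=
  ciSup_le fun n => gain_le hγ hM θ n

lemma floor_le_optimalGain (θ : ℝ) : γ * ⌊θ⌋ ≤ optimalGain ρ M γ θ := by
  simpa [optimalGain] using le_ciSup (bddAbove_gain hγ hM θ) 0

lemma sub_le_optimalGain (θ : ℝ) : γ * θ - γ ≤ optimalGain ρ M γ θ := by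
  refine le_trans ?_ (floor_le_optimalGain hγ hM θ)
  have := mul_le_mul_of_nonneg_left (Int.sub_one_lt_floor θ).le hγ
  linarith

lemma monotone_optimalGain : Monotone (optimalGain ρ M γ) := fun θ θ' hθ =>
  ciSup_mono (bddAbove_gain hγ hM θ') fun n => by gcongr

lemma optimalGain_add_rho (θ : ℝ) : optimalGain ρ M γ (θ + ρ) ≤ optimalGain ρ M γ θ + M := by
  refine ciSup_le fun n => ?_
  have := le_ciSup (bddAbove_gain hγ hM θ) (n + 1)
  have e : θ + ((n + 1 : ℕ) : ℝ) * ρ = θ + ρ + n * ρ := by push_cast; ring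
  rw [e] at this
  push_cast at this
  rw [optimalGain]
  linarith

lemma optimalGain_add_int (θ : ℝ) (k : ℤ) :
    optimalGain ρ M γ (k + θ) ≤ γ * k + optimalGain ρ M γ θ := by
  refine ciSup_le fun n => ?_
  have := le_ciSup (bddAbove_gain hγ hM θ) n
  rw [add_assoc, Int.floor_intCast_add]
  push_cast
  rw [optimalGain]
  linarith

end optimalGain

include hirr h0 h1 in
lemma optimalGain_add_optimalGain_le {α β M : ℝ} (h : BoundsAdmissible ρ α β M) :
    optimalGain ρ M α ρ + optimalGain ρ M β ρ ≤ M := by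
  rw [← le_sub_iff_add_le]
  refine ciSup_le fun m => ?_
  rw [le_sub_comm]
  refine ciSup_le fun n => ?_
  have := h.floor_le hirr h0 h1 m n
  linarith

end Admissible

namespace PlateauMap

variable {ρ : ℝ} (P : PlateauMap ρ)

/-- The potential of `z`, measured along one of the lines of the skeleton through `z`, is at
most `K`. -/
def PotentialLE (α β M : ℝ) (z : ℝ × ℝ) (K : ℝ) : Prop :=
  (∃ k : ℤ, z.2 = k ∧ β * k + optimalGain ρ M α (P.φ z.1) + optimalGain ρ M β ρ ≤ K) ∨
    ∃ k : ℤ, z.1 = k ∧ α * k + optimalGain ρ M β (P.π z.2) ≤ K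

variable (hirr : Irrational ρ) (h0 : 0 < ρ) (h1 : ρ < 1) {α β M : ℝ} (hα : 0 ≤ α) (hβ : 0 ≤ β)
  (hM : BoundsAdmissible ρ α β M)
include hirr h0 h1 hα hβ hM

lemma PotentialLE.skelMap {z : ℝ × ℝ} {K : ℝ} (hz : P.PotentialLE α β M z K) :
    P.PotentialLE α β M (P.skelMap z) (K + M) := by
  have hαM := hM.mul_le h0 h1
  have hβM := hM.swap.mul_le h0 h1
  have hh := P.quarter_lt_h_zero h0
  have hf := P.f_zero_pos h0
  obtain ⟨x, y⟩ := z
  rcases hz with ⟨k, hk, hz⟩ | ⟨k, hk, hz⟩ <;> dsimp only at hk hz <;> subst hk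
  · rcases P.skelMap_horizontal_cases x k with h | ⟨l, hl, h⟩ <;> rw [h]
    · refine Or.inl ⟨k, rfl, ?_⟩
      dsimp only
      rw [φ_f]
      linarith [optimalGain_add_rho hα hαM (P.φ x)]
    · refine Or.inr ⟨l, rfl, ?_⟩
      have e1 : P.π (k + P.h 0 * narrowBump (x + P.h 0)) ≤ k + ρ := by
        rw [P.π.map_int_add, add_le_add_iff_left]
        exact (P.π.monotone (mul_le_of_le_one_right (by linarith) (narrowBump_le_one _))).trans
          P.π_h_zero.le
      have e2 := (monotone_optimalGain hβ hβM e1).trans (optimalGain_add_int hβ hβM ρ k)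
      have e3 := optimalGain_add_rho hα hαM (P.φ x)
      have e4 := floor_le_optimalGain hα hαM l
      rw [hl, sub_add_cancel] at e3
      rw [Int.floor_intCast] at e4
      rw [hl] at hz
      dsimp only
      linarith
  · rcases P.skelMap_vertical_cases hirr k y with h | ⟨l, hl, h⟩ <;> rw [h]
    · refine Or.inr ⟨k, rfl, ?_⟩
      have e1 : P.π (P.h y - P.h 0 * broadBump y) ≤ P.π y + ρ := by
        rw [← P.semiconj]
        exact P.π.monotone (sub_le_self _ (mul_nonneg (by linarith) (broadBump_nonneg y)))
      have e2 := (monotone_optimalGain hβ hβM e1).trans (optimalGain_add_rho hβ hβM _)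
      dsimp only
      linarith
    · refine Or.inl ⟨l, rfl, ?_⟩
      have e1 : P.φ (k + P.f 0 * narrowBump y) ≤ k + ρ := by
        have : P.φ (P.f 0) = ρ := by rw [φ_f, φ_zero, zero_add]
        rw [P.φ.map_int_add, add_le_add_iff_left]
        exact (P.φ.monotone (mul_le_of_le_one_right hf.le (narrowBump_le_one _))).trans this.le
      have e2 := (monotone_optimalGain hα hαM e1).trans (optimalGain_add_int hα hαM ρ k)
      have e3 := optimalGain_add_optimalGain_le hirr h0 h1 hM
      have e4 := floor_le_optimalGain hβ hβM l
      rw [Int.floor_intCast] at e4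
      rw [hl] at hz
      dsimp only
      linarith

lemma PotentialLE.iterate_skelMap {z : ℝ × ℝ} {K : ℝ} (hz : P.PotentialLE α β M z K) (n : ℕ) :
    P.PotentialLE α β M (P.skelMap^[n] z) (K + n * M) := by
  induction n with
  | zero => simpa using hz
  | succ n ih =>
    rw [Function.iterate_succ_apply']
    convert PotentialLE.skelMap P hirr h0 h1 hα hβ hM ih using 1
    push_cast
    ring

omit hirr in
lemma PotentialLE.le {z : ℝ × ℝ} {K : ℝ} (hz : P.PotentialLE α β M z K) :
    α * z.1 + β * z.2 ≤ K + 2 * (α + β) := by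
  have hαM := hM.mul_le h0 h1
  have hβM := hM.swap.mul_le h0 h1
  rcases hz with ⟨k, hk, hz⟩ | ⟨k, hk, hz⟩ <;> rw [hk]
  · have a1 := sub_le_optimalGain hα hαM (P.φ z.1)
    have a2 := sub_le_optimalGain hβ hβM ρ
    have a3 := (abs_le.1 (abs_sub_le_of_map_zero P.φ_zero z.1)).1
    have a4 : α * (z.1 - 1) ≤ α * P.φ z.1 := by gcongr; linarith
    have a5 : 0 ≤ β * ρ := by positivity
    linarith
  · have a1 := sub_le_optimalGain hβ hβM (P.π z.2)
    have a3 := (abs_le.1 (abs_sub_le_of_map_zero P.π_zero z.2)).1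
    have a4 : β * (z.2 - 1) ≤ β * P.π z.2 := by gcongr; linarith
    linarith

omit hirr in
lemma potentialLE_of_mem_skel {z : ℝ × ℝ} (hz : z ∈ skel) :
    P.PotentialLE α β M z (α * z.1 + β * z.2 + (α + 2 * β)) := by
  have hαM := hM.mul_le h0 h1
  have hβM := hM.swap.mul_le h0 h1
  rcases hz with ⟨k, hk⟩ | ⟨k, hk⟩
  · refine Or.inr ⟨k, hk, ?_⟩
    have a1 := optimalGain_le hβ hβM (P.π z.2)
    have a3 := (abs_le.1 (abs_sub_le_of_map_zero P.π_zero z.2)).2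
    have a4 : β * P.π z.2 ≤ β * (z.2 + 1) := by gcongr; linarith
    rw [hk]
    linarith
  · refine Or.inl ⟨k, hk, ?_⟩
    have a1 := optimalGain_le hα hαM (P.φ z.1)
    have a2 := optimalGain_le hβ hβM ρ
    have a3 := (abs_le.1 (abs_sub_le_of_map_zero P.φ_zero z.1)).2
    have a4 : α * P.φ z.1 ≤ α * (z.1 + 1) := by gcongr; linarith
    have a5 : β * ρ ≤ β * 1 := by gcongr
    rw [hk]
    linarith

lemma iterate_skelMap_sub_le {z : ℝ × ℝ} (hz : z ∈ skel) (n : ℕ) :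
    α * (P.skelMap^[n] z - z).1 + β * (P.skelMap^[n] z - z).2 ≤ n * M + (3 * α + 4 * β) := by
  have h := PotentialLE.le P h0 h1 hα hβ hM (PotentialLE.iterate_skelMap P hirr h0 h1 hα hβ hM
    (P.potentialLE_of_mem_skel h0 h1 hα hβ hM hz) n)
  simp only [Prod.fst_sub, Prod.snd_sub]
  linarith

end PlateauMap

/-- A linear bound on the displacements, up to a constant, bounds the rotation set. -/
lemma le_of_mem_rotSetOn {F : ℝ × ℝ → ℝ × ℝ} {X : Set (ℝ × ℝ)} {α β M C : ℝ}
    (hC : ∀ x ∈ X, ∀ n : ℕ, α * (F^[n] x - x).1 + β * (F^[n] x - x).2 ≤ n * M + C)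
    {w : ℝ × ℝ} (hw : w ∈ rotSetOn F X) : α * w.1 + β * w.2 ≤ M := by
  have key : ∀ m : ℕ, 0 < m → α * w.1 + β * w.2 ≤ M + |C| / m := by
    intro m hm
    have hcl : IsClosed {v : ℝ × ℝ | α * v.1 + β * v.2 ≤ M + |C| / m} :=
      isClosed_le (by fun_prop) continuous_const
    refine closure_minimal ?_ hcl (Set.mem_iInter.1 hw m)
    refine Set.iUnion₂_subset fun n hn => ?_
    rintro _ ⟨x, hx, rfl⟩
    have hm' : (0 : ℝ) < m := by exact_mod_cast hm
    have hn' : (m : ℝ) < n := by exact_mod_cast Set.mem_Ioi.1 hn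
    have hn0 : (0 : ℝ) < n := hm'.trans hn'
    have h1 := hC x hx n
    have h2 : C / n ≤ |C| / m := by
      gcongr
      exact le_abs_self C
    have h3 : (n : ℝ)⁻¹ * (n * M + C) = M + C / n := by field_simp
    have h4 := mul_le_mul_of_nonneg_left h1 (inv_nonneg.2 hn0.le)
    simp only [Set.mem_ofPred_eq, Prod.smul_fst, Prod.smul_snd, smul_eq_mul]
    linarith
  have ht : Tendsto (fun m : ℕ => M + |C| / m) atTop (𝓝 (M + 0)) :=
    (tendsto_const_div_atTop_nhds_zero_nat |C|).const_add M
  rw [add_zero] at ht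
  exact ge_of_tendsto ht ((eventually_gt_atTop 0).mono key)

namespace PlateauMap

variable {ρ : ℝ} (P : PlateauMap ρ) (hirr : Irrational ρ) (h0 : 0 < ρ)

lemma iterate_skelMap_horizontal {x : ℝ} (Y : ℤ) {n : ℕ}
    (h : ∀ j < n, ∀ k : ℤ, P.φ x + j * ρ + ρ ≠ k) :
    P.skelMap^[n] (x, Y) = (P.f^[n] x, (Y : ℝ)) := by
  induction n with
  | zero => rfl
  | succ n ih =>
    rw [Function.iterate_succ_apply', ih fun j hj => h j (hj.trans n.lt_succ_self),
      Function.iterate_succ_apply']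
    rcases P.skelMap_horizontal_cases (P.f^[n] x) Y with he | ⟨l, hl, -⟩
    · exact he
    · rw [φ_iterate] at hl
      exact absurd (by linarith) (h n n.lt_succ_self l)

include hirr in
lemma iterate_skelMap_vertical (X : ℤ) {y : ℝ} {n : ℕ}
    (h : ∀ j < n, ∀ k : ℤ, P.π y + j * ρ ≠ k) :
    P.skelMap^[n] (X, y) = ((X : ℝ), P.h^[n] y) := by
  induction n with
  | zero => rfl
  | succ n ih =>
    rw [Function.iterate_succ_apply', ih fun j hj => h j (hj.trans n.lt_succ_self),
      Function.iterate_succ_apply', P.skelMap_vertical hirr]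
    have hb : broadBump (P.h^[n] y) = 0 := P.broadBump_eq_zero_of_π fun k => by
      rw [π_iterate]; exact h n n.lt_succ_self k
    rw [narrowBump_eq_zero hb, hb]
    simp

include hirr in
lemma natCast_mul_ne_int {n : ℕ} (hn : n ≠ 0) (k : ℤ) : (n : ℝ) * ρ ≠ k :=
  (hirr.natCast_mul hn).ne_int k

include hirr in
lemma ceil_sub_mem_Ioo {n : ℕ} (hn : n ≠ 0) (ha : alphaSeq ρ n < ρ) :
    (⌈(n : ℝ) * ρ⌉ : ℝ) - n * ρ ∈ Set.Ioo 0 ρ :=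
  ⟨sub_pos.2 (lt_of_le_of_ne (Int.le_ceil _) (natCast_mul_ne_int hirr hn _)), ha⟩

include hirr h0 in
/-- Starting just above a lattice point, one turns right, runs along a horizontal line, and turns
up again. -/
lemma exists_iterate_horizontal {m : ℕ} (hm : alphaSeq ρ m < ρ) (l : ℤ) {y' : ℝ}
    (hy' : y' ∈ Set.Icc 0 (P.h 0)) :
    ∃ y ∈ Set.Icc (0 : ℝ) (1 / 4),
      P.skelMap^[m + 1] (0, y + l) = ((⌈(m : ℝ) * ρ⌉ : ℝ), y' + l) := by
  have hh : 0 < P.h 0 := (by norm_num : (0 : ℝ) < 1 / 4).trans (P.quarter_lt_h_zero h0)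
  have hf := P.f_zero_pos h0
  have hstep : ∀ y ∈ Set.Icc (0 : ℝ) (1 / 4), P.skelMap (0, y + l) =
      (P.f 0 * narrowBump y, P.h 0 + l - P.h 0 * broadBump y) := by
    intro y hy
    have := P.skelMap_vertical hirr 0 (y + l)
    rw [narrowBump_add_int, broadBump_add_int, P.h.map_add_int,
      P.h_eq y (by rw [abs_of_nonneg hy.1]; exact hy.2)] at this
    simpa using this
  rcases Nat.eq_zero_or_pos m with rfl | hpos
  · obtain ⟨y, hy, hn, hb⟩ := exists_broadBump_eq (t := 1 - y' / P.h 0)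
      (by rw [sub_nonneg, div_le_one hh]; exact hy'.2)
      (sub_le_self _ (div_nonneg hy'.1 hh.le))
    refine ⟨y, hy, ?_⟩
    rw [zero_add, Function.iterate_one, hstep y hy, hn, hb]
    ext
    · simp
    · dsimp only; field_simp; ring
  · obtain ⟨z, hz, hzt⟩ := exists_narrowBump_eq (t := y' / P.h 0)
      (div_nonneg hy'.1 hh.le) (by rw [div_le_one hh]; exact hy'.2)
    obtain ⟨m, rfl⟩ : ∃ i, m = i + 1 := ⟨m - 1, by omega⟩
    set k : ℤ := ⌈((m + 1 : ℕ) : ℝ) * ρ⌉ with hk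
    obtain ⟨x, hx⟩ := ((P.f.continuous_iff_surjective.1 P.continuous_f).iterate m)
      (k + z - P.h 0)
    have hnear : |k + z - P.h 0 + P.h 0 - k| ≤ 1 / 4 := by
      rw [show k + z - P.h 0 + P.h 0 - k = z by ring, abs_of_nonneg hz.1]; exact hz.2
    have hφ : P.φ x = k - ((m + 1 : ℕ) : ℝ) * ρ := by
      have := P.φ_iterate m x
      rw [hx, P.φ_eq_of_near_int hnear] at this
      push_cast
      linarith
    have hmem := ceil_sub_mem_Ioo hirr m.succ_ne_zero hm
    rw [← hk, ← hφ] at hmem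
    have hx0 : 0 < x := P.lt_of_φ_lt (by rw [φ_zero]; exact hmem.1)
    have hx1 : x < P.f 0 := P.lt_of_φ_lt (by rw [φ_f, φ_zero, zero_add]; exact hmem.2)
    obtain ⟨y, hy, hyt⟩ := exists_narrowBump_eq (t := x / P.f 0)
      (div_nonneg hx0.le hf.le) (by rw [div_le_one hf]; exact hx1.le)
    have hb : broadBump y = 1 := broadBump_eq_one (by rw [hyt]; positivity)
    refine ⟨y, hy, ?_⟩
    rw [Function.iterate_succ_apply, hstep y hy, hyt, hb, mul_div_cancel₀ _ hf.ne', mul_one,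
      add_sub_cancel_left, Function.iterate_succ_apply', P.iterate_skelMap_horizontal, hx,
      skelMap_horizontal, P.f_eq_of_near_int hnear,
      show k + z - P.h 0 + P.h 0 = z + k by ring, narrowBump_add_int, hzt,
      mul_div_cancel₀ _ hh.ne', add_comm]
    intro j hj i hi
    refine natCast_mul_ne_int hirr (n := m - j) (by omega) (k - i) ?_
    rw [hφ] at hi
    rw [Nat.cast_sub hj.le]
    push_cast at hi ⊢
    linarith

include hirr h0 in
/-- The segment from `(0, 0)` to `(0, P.h 0)` covers each of its translates by `m + n + 1` times an
admissible vector. -/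
lemma exists_iterate_eq {m n : ℕ} (hm : alphaSeq ρ m < ρ) (hn : alphaSeq ρ n < ρ) {y' : ℝ}
    (hy' : y' ∈ Set.Icc 0 (P.h 0)) :
    ∃ y ∈ Set.Icc 0 (P.h 0), P.skelMap^[m + n + 1] (0, y) =
      (0, y') + ((⌈(m : ℝ) * ρ⌉ : ℝ), (⌈(n : ℝ) * ρ⌉ : ℝ)) := by
  have hh := P.quarter_lt_h_zero h0
  set l : ℤ := ⌈(n : ℝ) * ρ⌉ with hl
  obtain ⟨y, hy, hit⟩ := P.exists_iterate_horizontal hirr h0 hm l hy'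
  rw [show m + n + 1 = m + 1 + n by ring, Prod.mk_add_mk, zero_add, ← hit]
  rcases Nat.eq_zero_or_pos n with rfl | hpos
  · have hl0 : l = 0 := by simp [hl]
    exact ⟨y, ⟨hy.1, hy.2.trans hh.le⟩, by simp [hl0]⟩
  · obtain ⟨x, hx⟩ := ((P.h.continuous_iff_surjective.1 P.continuous_h).iterate n) (y + l)
    have hπ : P.π x = l - n * ρ := by
      have := P.π_iterate n x
      rw [hx, P.π.map_add_int, P.π_eq_zero y (by rw [abs_of_nonneg hy.1]; exact hy.2)] at this
      linarith
    have hmem := ceil_sub_mem_Ioo hirr hpos.ne' hn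
    rw [← hl, ← hπ] at hmem
    have hx0 : 0 < x := P.lt_of_π_lt (by rw [π_zero]; exact hmem.1)
    have hx1 : x < P.h 0 := P.lt_of_π_lt (by rw [π_h_zero]; exact hmem.2)
    have hv := P.iterate_skelMap_vertical hirr 0 (y := x) (n := n) ?_
    · rw [Int.cast_zero, hx] at hv
      exact ⟨x, ⟨hx0.le, hx1.le⟩, by rw [Function.iterate_add_apply, hv]⟩
    intro j hj i hi
    refine natCast_mul_ne_int hirr (n := n - j) (by omega) (l - i) ?_
    rw [hπ] at hi
    rw [Nat.cast_sub hj.le]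
    push_cast
    linarith

/-- After time `T` the segment from `(0, 0)` to `(0, P.h 0)` covers its translate by `v`. -/
def Covers (T : ℕ) (v : ℤ × ℤ) : Prop :=
  ∀ y ∈ Set.Icc 0 (P.h 0), ∃ z ∈ Set.Icc 0 (P.h 0),
    P.skelMap^[T] (0, z) = (0, y) + ((v.1 : ℝ), (v.2 : ℝ))

variable {P}

include hirr in
lemma Covers.add {S T : ℕ} {v w : ℤ × ℤ} (hv : P.Covers S v) (hw : P.Covers T w) :
    P.Covers (S + T) (v + w) := by
  intro y hy
  obtain ⟨z, hz, he⟩ := hv y hy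
  obtain ⟨z', hz', he'⟩ := hw z hz
  refine ⟨z', hz', ?_⟩
  have hmem : ((0 : ℝ), z) ∈ skel := by simpa using mem_skel_vertical 0 z
  rw [Function.iterate_add_apply, he', P.iterate_skelMap_add_int hirr hmem, he]
  ext <;> simp; ring

include hirr in
lemma Covers.nsmul {T : ℕ} {v : ℤ × ℤ} (hv : P.Covers T v) (n : ℕ) :
    P.Covers (n * T) (n • v) := by
  induction n with
  | zero => exact fun y hy => ⟨y, hy, by simp⟩
  | succ n ih => rw [add_mul, one_mul, succ_nsmul]; exact ih.add hirr hv

/-- The rotation vectors of the covering relations. -/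
def coverVectors (P : PlateauMap ρ) : Set (ℝ × ℝ) :=
  {w | ∃ T : ℕ, 0 < T ∧ ∃ v : ℤ × ℤ, P.Covers T v ∧ w = ((v.1 : ℝ) / T, (v.2 : ℝ) / T)}

include hirr h0 in
lemma coverVectors_subset_rotSetOn : P.coverVectors ⊆ rotSetOn P.skelMap skel := by
  rintro _ ⟨T, hT, v, hv, rfl⟩
  have hh : 0 < P.h 0 := (by norm_num : (0 : ℝ) < 1 / 4).trans (P.quarter_lt_h_zero h0)
  have hex : ∀ N : ℕ, ∃ z ∈ Set.Icc 0 (P.h 0), P.skelMap^[N * T] (0, z) =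
      ((N * v.1 : ℝ), (N * v.2 : ℝ)) := by
    intro N
    obtain ⟨z, hz, he⟩ := hv.nsmul hirr N 0 ⟨le_rfl, hh.le⟩
    exact ⟨z, hz, by rw [he]; simp⟩
  choose z hz he using hex
  have hT' : (T : ℝ) ≠ 0 := by exact_mod_cast hT.ne'
  refine Set.mem_iInter.2 fun m => ?_
  have hlim : Tendsto (fun N : ℕ => ((v.1 : ℝ) / T, (v.2 : ℝ) / T - z N / (N * T))) atTop
      (𝓝 ((v.1 : ℝ) / T, (v.2 : ℝ) / T - 0)) := by
    refine tendsto_const_nhds.prodMk_nhds (tendsto_const_nhds.sub ?_)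
    refine squeeze_zero (fun N => div_nonneg (hz N).1 (by positivity)) (fun N => ?_)
      (tendsto_const_div_atTop_nhds_zero_nat (P.h 0 / T))
    rw [div_div, mul_comm (T : ℝ)]
    gcongr
    exact (hz N).2
  rw [sub_zero] at hlim
  refine mem_closure_of_tendsto hlim ?_
  filter_upwards [eventually_gt_atTop m] with N hN
  have hN' : (N : ℝ) ≠ 0 := by
    have : N ≠ 0 := by omega
    exact_mod_cast this
  refine Set.mem_iUnion₂.2 ⟨N * T, hN.trans_le (Nat.le_mul_of_pos_right N hT), (0, z N), ?_, ?_⟩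
  · simpa using mem_skel_vertical 0 (z N)
  · rw [he]
    ext <;> simp <;> field_simp

include hirr in
lemma convex_closure_coverVectors : Convex ℝ (closure P.coverVectors) := by
  have key : ∀ x ∈ P.coverVectors, ∀ y ∈ P.coverVectors, ∀ t ∈ Set.Icc (0 : ℝ) 1,
      t • x + (1 - t) • y ∈ closure P.coverVectors := by
    rintro _ ⟨S, hS, v, hv, rfl⟩ _ ⟨T, hT, w, hw, rfl⟩ t ⟨ht0, ht1⟩
    have hlim : Tendsto (fun N : ℕ => (⌊t * N⌋₊ : ℝ) / N) atTop (𝓝 t) :=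
      (tendsto_nat_floor_mul_div_atTop ht0).comp tendsto_natCast_atTop_atTop
    refine mem_closure_of_tendsto ((hlim.smul_const _).add
      ((tendsto_const_nhds.sub hlim).smul_const _)) ?_
    filter_upwards [eventually_gt_atTop 0] with N hN
    have hq : ⌊t * N⌋₊ ≤ N := Nat.floor_le_of_le (mul_le_of_le_one_left (by positivity) ht1)
    obtain ⟨r, hr⟩ := Nat.exists_eq_add_of_le hq
    refine ⟨_, ?_, _, (hv.nsmul hirr (⌊t * N⌋₊ * T)).add hirr (hw.nsmul hirr (r * S)), ?_⟩
    · rw [show ⌊t * N⌋₊ * T * S + r * S * T = (⌊t * N⌋₊ + r) * (S * T) by ring, ← hr]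
      positivity
    · have hN' : (N : ℝ) = ⌊t * N⌋₊ + r := by exact_mod_cast hr
      have hNpos : (0 : ℝ) < N := by exact_mod_cast hN
      generalize ⌊t * N⌋₊ = q at *
      rw [hN'] at hNpos ⊢
      have hS' : (S : ℝ) ≠ 0 := by exact_mod_cast hS.ne'
      have hT' : (T : ℝ) ≠ 0 := by exact_mod_cast hT.ne'
      have hden : (q : ℝ) * T * S + r * S * T ≠ 0 := by
        rw [show (q : ℝ) * T * S + r * S * T = (q + r) * (S * T) by ring]
        positivity
      have := hNpos.ne'
      ext <;> simp <;> field_simp <;> ring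
  intro x hx y hy a b ha hb hab
  obtain rfl : b = 1 - a := by linarith
  have hcont : Continuous (Function.uncurry fun x y : ℝ × ℝ => a • x + (1 - a) • y) := by
    fun_prop
  have := map_mem_closure₂ hcont hx hy fun p hp q hq => key p hp q hq a ⟨ha, by linarith⟩
  rwa [closure_closure] at this

end PlateauMap

section RotationSet

variable {ρ : ℝ} (hirr : Irrational ρ) (h0 : 0 < ρ) (h1 : ρ < 1)

lemma isClosed_rotSetOn (F : ℝ × ℝ → ℝ × ℝ) (X : Set (ℝ × ℝ)) : IsClosed (rotSetOn F X) :=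
  isClosed_iInter fun _ => isClosed_closure

include hirr h0 in
lemma OmegaSet_subset_rotSetOn (P : PlateauMap ρ) : OmegaSet ρ ⊆ rotSetOn P.skelMap skel := by
  have hC : closure P.coverVectors ⊆ rotSetOn P.skelMap skel :=
    closure_minimal (PlateauMap.coverVectors_subset_rotSetOn hirr h0) (isClosed_rotSetOn _ _)
  refine (closure_minimal ?_ isClosed_closure).trans hC
  refine convexHull_min ?_ (PlateauMap.convex_closure_coverVectors hirr)
  rintro _ ⟨m, n, hm, hn, rfl⟩
  refine subset_closure ⟨m + n + 1, by omega, (⌈(m : ℝ) * ρ⌉, ⌈(n : ℝ) * ρ⌉), ?_, ?_⟩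
  · exact fun y hy => P.exists_iterate_eq hirr h0 hm hn hy
  · simp [vecRho]

include h0 h1 in
/-- Half-planes containing the admissible vectors may be assumed to have a nonnegative normal. -/
lemma BoundsAdmissible.max_zero {α β M : ℝ} (h : BoundsAdmissible ρ α β M) :
    BoundsAdmissible ρ (max α 0) (max β 0) M := by
  have hM := h.nonneg h0
  have key : ∀ {γ : ℝ} (n : ℕ), 0 ≤ γ → γ * ρ ≤ M → alphaSeq ρ n < ρ →
      γ * ⌈(n : ℝ) * ρ⌉ ≤ M * (n + 1) := by
    intro γ n hγ hγM hn
    rw [alphaSeq] at hn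
    have e1 : γ * ⌈(n : ℝ) * ρ⌉ ≤ γ * ((n + 1) * ρ) := by gcongr; linarith
    have e2 : (γ * ρ) * (n + 1) ≤ M * (n + 1) := by gcongr
    linarith
  intro m n hm hn
  have em : 0 ≤ M * m := by positivity
  have en : 0 ≤ M * n := by positivity
  rcases le_total α 0 with hα | hα <;> rcases le_total β 0 with hβ | hβ
  · rw [max_eq_right hα, max_eq_right hβ]; linarith
  · rw [max_eq_right hα, max_eq_left hβ]
    linarith [key n hβ (h.swap.mul_le h0 h1) hn]
  · rw [max_eq_left hα, max_eq_right hβ]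
    linarith [key m hα (h.mul_le h0 h1) hm]
  · rw [max_eq_left hα, max_eq_left hβ]
    exact h m n hm hn

include hirr h0 h1 in
lemma rotSetOn_subset_OmegaSet (P : PlateauMap ρ) : rotSetOn P.skelMap skel ⊆ OmegaSet ρ := by
  intro w hw
  have hw1 : 0 ≤ w.1 := by
    have := le_of_mem_rotSetOn (α := -1) (β := 0) (M := 0) (C := 2) (fun x hx n => by
      have := (P.sub_two_le_iterate_skelMap hirr h0 hx n).1
      simp only [Prod.fst_sub]
      linarith) hw
    linarith
  have hw2 : 0 ≤ w.2 := by
    have := le_of_mem_rotSetOn (α := 0) (β := -1) (M := 0) (C := 2) (fun x hx n => by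
      have := (P.sub_two_le_iterate_skelMap hirr h0 hx n).2
      simp only [Prod.snd_sub]
      linarith) hw
    linarith
  by_contra hnot
  obtain ⟨f, u, hu, huw⟩ := geometric_hahn_banach_closed_point
    (convex_convexHull ℝ _).closure isClosed_closure hnot
  have hf : ∀ p : ℝ × ℝ, f p = f (1, 0) * p.1 + f (0, 1) * p.2 := fun p => by
    conv_lhs => rw [show p = p.1 • ((1 : ℝ), (0 : ℝ)) + p.2 • ((0 : ℝ), (1 : ℝ)) by ext <;> simp]
    rw [map_add, map_smul, map_smul, smul_eq_mul, smul_eq_mul]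
    ring
  have hB : BoundsAdmissible ρ (f (1, 0)) (f (0, 1)) u := by
    intro m n hm hn
    have hlt := hu _ (subset_closure (subset_convexHull ℝ _ ⟨m, n, hm, hn, rfl⟩))
    rw [hf, vecRho] at hlt
    have hpos : (0 : ℝ) < m + n + 1 := by positivity
    have := (mul_lt_mul_of_pos_right hlt hpos).le
    refine le_trans (le_of_eq ?_) this
    field_simp
  have hle := le_of_mem_rotSetOn (fun x hx n => P.iterate_skelMap_sub_le hirr h0 h1
    (le_max_right _ _) (le_max_right _ _) (hB.max_zero h0 h1) hx n) hw
  rw [hf] at huw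
  have e1 : f (1, 0) * w.1 ≤ max (f (1, 0)) 0 * w.1 := by gcongr; exact le_max_left _ _
  have e2 : f (0, 1) * w.2 ≤ max (f (0, 1)) 0 * w.2 := by gcongr; exact le_max_left _ _
  linarith

end RotationSet

theorem stmt14 (ρ : ℝ) (hirr : Irrational ρ) (h0 : 0 < ρ) (h1 : ρ < 1) :
    ∃ F : ℝ × ℝ → ℝ × ℝ,
      ContinuousOn F skel ∧
      Set.MapsTo F skel skel ∧
      (∀ x ∈ skel, ∀ v : ℤ × ℤ,
        F (x + ((v.1 : ℝ), (v.2 : ℝ))) = F x + ((v.1 : ℝ), (v.2 : ℝ))) ∧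
      rotSetOn F skel = OmegaSet ρ := by
  obtain ⟨P⟩ := exists_plateauMap h0 h1
  exact ⟨P.skelMap, P.continuousOn_skelMap hirr, P.mapsTo_skelMap hirr,
    fun x hx v => P.skelMap_add_int hirr hx v,
    (rotSetOn_subset_OmegaSet hirr h0 h1 P).antisymm (OmegaSet_subset_rotSetOn hirr h0 P)⟩
end

section
/- For every irrational ρ ∈ (0,1) there exist an open set Ũ ⊆ ℝ² with Ũ + v = Ũ for all v ∈ ℤ², containing the skeleton X̃ := { (x, y) ∈ ℝ² : x ∈ ℤ or y ∈ ℤ }, and a continuously differentiable map G̃ defined on a neighborhood of the closure of Ũ such that: G̃ restricted to closure(Ũ) is injective with invertible derivative at every point (a C¹ embedding), G̃(closure(Ũ)) ⊆ Ũ, G̃(x + v) = G̃(x) + v for all x and all v ∈ ℤ², and the rotation set ρ(G̃), computed with x ranging over closure(Ũ), equals Ω_ρ. -/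
open Filter Topology

/-! ### A periodic `C¹` staircase -/

/-- A `C¹` ramp equal to `0` on `(-∞, 0]` and to `1` on `[1, ∞)`. -/
noncomputable def ramp (u : ℝ) : ℝ :=
  2 * max u 0 ^ 2 - 4 * max (u - 1 / 2) 0 ^ 2 + 2 * max (u - 1) 0 ^ 2

/-- The derivative of `ramp`. -/
noncomputable def rampDeriv (u : ℝ) : ℝ :=
  4 * max u 0 - 8 * max (u - 1 / 2) 0 + 4 * max (u - 1) 0

theorem hasDerivAt_max_zero_sq (u : ℝ) :
    HasDerivAt (fun v : ℝ => max v 0 ^ 2) (2 * max u 0) u := by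
  have hl : ∀ x ≤ (0 : ℝ), HasDerivWithinAt (fun v : ℝ => max v 0 ^ 2) (2 * max x 0)
      (Set.Iic 0) x := by
    intro x hx
    rw [max_eq_right hx, mul_zero]
    refine (hasDerivWithinAt_const x _ (0 : ℝ)).congr (fun y hy => ?_) ?_
    · simp [max_eq_right (Set.mem_Iic.1 hy)]
    · simp [max_eq_right hx]
  have hr : ∀ x ≥ (0 : ℝ), HasDerivWithinAt (fun v : ℝ => max v 0 ^ 2) (2 * max x 0)
      (Set.Ici 0) x := by
    intro x hx
    rw [max_eq_left hx]
    refine HasDerivWithinAt.congr (f := fun v : ℝ => v ^ 2) ?_ (fun y hy => ?_) ?_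
    · simpa using (hasDerivAt_pow 2 x).hasDerivWithinAt
    · simp [max_eq_left (Set.mem_Ici.1 hy)]
    · simp [max_eq_left hx]
  rcases lt_trichotomy u 0 with hu | hu | hu
  · exact (hl u hu.le).hasDerivAt (Iic_mem_nhds hu)
  · have := (hl u hu.le).union (hr u hu.ge)
    rwa [Set.Iic_union_Ici, hasDerivWithinAt_univ] at this
  · exact (hr u hu.le).hasDerivAt (Ici_mem_nhds hu)

theorem hasDerivAt_ramp (u : ℝ) : HasDerivAt ramp (rampDeriv u) u := by
  have h (c : ℝ) : HasDerivAt (fun v : ℝ => max (v - c) 0 ^ 2) (2 * max (u - c) 0) u :=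
    (hasDerivAt_max_zero_sq (u - c)).comp_sub_const u c
  have := (((hasDerivAt_max_zero_sq u).const_mul 2).sub ((h (1 / 2)).const_mul 4)).add
    ((h 1).const_mul 2)
  exact this.congr_deriv (by unfold rampDeriv; ring)

theorem continuous_rampDeriv : Continuous rampDeriv := by
  unfold rampDeriv
  fun_prop

theorem ramp_of_nonpos {u : ℝ} (hu : u ≤ 0) : ramp u = 0 := by
  rw [ramp, max_eq_right hu, max_eq_right (by linarith), max_eq_right (by linarith)]
  ring

theorem ramp_of_one_le {u : ℝ} (hu : 1 ≤ u) : ramp u = 1 := by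
  rw [ramp, max_eq_left (by linarith), max_eq_left (by linarith), max_eq_left (by linarith)]
  ring

theorem rampDeriv_of_nonpos {u : ℝ} (hu : u ≤ 0) : rampDeriv u = 0 := by
  rw [rampDeriv, max_eq_right hu, max_eq_right (by linarith), max_eq_right (by linarith)]
  ring

theorem rampDeriv_of_one_le {u : ℝ} (hu : 1 ≤ u) : rampDeriv u = 0 := by
  rw [rampDeriv, max_eq_left (by linarith), max_eq_left (by linarith), max_eq_left (by linarith)]
  ring

theorem rampDeriv_nonneg (u : ℝ) : 0 ≤ rampDeriv u := by
  unfold rampDeriv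
  rcases max_cases u 0 with h | h <;> rcases max_cases (u - 1 / 2) 0 with h' | h' <;>
    rcases max_cases (u - 1) 0 with h'' | h'' <;> linarith

theorem rampDeriv_le (u : ℝ) : rampDeriv u ≤ 2 := by
  unfold rampDeriv
  rcases max_cases u 0 with h | h <;> rcases max_cases (u - 1 / 2) 0 with h' | h' <;>
    rcases max_cases (u - 1) 0 with h'' | h'' <;> linarith

theorem monotone_ramp : Monotone ramp :=
  monotone_of_deriv_nonneg (fun u => (hasDerivAt_ramp u).differentiableAt) fun u => by
    rw [(hasDerivAt_ramp u).deriv]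
    exact rampDeriv_nonneg u

theorem ramp_nonneg (u : ℝ) : 0 ≤ ramp u := by
  rcases le_total u 0 with h | h
  · exact (ramp_of_nonpos h).ge
  · simpa [ramp_of_nonpos le_rfl] using monotone_ramp h

theorem ramp_le_one (u : ℝ) : ramp u ≤ 1 := by
  rcases le_total 1 u with h | h
  · exact (ramp_of_one_le h).le
  · simpa [ramp_of_one_le le_rfl] using monotone_ramp h

/-- The staircase that climbs from `k` to `k + 1` on `[A + k, A + k + l]` and is constant on
`[A + k + l, A + k + 1]`, for every integer `k`. -/
noncomputable def stair (A l x : ℝ) : ℝ := ⌊x - A⌋ + ramp (Int.fract (x - A) / l)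

/-- The derivative of `stair`. -/
noncomputable def stairDeriv (A l x : ℝ) : ℝ := rampDeriv (Int.fract (x - A) / l) / l

section stair

variable {A l x : ℝ}

theorem stair_add_one (A l x : ℝ) : stair A l (x + 1) = stair A l x + 1 := by
  unfold stair
  rw [show x + 1 - A = x - A + 1 by ring, Int.floor_add_one, Int.fract_add_one]
  push_cast
  ring

theorem abs_stair_le (A l x : ℝ) : |stair A l x| ≤ |x - A| + 2 := by
  have h1 := ramp_nonneg (Int.fract (x - A) / l)
  have h2 := ramp_le_one (Int.fract (x - A) / l)
  have h3 := Int.floor_le (x - A)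
  have h4 := Int.lt_floor_add_one (x - A)
  unfold stair
  rw [abs_le]
  constructor <;> cases abs_cases (x - A) <;> linarith

theorem stair_local (hl : 0 < l) {k : ℤ} (h1 : A + k - 1 + l ≤ x)
    (h2 : x < A + k + 1) :
    stair A l x = k + ramp ((x - A - k) / l) ∧ stairDeriv A l x = rampDeriv ((x - A - k) / l) / l := by
  rcases le_or_gt (A + k) x with h | h
  · have hf : ⌊x - A⌋ = k := by
      rw [Int.floor_eq_iff]
      constructor <;> linarith
    have hfr : Int.fract (x - A) = x - A - k := by rw [Int.fract, hf]
    rw [stair, stairDeriv, hfr, hf]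
    exact ⟨rfl, rfl⟩
  · have hf : ⌊x - A⌋ = k - 1 := by
      rw [Int.floor_eq_iff]
      push_cast
      constructor <;> linarith
    have hfr : Int.fract (x - A) = x - A - (k - 1) := by rw [Int.fract, hf]; push_cast; ring
    have hn : (x - A - k) / l ≤ 0 := div_nonpos_of_nonpos_of_nonneg (by linarith) hl.le
    have hp : 1 ≤ (x - A - (k - 1)) / l := by
      rw [le_div_iff₀ hl]
      linarith
    rw [stair, stairDeriv, hfr, hf, ramp_of_one_le hp, rampDeriv_of_one_le hp, ramp_of_nonpos hn,
      rampDeriv_of_nonpos hn]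
    push_cast
    exact ⟨by ring, rfl⟩

theorem exists_stair_window (hl1 : l < 1) (A x : ℝ) :
    ∃ k : ℤ, x ∈ Set.Ioo (A + k - 1 + l) (A + k + 1) :=
  ⟨⌊x - A⌋, by linarith [Int.floor_le (x - A)], by linarith [Int.lt_floor_add_one (x - A)]⟩

theorem hasDerivAt_stair (hl : 0 < l) (hl1 : l < 1) (A x : ℝ) :
    HasDerivAt (stair A l) (stairDeriv A l x) x := by
  obtain ⟨k, hk⟩ := exists_stair_window hl1 A x
  rw [(stair_local hl hk.1.le hk.2).2]
  have h : HasDerivAt (fun y : ℝ => k + ramp ((y - A - k) / l))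
      (rampDeriv ((x - A - k) / l) / l) x := by
    have h0 : HasDerivAt (fun y : ℝ => (y - A - k) / l) (1 / l) x :=
      (((hasDerivAt_id x).sub_const A).sub_const (k : ℝ)).div_const l
    have := ((hasDerivAt_ramp ((x - A - k) / l)).comp x h0).const_add (k : ℝ)
    rw [div_eq_mul_one_div]
    exact this
  refine h.congr_of_eventuallyEq ?_
  filter_upwards [isOpen_Ioo.mem_nhds hk] with y hy
  exact (stair_local hl hy.1.le hy.2).1

theorem continuous_stairDeriv (hl : 0 < l) (hl1 : l < 1) (A : ℝ) :
    Continuous (stairDeriv A l) := by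
  rw [continuous_iff_continuousAt]
  intro x
  obtain ⟨k, hk⟩ := exists_stair_window hl1 A x
  have h : ContinuousAt (fun y : ℝ => rampDeriv ((y - A - k) / l) / l) x := by
    have := continuous_rampDeriv
    fun_prop
  refine h.congr ?_
  filter_upwards [isOpen_Ioo.mem_nhds hk] with y hy
  exact (stair_local hl hy.1.le hy.2).2.symm

theorem contDiff_stair (hl : 0 < l) (hl1 : l < 1) (A : ℝ) : ContDiff ℝ 1 (stair A l) := by
  rw [contDiff_one_iff_deriv]
  refine ⟨fun x => (hasDerivAt_stair hl hl1 A x).differentiableAt, ?_⟩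
  rw [show deriv (stair A l) = stairDeriv A l from
    funext fun x => (hasDerivAt_stair hl hl1 A x).deriv]
  exact continuous_stairDeriv hl hl1 A

theorem stairDeriv_nonneg (hl : 0 < l) (A x : ℝ) : 0 ≤ stairDeriv A l x :=
  div_nonneg (rampDeriv_nonneg _) hl.le

theorem stairDeriv_le (hl : 0 < l) (A x : ℝ) : stairDeriv A l x ≤ 2 / l :=
  div_le_div_of_nonneg_right (rampDeriv_le _) hl.le

theorem stair_eq (hl : 0 < l) {k : ℤ} (h1 : A + k - 1 + l ≤ x) (h2 : x ≤ A + k) :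
    stair A l x = k := by
  rw [(stair_local hl h1 (by linarith)).1, ramp_of_nonpos, add_zero]
  exact div_nonpos_of_nonpos_of_nonneg (by linarith) hl.le

theorem exists_of_stairDeriv_ne_zero (hl : 0 < l) (h : stairDeriv A l x ≠ 0) :
    ∃ k : ℤ, A + k < x ∧ x < A + k + l := by
  refine ⟨⌊x - A⌋, ?_⟩
  have hx : x = A + ⌊x - A⌋ + Int.fract (x - A) := by
    linarith [Int.floor_add_fract (x - A)]
  have h0 : 0 < Int.fract (x - A) := by
    by_contra! h0
    exact h (by rw [stairDeriv, rampDeriv_of_nonpos (div_nonpos_of_nonpos_of_nonneg h0 hl.le),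
      zero_div])
  have h1 : Int.fract (x - A) < l := by
    by_contra! h1
    exact h (by rw [stairDeriv, rampDeriv_of_one_le ((one_le_div hl).2 h1), zero_div])
  constructor <;> linarith

theorem monotone_stair (hl : 0 < l) (hl1 : l < 1) (A : ℝ) : Monotone (stair A l) :=
  monotone_of_deriv_nonneg (fun x => (hasDerivAt_stair hl hl1 A x).differentiableAt) fun x => by
    rw [(hasDerivAt_stair hl hl1 A x).deriv]
    exact stairDeriv_nonneg hl A x

end stair

/-! ### Gap lengths -/

/-- The unnormalised lengths of the gaps of the Denjoy homeomorphism. -/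
noncomputable def gapWeight (n : ℤ) : ℝ := 1 / ((n : ℝ) ^ 2 + 12)

/-- The lengths of the gaps of the Denjoy homeomorphism; they add up to `1 / 2`. -/
noncomputable def gapLength (n : ℤ) : ℝ := gapWeight n / (2 * ∑' m, gapWeight m)

theorem gapWeight_pos (n : ℤ) : 0 < gapWeight n := by
  unfold gapWeight
  positivity

theorem summable_gapWeight : Summable gapWeight := by
  refine Summable.of_norm_bounded_eventually (Real.summable_one_div_int_pow.2 one_lt_two) ?_
  have h : ∀ᶠ n : ℤ in cofinite, n ≠ 0 := (Set.finite_singleton (0 : ℤ)).compl_mem_cofinite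
  filter_upwards [h] with n hn
  have hn' : (0 : ℝ) < (n : ℝ) ^ 2 := by positivity
  rw [Real.norm_of_nonneg (gapWeight_pos n).le]
  exact one_div_le_one_div_of_le hn' (by linarith)

theorem tsum_gapWeight_pos : 0 < ∑' m, gapWeight m :=
  summable_gapWeight.tsum_pos (fun n => (gapWeight_pos n).le) 0 (gapWeight_pos 0)

theorem gapLength_pos (n : ℤ) : 0 < gapLength n :=
  div_pos (gapWeight_pos n) (mul_pos two_pos tsum_gapWeight_pos)

theorem summable_gapLength : Summable gapLength := summable_gapWeight.div_const _

theorem tsum_gapLength : ∑' n, gapLength n = 1 / 2 := by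
  have h := tsum_gapWeight_pos.ne'
  unfold gapLength
  rw [tsum_div_const]
  field_simp

theorem gapLength_lt_one (n : ℤ) : gapLength n < 1 := by
  have h := summable_gapLength.le_tsum n fun m _ => (gapLength_pos m).le
  rw [tsum_gapLength] at h
  linarith

theorem summable_gapLength_mul {f : ℤ → ℝ} {C : ℝ} (hf : ∀ n, |f n| ≤ C) :
    Summable fun n => gapLength n * f n := by
  refine Summable.of_norm_bounded (summable_gapLength.mul_right C) fun n => ?_
  rw [norm_mul, Real.norm_of_nonneg (gapLength_pos n).le]
  exact mul_le_mul_of_nonneg_left (hf n) (gapLength_pos n).le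

theorem summable_gapLength_succ_mul {f : ℤ → ℝ} {C : ℝ} (hf : ∀ n, |f n| ≤ C) :
    Summable fun n => gapLength (n + 1) * f n := by
  have h := summable_gapLength_mul (f := fun n => f (n - 1)) fun n => hf (n - 1)
  simpa [Function.comp_def] using (Equiv.addRight (1 : ℤ)).summable_iff.2 h

/-- The jump of the gap lengths along the orbit of gaps. -/
noncomputable def gapDiff (n : ℤ) : ℝ := gapLength (n + 1) - gapLength n

theorem summable_gapDiff_mul {f : ℤ → ℝ} {C : ℝ} (hf : ∀ n, |f n| ≤ C) :
    Summable fun n => gapDiff n * f n := by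
  simpa [gapDiff, sub_mul] using (summable_gapLength_succ_mul hf).sub (summable_gapLength_mul hf)

theorem tsum_gapDiff : ∑' n, gapDiff n = 0 := by
  have h1 := (Equiv.addRight (1 : ℤ)).tsum_eq gapLength
  have h2 : Summable fun n : ℤ => gapLength (n + 1) :=
    (Equiv.addRight (1 : ℤ)).summable_iff.2 summable_gapLength
  simp only [Equiv.coe_addRight] at h1
  unfold gapDiff
  rw [h2.tsum_sub summable_gapLength, h1, sub_self]

/-- An upper bound for the relative change of length of consecutive gaps. -/
noncomputable def gapRatio (n : ℤ) : ℝ := 2 * |2 * (n : ℝ) + 1| / (((n : ℝ) + 1) ^ 2 + 12)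

theorem abs_gapDiff_mul (n : ℤ) : |gapDiff n| * (2 / gapLength n) = gapRatio n := by
  have h := tsum_gapWeight_pos
  have h1 : gapDiff n = -(2 * (n : ℝ) + 1) * (gapLength n / (((n : ℝ) + 1) ^ 2 + 12)) := by
    simp only [gapDiff, gapLength, gapWeight]
    push_cast
    field_simp
    ring
  have h2 := gapLength_pos n
  have h3 : 0 ≤ gapLength n / (((n : ℝ) + 1) ^ 2 + 12) := by positivity
  rw [h1, abs_mul, abs_neg, abs_of_nonneg h3, gapRatio]
  field_simp

theorem gapRatio_lt_one (n : ℤ) : gapRatio n < 1 := by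
  unfold gapRatio
  rw [div_lt_one (by positivity)]
  cases abs_cases (2 * (n : ℝ) + 1) <;> nlinarith [sq_nonneg ((n : ℝ) + 3), sq_nonneg ((n : ℝ) - 1)]

theorem finite_le_gapRatio {ε : ℝ} (hε : 0 < ε) : {n : ℤ | ε ≤ gapRatio n}.Finite := by
  refine (Set.finite_Icc (-⌈6 / ε⌉ - 1) ⌈6 / ε⌉).subset fun n hn => ?_
  have hn : ε ≤ gapRatio n := hn
  rw [gapRatio, le_div_iff₀ (by positivity)] at hn
  have key : |(n : ℝ) + 1| ≤ 6 / ε := by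
    by_contra! hlt
    rw [div_lt_iff₀ hε] at hlt
    have hk : 0 < |(n : ℝ) + 1| := by
      by_contra! hk
      nlinarith
    have h1 : 6 * |(n : ℝ) + 1| < ε * ((n : ℝ) + 1) ^ 2 := by
      rw [← sq_abs]
      nlinarith
    have h2 : |2 * (n : ℝ) + 1| ≤ 2 * |(n : ℝ) + 1| + 1 := by
      cases abs_cases (2 * (n : ℝ) + 1) <;> cases abs_cases ((n : ℝ) + 1) <;> linarith
    have h3 : (1 : ℝ) ≤ |(n : ℝ) + 1| := by
      have : (0 : ℤ) < |n + 1| := by exact_mod_cast hk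
      exact_mod_cast this
    nlinarith
  have h := Int.le_ceil (6 / ε)
  obtain ⟨h1, h2⟩ := abs_le.1 (key.trans h)
  constructor
  · have : (-⌈6 / ε⌉ : ℤ) ≤ n + 1 := by exact_mod_cast h1
    linarith
  · have : n + 1 ≤ ⌈6 / ε⌉ := by exact_mod_cast h2
    linarith

/-! ### The Denjoy homeomorphism -/

section Denjoy

variable (ρ : ℝ)

/-- The map that opens a gap of length `gapLength n` at each point of `n ρ + ℤ`. -/
noncomputable def openGaps (t : ℝ) : ℝ :=
  t / 2 + ∑' n : ℤ, gapLength n * (⌈t - Int.fract ((n : ℝ) * ρ)⌉ : ℝ)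

theorem abs_ceil_sub_fract_le (t u : ℝ) : |(⌈t - Int.fract u⌉ : ℝ)| ≤ |t| + 2 := by
  have h1 := Int.le_ceil (t - Int.fract u)
  have h2 := Int.ceil_lt_add_one (t - Int.fract u)
  have h3 := Int.fract_nonneg u
  have h4 := Int.fract_lt_one u
  rw [abs_le]
  constructor <;> cases abs_cases t <;> linarith

theorem summable_openGaps (t : ℝ) :
    Summable fun n : ℤ => gapLength n * (⌈t - Int.fract ((n : ℝ) * ρ)⌉ : ℝ) :=
  summable_gapLength_mul fun _ => abs_ceil_sub_fract_le t _

theorem openGaps_add_int (t : ℝ) (k : ℤ) : openGaps ρ (t + k) = openGaps ρ t + k := by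
  have h : ∀ n : ℤ, gapLength n * (⌈t + k - Int.fract ((n : ℝ) * ρ)⌉ : ℝ) =
      gapLength n * (⌈t - Int.fract ((n : ℝ) * ρ)⌉ : ℝ) + gapLength n * k := by
    intro n
    rw [show t + k - Int.fract ((n : ℝ) * ρ) = t - Int.fract ((n : ℝ) * ρ) + k by ring,
      Int.ceil_add_intCast]
    push_cast
    ring
  unfold openGaps
  simp only [h]
  rw [(summable_openGaps ρ t).tsum_add (summable_gapLength.mul_right _), tsum_mul_right,
    tsum_gapLength]
  ring

theorem monotone_openGaps : Monotone (openGaps ρ) := by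
  intro s t hst
  refine add_le_add (by linarith) ?_
  refine (summable_openGaps ρ s).tsum_le_tsum (fun n => ?_) (summable_openGaps ρ t)
  refine mul_le_mul_of_nonneg_left ?_ (gapLength_pos n).le
  exact_mod_cast Int.ceil_le_ceil (by linarith)

theorem openGaps_add_gapLength_le {s t : ℝ} (hst : s ≤ t) {n : ℤ}
    (h : ⌈s - Int.fract ((n : ℝ) * ρ)⌉ < ⌈t - Int.fract ((n : ℝ) * ρ)⌉) :
    openGaps ρ s + gapLength n + (t - s) / 2 ≤ openGaps ρ t := by
  have hsum := (summable_openGaps ρ t).sub (summable_openGaps ρ s)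
  have hle := hsum.le_tsum n fun m _ => by
    rw [← mul_sub]
    refine mul_nonneg (gapLength_pos m).le (sub_nonneg.2 ?_)
    exact_mod_cast Int.ceil_le_ceil (by linarith)
  rw [(summable_openGaps ρ t).tsum_sub (summable_openGaps ρ s), ← mul_sub] at hle
  have h1 : (1 : ℝ) ≤ (⌈t - Int.fract ((n : ℝ) * ρ)⌉ : ℝ) - (⌈s - Int.fract ((n : ℝ) * ρ)⌉ : ℝ) := by
    rw [le_sub_iff_add_le']
    exact_mod_cast h
  have h2 := le_mul_of_one_le_right (gapLength_pos n).le h1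
  unfold openGaps
  linarith

/-- The left endpoint of the gap opened at the fractional part of `n ρ`. -/
noncomputable def gapStart (n : ℤ) : ℝ := openGaps ρ (Int.fract ((n : ℝ) * ρ))

theorem gapStart_add_gapLength_le {t : ℝ} {n k : ℤ} (h : Int.fract ((n : ℝ) * ρ) + k < t) :
    gapStart ρ n + k + gapLength n + (t - (Int.fract ((n : ℝ) * ρ) + k)) / 2 ≤ openGaps ρ t := by
  rw [gapStart, ← openGaps_add_int]
  refine openGaps_add_gapLength_le ρ h.le ?_
  rw [add_sub_cancel_left, Int.ceil_intCast, Int.lt_ceil]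
  linarith

theorem stair_openGaps (t : ℝ) (n : ℤ) :
    stair (gapStart ρ n) (gapLength n) (openGaps ρ t) = ⌈t - Int.fract ((n : ℝ) * ρ)⌉ := by
  have h1 := Int.le_ceil (t - Int.fract ((n : ℝ) * ρ))
  have h2 := Int.ceil_lt_add_one (t - Int.fract ((n : ℝ) * ρ))
  set j := ⌈t - Int.fract ((n : ℝ) * ρ)⌉
  refine stair_eq (gapLength_pos n) ?_ ?_
  · have := gapStart_add_gapLength_le ρ (t := t) (n := n) (k := j - 1) (by push_cast; linarith)
    push_cast at this
    linarith
  · rw [gapStart, ← openGaps_add_int]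
    exact monotone_openGaps ρ (by linarith)

/-- The integer carried when the rotation by `ρ` is applied to the fractional part of `n ρ`. -/
noncomputable def carry (n : ℤ) : ℤ := ⌊((n : ℝ) + 1) * ρ⌋ - ⌊(n : ℝ) * ρ⌋

theorem abs_carry_le (n : ℤ) : |(carry ρ n : ℝ)| ≤ |ρ| + 1 := by
  have h1 := Int.floor_le (((n : ℝ) + 1) * ρ)
  have h2 := Int.lt_floor_add_one (((n : ℝ) + 1) * ρ)
  have h3 := Int.floor_le ((n : ℝ) * ρ)
  have h4 := Int.lt_floor_add_one ((n : ℝ) * ρ)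
  unfold carry
  push_cast
  rw [abs_le]
  constructor <;> cases abs_cases ρ <;> linarith

theorem fract_succ_mul (n : ℤ) :
    Int.fract (((n + 1 : ℤ) : ℝ) * ρ) = Int.fract ((n : ℝ) * ρ) + ρ - carry ρ n := by
  unfold carry Int.fract
  push_cast
  ring

/-- The displacement constant of the Denjoy homeomorphism. -/
noncomputable def denjoyConst : ℝ := ρ / 2 + ∑' n : ℤ, gapLength (n + 1) * (carry ρ n : ℝ)

/-- The lift of a Denjoy homeomorphism with rotation number `ρ`. -/
noncomputable def denjoyMap (x : ℝ) : ℝ :=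
  x + denjoyConst ρ + ∑' n : ℤ, gapDiff n * stair (gapStart ρ n) (gapLength n) x

theorem denjoyMap_openGaps (t : ℝ) : denjoyMap ρ (openGaps ρ t) = openGaps ρ (t + ρ) := by
  have hs := summable_gapLength_succ_mul (fun n => abs_ceil_sub_fract_le t ((n : ℝ) * ρ))
  have h := (Equiv.addRight (1 : ℤ)).tsum_eq
    fun n : ℤ => gapLength n * (⌈t + ρ - Int.fract ((n : ℝ) * ρ)⌉ : ℝ)
  have h' : ∀ n : ℤ, (⌈t + ρ - Int.fract (((n + 1 : ℤ) : ℝ) * ρ)⌉ : ℝ) =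
      (⌈t - Int.fract ((n : ℝ) * ρ)⌉ : ℝ) + carry ρ n := by
    intro n
    rw [fract_succ_mul, show t + ρ - (Int.fract ((n : ℝ) * ρ) + ρ - carry ρ n) =
      t - Int.fract ((n : ℝ) * ρ) + carry ρ n by ring, Int.ceil_add_intCast]
    push_cast
    ring
  simp only [Equiv.coe_addRight, h', mul_add] at h
  rw [hs.tsum_add (summable_gapLength_succ_mul (abs_carry_le ρ))] at h
  have h'' : ∑' n : ℤ, gapDiff n * (⌈t - Int.fract ((n : ℝ) * ρ)⌉ : ℝ) =
      ∑' n : ℤ, gapLength (n + 1) * (⌈t - Int.fract ((n : ℝ) * ρ)⌉ : ℝ) -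
      ∑' n : ℤ, gapLength n * (⌈t - Int.fract ((n : ℝ) * ρ)⌉ : ℝ) := by
    rw [← hs.tsum_sub (summable_openGaps ρ t)]
    simp only [gapDiff, sub_mul]
  simp only [denjoyMap, stair_openGaps, denjoyConst]
  rw [h'', openGaps, openGaps, ← h]
  ring

theorem summable_gapDiff_mul_stair (x : ℝ) :
    Summable fun n : ℤ => gapDiff n * stair (gapStart ρ n) (gapLength n) x := by
  refine summable_gapDiff_mul (C := |x| + |openGaps ρ 0| + |openGaps ρ 1| + 2) fun n => ?_
  refine (abs_stair_le _ _ _).trans ?_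
  have h1 : openGaps ρ 0 ≤ gapStart ρ n := monotone_openGaps ρ (Int.fract_nonneg _)
  have h2 : gapStart ρ n ≤ openGaps ρ 1 := monotone_openGaps ρ (Int.fract_lt_one _).le
  have h3 : |gapStart ρ n| ≤ |openGaps ρ 0| + |openGaps ρ 1| := by
    rw [abs_le]
    constructor
    · linarith [neg_abs_le (openGaps ρ 0), abs_nonneg (openGaps ρ 1)]
    · linarith [le_abs_self (openGaps ρ 1), abs_nonneg (openGaps ρ 0)]
  linarith [abs_sub x (gapStart ρ n)]

theorem denjoyMap_add_one (x : ℝ) : denjoyMap ρ (x + 1) = denjoyMap ρ x + 1 := by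
  have h : Summable gapDiff := by
    simpa using summable_gapDiff_mul (f := fun _ => 1) (C := 1) (by simp)
  simp only [denjoyMap, stair_add_one, mul_add, mul_one]
  rw [(summable_gapDiff_mul_stair ρ x).tsum_add h, tsum_gapDiff]
  ring

theorem tendstoUniformly_sum_of_disjoint_support {ι α : Type*} {g : ι → α → ℝ} {b : ι → ℝ}
    (hg : ∀ x i j, g i x ≠ 0 → g j x ≠ 0 → i = j) (hb : ∀ i x, |g i x| ≤ b i)
    (hfin : ∀ ε > 0, {i | ε ≤ b i}.Finite) :
    TendstoUniformly (fun (s : Finset ι) x => ∑ i ∈ s, g i x) (fun x => ∑' i, g i x) atTop := by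
  rw [Metric.tendstoUniformly_iff]
  intro ε hε
  filter_upwards [eventually_ge_atTop (hfin ε hε).toFinset] with s hs x
  by_cases hx : ∃ i, g i x ≠ 0
  · obtain ⟨i, hi⟩ := hx
    have hz : ∀ j, j ≠ i → g j x = 0 := fun j hj => by
      by_contra h
      exact hj (hg x j i h hi)
    rw [tsum_eq_single i hz]
    by_cases his : i ∈ s
    · rw [Finset.sum_eq_single_of_mem i his fun j _ hj => hz j hj]
      simpa using hε
    · rw [Finset.sum_eq_zero fun j hj => hz j fun h => his (h ▸ hj), dist_zero_right]
      refine (hb i x).trans_lt ?_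
      by_contra! h
      exact his (hs ((hfin ε hε).mem_toFinset.2 h))
  · push Not at hx
    simpa [hx] using hε

variable {ρ}

theorem eq_of_mem_gap (hρ : Irrational ρ) {x : ℝ} {n m k j : ℤ}
    (h1 : gapStart ρ n + k < x) (h2 : x < gapStart ρ n + k + gapLength n)
    (h3 : gapStart ρ m + j < x) (h4 : x < gapStart ρ m + j + gapLength m) : n = m := by
  by_contra hnm
  have hne : Int.fract ((n : ℝ) * ρ) + k ≠ Int.fract ((m : ℝ) * ρ) + j := by
    intro h
    refine (hρ.intCast_mul (sub_ne_zero.2 hnm)).ne_int (⌊(n : ℝ) * ρ⌋ - ⌊(m : ℝ) * ρ⌋ + j - k) ?_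
    unfold Int.fract at h
    push_cast
    linarith
  rcases hne.lt_or_gt with h | h
  · have := gapStart_add_gapLength_le ρ h
    rw [openGaps_add_int, ← gapStart] at this
    linarith
  · have := gapStart_add_gapLength_le ρ h
    rw [openGaps_add_int, ← gapStart] at this
    linarith

theorem gapDiff_stairDeriv_disjoint (hρ : Irrational ρ) (x : ℝ) (n m : ℤ)
    (hn : gapDiff n * stairDeriv (gapStart ρ n) (gapLength n) x ≠ 0)
    (hm : gapDiff m * stairDeriv (gapStart ρ m) (gapLength m) x ≠ 0) : n = m := by
  obtain ⟨k, hk⟩ := exists_of_stairDeriv_ne_zero (gapLength_pos n) (right_ne_zero_of_mul hn)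
  obtain ⟨j, hj⟩ := exists_of_stairDeriv_ne_zero (gapLength_pos m) (right_ne_zero_of_mul hm)
  exact eq_of_mem_gap hρ hk.1 hk.2 hj.1 hj.2

theorem abs_gapDiff_stairDeriv_le (n : ℤ) (x : ℝ) :
    |gapDiff n * stairDeriv (gapStart ρ n) (gapLength n) x| ≤ gapRatio n := by
  rw [abs_mul, abs_of_nonneg (stairDeriv_nonneg (gapLength_pos n) _ _), ← abs_gapDiff_mul]
  exact mul_le_mul_of_nonneg_left (stairDeriv_le (gapLength_pos n) _ _) (abs_nonneg _)

theorem tendstoUniformly_gapDiff_stairDeriv (hρ : Irrational ρ) :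
    TendstoUniformly
      (fun (s : Finset ℤ) x => ∑ n ∈ s, gapDiff n * stairDeriv (gapStart ρ n) (gapLength n) x)
      (fun x => ∑' n, gapDiff n * stairDeriv (gapStart ρ n) (gapLength n) x) atTop :=
  tendstoUniformly_sum_of_disjoint_support (gapDiff_stairDeriv_disjoint hρ)
    abs_gapDiff_stairDeriv_le fun _ hε => finite_le_gapRatio hε

theorem hasDerivAt_denjoyMap (hρ : Irrational ρ) (x : ℝ) :
    HasDerivAt (denjoyMap ρ)
      (1 + ∑' n, gapDiff n * stairDeriv (gapStart ρ n) (gapLength n) x) x := by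
  have h := hasDerivAt_of_tendstoUniformly (tendstoUniformly_gapDiff_stairDeriv hρ)
    (f := fun s x => ∑ n ∈ s, gapDiff n * stair (gapStart ρ n) (gapLength n) x)
    (.of_forall fun s y => HasDerivAt.fun_sum fun n _ =>
      (hasDerivAt_stair (gapLength_pos n) (gapLength_lt_one n) _ y).const_mul _)
    (fun y => (summable_gapDiff_mul_stair ρ y).hasSum) x
  exact ((hasDerivAt_id x).add_const (denjoyConst ρ)).add h

theorem deriv_denjoyMap_pos (hρ : Irrational ρ) (x : ℝ) : 0 < deriv (denjoyMap ρ) x := by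
  rw [(hasDerivAt_denjoyMap hρ x).deriv]
  by_cases hx : ∃ n, gapDiff n * stairDeriv (gapStart ρ n) (gapLength n) x ≠ 0
  · obtain ⟨n, hn⟩ := hx
    rw [tsum_eq_single n fun m hm => by
      by_contra h
      exact hm (gapDiff_stairDeriv_disjoint hρ x m n h hn)]
    linarith [neg_abs_le (gapDiff n * stairDeriv (gapStart ρ n) (gapLength n) x),
      abs_gapDiff_stairDeriv_le (ρ := ρ) n x, gapRatio_lt_one n]
  · push Not at hx
    simp [hx]

theorem contDiff_denjoyMap (hρ : Irrational ρ) : ContDiff ℝ 1 (denjoyMap ρ) := by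
  rw [contDiff_one_iff_deriv]
  refine ⟨fun x => (hasDerivAt_denjoyMap hρ x).differentiableAt, ?_⟩
  rw [funext fun x => (hasDerivAt_denjoyMap hρ x).deriv]
  refine continuous_const.add ((tendstoUniformly_gapDiff_stairDeriv hρ).continuous
    (.of_forall fun s => continuous_finsetSum s fun n _ => ?_))
  exact (continuous_stairDeriv (gapLength_pos n) (gapLength_lt_one n) _).const_mul _

variable (ρ) in
/-- The semiconjugacy that collapses the gaps. -/
noncomputable def closeGaps (x : ℝ) : ℝ := sSup {t | openGaps ρ t ≤ x}

theorem abs_openGaps_sub_le (t : ℝ) : |openGaps ρ t - (t + openGaps ρ 0)| ≤ 1 := by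
  have h1 := monotone_openGaps ρ (Int.floor_le t)
  have h2 := monotone_openGaps ρ (Int.lt_floor_add_one t).le
  have h3 := openGaps_add_int ρ 0 ⌊t⌋
  have h4 := openGaps_add_int ρ 0 (⌊t⌋ + 1)
  push_cast at h4
  rw [zero_add] at h3 h4
  rw [abs_le]
  constructor <;> linarith [Int.floor_le t, Int.lt_floor_add_one t]

theorem isLUB_closeGaps (x : ℝ) : IsLUB {t | openGaps ρ t ≤ x} (closeGaps ρ x) := by
  refine isLUB_csSup ⟨x - openGaps ρ 0 - 1, ?_⟩ ⟨x - openGaps ρ 0 + 1, fun t ht => ?_⟩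
  · have := abs_le.1 (abs_openGaps_sub_le (ρ := ρ) (x - openGaps ρ 0 - 1))
    change openGaps ρ _ ≤ x
    linarith
  · have := abs_le.1 (abs_openGaps_sub_le (ρ := ρ) t)
    have ht : openGaps ρ t ≤ x := ht
    linarith

theorem monotone_closeGaps : Monotone (closeGaps ρ) := fun x y hxy =>
  (isLUB_closeGaps x).2 fun _ ht => (isLUB_closeGaps y).1 (le_trans ht hxy)

theorem closeGaps_add_one (x : ℝ) : closeGaps ρ (x + 1) = closeGaps ρ x + 1 := by
  apply le_antisymm
  · refine (isLUB_closeGaps _).2 fun t ht => ?_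
    have ht : openGaps ρ t ≤ x + 1 := ht
    have h := openGaps_add_int ρ (t - 1) 1
    have : t - 1 ≤ closeGaps ρ x := (isLUB_closeGaps x).1 (by
      change openGaps ρ (t - 1) ≤ x
      push_cast at h
      rw [sub_add_cancel] at h
      linarith)
    linarith
  · rw [← le_sub_iff_add_le]
    refine (isLUB_closeGaps _).2 fun t ht => ?_
    have ht : openGaps ρ t ≤ x := ht
    have h := openGaps_add_int ρ t 1
    have : t + 1 ≤ closeGaps ρ (x + 1) := (isLUB_closeGaps (x + 1)).1 (by
      change openGaps ρ (t + 1) ≤ x + 1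
      push_cast at h
      linarith)
    linarith

theorem closeGaps_denjoyMap (hρ : Irrational ρ) (x : ℝ) :
    closeGaps ρ (denjoyMap ρ x) = closeGaps ρ x + ρ := by
  have hmono := strictMono_of_deriv_pos (deriv_denjoyMap_pos hρ)
  have key : ∀ t, openGaps ρ (t + ρ) ≤ denjoyMap ρ x ↔ openGaps ρ t ≤ x := fun t => by
    rw [← denjoyMap_openGaps, hmono.le_iff_le]
  apply le_antisymm
  · refine (isLUB_closeGaps _).2 fun t ht => ?_
    have : t - ρ ≤ closeGaps ρ x := (isLUB_closeGaps x).1 ((key (t - ρ)).1 (by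
      rw [sub_add_cancel]
      exact ht))
    linarith
  · rw [← le_sub_iff_add_le]
    refine (isLUB_closeGaps _).2 fun t ht => ?_
    have : t + ρ ≤ closeGaps ρ (denjoyMap ρ x) := (isLUB_closeGaps _).1 ((key t).2 ht)
    linarith

theorem closeGaps_eq_zero {x : ℝ} (hx : x ∈ Set.Icc (gapStart ρ 0) (gapStart ρ 0 + gapLength 0)) :
    closeGaps ρ x = 0 := by
  have h0 : gapStart ρ 0 = openGaps ρ 0 := by simp [gapStart]
  apply le_antisymm
  · refine (isLUB_closeGaps _).2 fun t ht => ?_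
    by_contra! hlt
    have := gapStart_add_gapLength_le ρ (n := 0) (k := 0) (t := t) (by simpa using hlt)
    have ht : openGaps ρ t ≤ x := ht
    simp only [Int.cast_zero, zero_mul, Int.fract_zero, add_zero, sub_zero] at this
    linarith [hx.2]
  · exact (isLUB_closeGaps _).1 (show openGaps ρ 0 ≤ x from h0 ▸ hx.1)

end Denjoy

/-! ### Circle maps with a junction interval -/

/-- One-dimensional data for the torus diffeomorphism. The map `F` rotates with rotation number
`ρ` and `h` is a semiconjugacy to the rotation which collapses the junction interval `[a, c]`.
The map `s` is a slow flow on the junction with fixed points `a`, `t`, `c`, and the switch `χ`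
is `1` around `t` and `0` near the endpoints, with transitions on the fundamental domains
`[s d, d]` and `[s e, e]` of `s`. -/
structure Junction (ρ : ℝ) where
  (F h s χ : ℝ → ℝ)
  (a c t d e : ℝ)
  irrational : Irrational ρ
  pos : 0 < ρ
  lt_one : ρ < 1
  contDiff_F : ContDiff ℝ 1 F
  contDiff_s : ContDiff ℝ 1 s
  contDiff_χ : ContDiff ℝ 1 χ
  deriv_F_pos : ∀ x, 0 < deriv F x
  deriv_s_pos : ∀ x, 0 < deriv s x
  F_add_one : ∀ x, F (x + 1) = F x + 1
  h_add_one : ∀ x, h (x + 1) = h x + 1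
  s_add_one : ∀ x, s (x + 1) = s x + 1
  χ_add_one : ∀ x, χ (x + 1) = χ x
  monotone_h : Monotone h
  h_F : ∀ x, h (F x) = h x + ρ
  h_eq_zero : ∀ x ∈ Set.Icc a c, h x = 0
  a_le_s_d : a ≤ s d
  s_d_lt : s d < d
  d_le_t : d ≤ t
  t_le_s_e : t ≤ s e
  s_e_lt : s e < e
  e_le_c : e ≤ c
  c_lt : c < a + 1
  s_a : s a = a
  s_t : s t = t
  s_c : s c = c
  s_le : ∀ x, s x ≤ x
  s_eq_self : ∀ x ∈ Set.Icc c (a + 1), s x = x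
  χ_nonneg : ∀ x, 0 ≤ χ x
  χ_le_one : ∀ x, χ x ≤ 1
  χ_eq_zero_low : ∀ x ∈ Set.Icc a (s d), χ x = 0
  χ_eq_one : ∀ x ∈ Set.Icc d (s e), χ x = 1
  χ_eq_zero_high : ∀ x ∈ Set.Icc e (a + 1), χ x = 0

section switches

variable {A l x : ℝ}

theorem stair_eq_zero (hl : 0 < l) (h1 : A - 1 + l ≤ x) (h2 : x ≤ A) : stair A l x = 0 := by
  simpa using stair_eq (k := 0) hl (by simpa using h1) (by simpa using h2)

theorem stair_eq_one (hl : 0 < l) (h1 : A + l ≤ x) (h2 : x ≤ A + 1) : stair A l x = 1 := by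
  simpa using stair_eq (k := 1) hl (by simpa using h1) (by simpa using h2)

theorem stair_shift (A l u x : ℝ) : stair (A + u) l x = stair A l (x - u) := by
  unfold stair
  rw [show x - (A + u) = x - u - A by ring]

theorem stair_shift_le (hl : 0 < l) (hl1 : l < 1) (A : ℝ) {u : ℝ} (hu : 0 ≤ u) (x : ℝ) :
    stair (A + u) l x ≤ stair A l x := by
  rw [stair_shift]
  exact monotone_stair hl hl1 A (by linarith)

theorem stair_le_shift_add_one (hl : 0 < l) (hl1 : l < 1) (A : ℝ) {u : ℝ} (hu : u ≤ 1) (x : ℝ) :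
    stair A l x ≤ stair (A + u) l x + 1 := by
  rw [stair_shift, ← stair_add_one]
  exact monotone_stair hl hl1 A (by linarith)

/-- The flow on the interval `[a, a + l]` with fixed points at its endpoints and its midpoint. -/
noncomputable def junctionFlow (a l x : ℝ) : ℝ :=
  x - l / 32 * (stair a (l / 4) x - stair (a + l / 4) (l / 4) x +
    (stair (a + l / 2) (l / 4) x - stair (a + l / 2 + l / 4) (l / 4) x))

theorem hasDerivAt_junctionFlow {l : ℝ} (hl : 0 < l) (hl1 : l < 1) (a x : ℝ) :
    HasDerivAt (junctionFlow a l)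
      (1 - l / 32 * (stairDeriv a (l / 4) x - stairDeriv (a + l / 4) (l / 4) x +
        (stairDeriv (a + l / 2) (l / 4) x - stairDeriv (a + l / 2 + l / 4) (l / 4) x))) x := by
  have h (b : ℝ) := hasDerivAt_stair (l := l / 4) (by positivity) (by linarith) b x
  exact (hasDerivAt_id x).sub ((((h a).sub (h (a + l / 4))).add
    ((h (a + l / 2)).sub (h (a + l / 2 + l / 4)))).const_mul (l / 32))

theorem deriv_junctionFlow_pos {l : ℝ} (hl : 0 < l) (hl1 : l < 1) (a x : ℝ) :
    0 < deriv (junctionFlow a l) x := by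
  rw [(hasDerivAt_junctionFlow hl hl1 a x).deriv]
  have hl4 : 0 < l / 4 := by positivity
  have h1 := stairDeriv_le hl4 a x
  have h2 := stairDeriv_nonneg hl4 (a + l / 4) x
  have h3 := stairDeriv_le hl4 (a + l / 2) x
  have h4 := stairDeriv_nonneg hl4 (a + l / 2 + l / 4) x
  have h5 : l / 32 * (2 / (l / 4) + 2 / (l / 4)) = 1 / 2 := by
    field_simp
    norm_num
  have h6 : l / 32 * (stairDeriv a (l / 4) x - stairDeriv (a + l / 4) (l / 4) x +
      (stairDeriv (a + l / 2) (l / 4) x - stairDeriv (a + l / 2 + l / 4) (l / 4) x)) ≤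
      l / 32 * (2 / (l / 4) + 2 / (l / 4)) :=
    mul_le_mul_of_nonneg_left (by linarith) (by positivity)
  linarith

/-- The switch on the interval `[a, a + l]`. -/
noncomputable def junctionSwitch (a l x : ℝ) : ℝ :=
  stair (a + 7 * l / 32) (l / 32) x - stair (a + 7 * l / 32 + l / 2) (l / 32) x

end switches

theorem nonempty_junction {ρ : ℝ} (hirr : Irrational ρ) (h0 : 0 < ρ) (h1 : ρ < 1) :
    Nonempty (Junction ρ) := by
  obtain ⟨a, ha⟩ : ∃ a, a = gapStart ρ 0 := ⟨_, rfl⟩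
  obtain ⟨l, hl⟩ : ∃ l, l = gapLength 0 := ⟨_, rfl⟩
  have hl0 : 0 < l := hl ▸ gapLength_pos 0
  have hl1 : l < 1 := hl ▸ gapLength_lt_one 0
  have hl4 : 0 < l / 4 := by positivity
  have hl32 : 0 < l / 32 := by positivity
  have hsd : junctionFlow a l (a + l / 4) = a + 7 * l / 32 := by
    rw [junctionFlow, stair_eq_one hl4 (by linarith) (by linarith),
      stair_eq_zero hl4 (by linarith) (by linarith), stair_eq_zero hl4 (by linarith) (by linarith),
      stair_eq_zero hl4 (by linarith) (by linarith)]
    ring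
  have hse : junctionFlow a l (a + 3 * l / 4) = a + 7 * l / 32 + l / 2 := by
    rw [junctionFlow, stair_eq_one hl4 (by linarith) (by linarith),
      stair_eq_one hl4 (by linarith) (by linarith), stair_eq_one hl4 (by linarith) (by linarith),
      stair_eq_zero hl4 (by linarith) (by linarith)]
    ring
  have hself : ∀ x ∈ Set.Icc (a + l) (a + 1), junctionFlow a l x = x := by
    rintro x ⟨hx1, hx2⟩
    rw [junctionFlow, stair_eq_one hl4 (by linarith) (by linarith),
      stair_eq_one hl4 (by linarith) (by linarith), stair_eq_one hl4 (by linarith) (by linarith),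
      stair_eq_one hl4 (by linarith) (by linarith)]
    ring
  have hsmooth (b : ℝ) {u : ℝ} (hu : 0 < u) (hu1 : u < 1) := contDiff_stair hu hu1 b
  refine ⟨{
    F := denjoyMap ρ, h := closeGaps ρ, s := junctionFlow a l, χ := junctionSwitch a l
    a := a, c := a + l, t := a + l / 2, d := a + l / 4, e := a + 3 * l / 4
    irrational := hirr, pos := h0, lt_one := h1
    contDiff_F := contDiff_denjoyMap hirr
    contDiff_s := ?_
    contDiff_χ := (hsmooth _ hl32 (by linarith)).sub (hsmooth _ hl32 (by linarith))
    deriv_F_pos := deriv_denjoyMap_pos hirr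
    deriv_s_pos := deriv_junctionFlow_pos hl0 hl1 a
    F_add_one := denjoyMap_add_one ρ
    h_add_one := closeGaps_add_one
    s_add_one := fun x => ?_
    χ_add_one := fun x => ?_
    monotone_h := monotone_closeGaps
    h_F := closeGaps_denjoyMap hirr
    h_eq_zero := fun x hx => closeGaps_eq_zero (by rwa [← ha, ← hl])
    a_le_s_d := ?_
    s_d_lt := ?_
    d_le_t := by linarith
    t_le_s_e := ?_
    s_e_lt := ?_
    e_le_c := by linarith
    c_lt := by linarith
    s_a := ?_
    s_t := ?_
    s_c := hself _ ⟨le_rfl, by linarith⟩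
    s_le := fun x => ?_
    s_eq_self := hself
    χ_nonneg := fun x => sub_nonneg.2 (stair_shift_le hl32 (by linarith) _ (by linarith) x)
    χ_le_one := fun x => by
      have := stair_le_shift_add_one hl32 (by linarith) (a + 7 * l / 32) (u := l / 2)
        (by linarith) x
      unfold junctionSwitch
      linarith
    χ_eq_zero_low := fun x hx => ?_
    χ_eq_one := fun x hx => ?_
    χ_eq_zero_high := fun x hx => ?_ }⟩
  · exact contDiff_id.sub (contDiff_const.mul (((hsmooth _ hl4 (by linarith)).sub
      (hsmooth _ hl4 (by linarith))).add ((hsmooth _ hl4 (by linarith)).sub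
      (hsmooth _ hl4 (by linarith)))))
  · simp only [junctionFlow, stair_add_one]
    ring
  · simp only [junctionSwitch, stair_add_one]
    ring
  · rw [hsd]
    linarith
  · rw [hsd]
    linarith
  · rw [hse]
    linarith
  · rw [hse]
    linarith
  · rw [junctionFlow, stair_eq_zero hl4 (by linarith) (by linarith),
      stair_eq_zero hl4 (by linarith) (by linarith), stair_eq_zero hl4 (by linarith) (by linarith),
      stair_eq_zero hl4 (by linarith) (by linarith)]
    ring
  · rw [junctionFlow, stair_eq_one hl4 (by linarith) (by linarith),
      stair_eq_one hl4 (by linarith) (by linarith), stair_eq_zero hl4 (by linarith) (by linarith),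
      stair_eq_zero hl4 (by linarith) (by linarith)]
    ring
  · have h1 := stair_shift_le hl4 (by linarith) a hl4.le x
    have h2 := stair_shift_le hl4 (by linarith) (a + l / 2) hl4.le x
    unfold junctionFlow
    nlinarith
  · rw [hsd] at hx
    rw [junctionSwitch, stair_eq_zero hl32 (by linarith [hx.1]) hx.2,
      stair_eq_zero hl32 (by linarith [hx.1]) (by linarith [hx.2]), sub_self]
  · rw [hse] at hx
    rw [junctionSwitch, stair_eq_one hl32 (by linarith [hx.1]) (by linarith [hx.2]),
      stair_eq_zero hl32 (by linarith [hx.1]) hx.2, sub_zero]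
  · rw [junctionSwitch, stair_eq_one hl32 (by linarith [hx.1]) (by linarith [hx.2]),
      stair_eq_one hl32 (by linarith [hx.1]) (by linarith [hx.2]), sub_self]

namespace Junction

variable {ρ : ℝ} (J : Junction ρ)

theorem map_add_int_of_map_add_one {f : ℝ → ℝ} (hf : ∀ x, f (x + 1) = f x + 1) (x : ℝ) (k : ℤ) :
    f (x + k) = f x + k := by
  have hper : Function.Periodic (fun y => f y - y) 1 := fun y => by
    simp only [hf]; ring
  have := hper.int_mul k x
  simp only [mul_one] at this
  linarith

theorem F_add_int (x : ℝ) (k : ℤ) : J.F (x + k) = J.F x + k :=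
  map_add_int_of_map_add_one J.F_add_one x k

theorem h_add_int (x : ℝ) (k : ℤ) : J.h (x + k) = J.h x + k :=
  map_add_int_of_map_add_one J.h_add_one x k

theorem s_add_int (x : ℝ) (k : ℤ) : J.s (x + k) = J.s x + k :=
  map_add_int_of_map_add_one J.s_add_one x k

theorem χ_add_int (x : ℝ) (k : ℤ) : J.χ (x + k) = J.χ x := by
  have hper : Function.Periodic J.χ 1 := J.χ_add_one
  simpa using hper.int_mul k x

theorem strictMono_F : StrictMono J.F := strictMono_of_deriv_pos J.deriv_F_pos

theorem strictMono_s : StrictMono J.s := strictMono_of_deriv_pos J.deriv_s_pos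

theorem lt_F (x : ℝ) : x < J.F x := by
  by_contra! hle
  have := J.monotone_h hle
  rw [J.h_F] at this
  linarith [J.pos]

/-- The map that moves a point the fraction `w` of the way towards its image under `F`. -/
noncomputable def slide (w x : ℝ) : ℝ := x + w * (J.F x - x)

@[simp] theorem slide_zero (x : ℝ) : J.slide 0 x = x := by simp [slide]

@[simp] theorem slide_one (x : ℝ) : J.slide 1 x = J.F x := by simp [slide]

theorem slide_add_int (w x : ℝ) (k : ℤ) : J.slide w (x + k) = J.slide w x + k := by
  simp only [slide, F_add_int]; ring

theorem strictMono_slide {w : ℝ} (hw₀ : 0 ≤ w) (hw₁ : w ≤ 1) : StrictMono (J.slide w) := by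
  intro x y hxy
  have hF := J.strictMono_F hxy
  have hrw : ∀ z, J.slide w z = (1 - w) * z + w * J.F z := fun z => by simp only [slide]; ring
  rw [hrw, hrw]
  rcases hw₀.eq_or_lt with rfl | hpos
  · simpa using hxy
  · have := mul_lt_mul_of_pos_left hF hpos
    have := mul_le_mul_of_nonneg_left hxy.le (sub_nonneg.2 hw₁)
    linarith

theorem le_slide {w : ℝ} (hw₀ : 0 ≤ w) (x : ℝ) : x ≤ J.slide w x := by
  have := mul_nonneg hw₀ (sub_nonneg.2 (J.lt_F x).le)
  simp only [slide]; linarith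

theorem slide_le {w : ℝ} (hw₁ : w ≤ 1) (x : ℝ) : J.slide w x ≤ J.F x := by
  have := mul_nonneg (sub_nonneg.2 hw₁) (sub_nonneg.2 (J.lt_F x).le)
  simp only [slide]; linarith

theorem continuous_F : Continuous J.F := J.contDiff_F.continuous

theorem continuous_s : Continuous J.s := J.contDiff_s.continuous

theorem continuous_χ : Continuous J.χ := J.contDiff_χ.continuous

theorem continuous_slide {f g : ℝ → ℝ} (hf : Continuous f) (hg : Continuous g) :
    Continuous fun r => J.slide (f r) (g r) :=
  hg.add (hf.mul ((J.continuous_F.comp hg).sub hg))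

/-- The half step: slide the first coordinate with strength governed by the second, shear the
second coordinate, and exchange the two. -/
noncomputable def half (z : ℝ × ℝ) : ℝ × ℝ := (J.s z.2, J.slide (J.χ z.2) z.1)

/-- The lift of the torus map: two half steps. -/
noncomputable def step (z : ℝ × ℝ) : ℝ × ℝ := J.half (J.half z)

theorem half_add_int (z : ℝ × ℝ) (i k : ℤ) :
    J.half (z + ((i : ℝ), (k : ℝ))) = J.half z + ((k : ℝ), (i : ℝ)) := by
  ext <;> simp [half, s_add_int, χ_add_int, slide_add_int]

theorem step_add_int (z : ℝ × ℝ) (i k : ℤ) :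
    J.step (z + ((i : ℝ), (k : ℝ))) = J.step z + ((i : ℝ), (k : ℝ)) := by
  simp only [step, half_add_int]

theorem step_iterate_add_int (n : ℕ) (z : ℝ × ℝ) (i k : ℤ) :
    J.step^[n] (z + ((i : ℝ), (k : ℝ))) = J.step^[n] z + ((i : ℝ), (k : ℝ)) := by
  induction n generalizing z with
  | zero => rfl
  | succ n ih => rw [Function.iterate_succ_apply, step_add_int, ih, Function.iterate_succ_apply]

theorem half_injective : Function.Injective J.half := by
  intro z w hzw
  have h₁ : z.2 = w.2 := J.strictMono_s.injective (congrArg Prod.fst hzw)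
  have h₂ : J.slide (J.χ z.2) z.1 = J.slide (J.χ w.2) w.1 := congrArg Prod.snd hzw
  rw [← h₁] at h₂
  exact Prod.ext ((J.strictMono_slide (J.χ_nonneg _) (J.χ_le_one _)).injective h₂) h₁

theorem step_injective : Function.Injective J.step := J.half_injective.comp J.half_injective

theorem contDiff_half : ContDiff ℝ 1 J.half := by
  have hF := J.contDiff_F.comp (contDiff_fst (𝕜 := ℝ) (E := ℝ) (F := ℝ))
  have hχ := J.contDiff_χ.comp (contDiff_snd (𝕜 := ℝ) (E := ℝ) (F := ℝ))
  have hs := J.contDiff_s.comp (contDiff_snd (𝕜 := ℝ) (E := ℝ) (F := ℝ))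
  exact hs.prodMk (contDiff_fst.add (hχ.mul (hF.sub contDiff_fst)))

theorem contDiff_step : ContDiff ℝ 1 J.step := J.contDiff_half.comp J.contDiff_half

theorem continuous_half : Continuous J.half := J.contDiff_half.continuous

theorem exists_hasFDerivAt_half (z : ℝ × ℝ) : ∃ L : (ℝ × ℝ) ≃L[ℝ] (ℝ × ℝ),
    HasFDerivAt J.half (L : (ℝ × ℝ) →L[ℝ] (ℝ × ℝ)) z := by
  have hF : HasDerivAt J.F (deriv J.F z.1) z.1 :=
    (J.contDiff_F.differentiable (by norm_num)).differentiableAt.hasDerivAt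
  have hχ : HasDerivAt J.χ (deriv J.χ z.2) z.2 :=
    (J.contDiff_χ.differentiable (by norm_num)).differentiableAt.hasDerivAt
  have hs : HasDerivAt J.s (deriv J.s z.2) z.2 :=
    (J.contDiff_s.differentiable (by norm_num)).differentiableAt.hasDerivAt
  have h₁ : HasFDerivAt (Prod.fst : ℝ × ℝ → ℝ) (ContinuousLinearMap.fst ℝ ℝ ℝ) z :=
    hasFDerivAt_fst
  have h₂ : HasFDerivAt (Prod.snd : ℝ × ℝ → ℝ) (ContinuousLinearMap.snd ℝ ℝ ℝ) z :=
    hasFDerivAt_snd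
  have hF' := hF.comp_hasFDerivAt z h₁
  have hχ' := hχ.comp_hasFDerivAt z h₂
  have hs' := hs.comp_hasFDerivAt z h₂
  obtain ⟨D, hD, hK⟩ : ∃ D : (ℝ × ℝ) →L[ℝ] (ℝ × ℝ),
      (∀ v, D v = (deriv J.s z.2 * v.2, v.1 + (J.χ z.2 * (deriv J.F z.1 * v.1 - v.1) +
        (J.F z.1 - z.1) * (deriv J.χ z.2 * v.2)))) ∧ HasFDerivAt J.half D z :=
    ⟨_, fun v => rfl, hs'.prodMk (h₁.add (hχ'.mul (hF'.sub h₁)))⟩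
  have hinj : Function.Injective (D : (ℝ × ℝ) →ₗ[ℝ] (ℝ × ℝ)) := by
    rw [injective_iff_map_eq_zero]
    rintro ⟨v, w⟩ hvw
    have e₁ := congrArg Prod.fst hvw
    have e₂ := congrArg Prod.snd hvw
    simp only [ContinuousLinearMap.coe_coe, hD, Prod.fst_zero, Prod.snd_zero] at e₁ e₂
    have hw : w = 0 := (mul_eq_zero.1 e₁).resolve_left (J.deriv_s_pos _).ne'
    subst hw
    have hfac : 0 < 1 + J.χ z.2 * (deriv J.F z.1 - 1) := by
      have h0 := J.χ_nonneg z.2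
      have h1 := J.χ_le_one z.2
      have hd := J.deriv_F_pos z.1
      rcases h0.eq_or_lt with h0 | h0
      · rw [← h0]; simp
      · nlinarith [mul_pos h0 hd]
    have : (1 + J.χ z.2 * (deriv J.F z.1 - 1)) * v = 0 := by
      rw [← e₂]; ring
    have hv : v = 0 := (mul_eq_zero.1 this).resolve_left hfac.ne'
    simp [hv]
  exact ⟨(LinearEquiv.ofInjectiveEndo _ hinj).toContinuousLinearEquiv, hK⟩

theorem exists_hasFDerivAt_step (z : ℝ × ℝ) : ∃ L : (ℝ × ℝ) ≃L[ℝ] (ℝ × ℝ),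
    HasFDerivAt J.step (L : (ℝ × ℝ) →L[ℝ] (ℝ × ℝ)) z := by
  obtain ⟨L, hL⟩ := J.exists_hasFDerivAt_half z
  obtain ⟨M, hM⟩ := J.exists_hasFDerivAt_half (J.half z)
  exact ⟨L.trans M, hM.comp z hL⟩

theorem a_lt_c : J.a < J.c :=
  J.a_le_s_d.trans_lt <| J.s_d_lt.trans_le <| J.d_le_t.trans <| J.t_le_s_e.trans <|
    J.s_e_lt.le.trans J.e_le_c

theorem χ_eq_zero_of_c_le {x : ℝ} (hx : x ∈ Set.Icc J.c (J.a + 1)) : J.χ x = 0 :=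
  J.χ_eq_zero_high x ⟨J.e_le_c.trans hx.1, hx.2⟩

theorem exists_eq_add_int (x : ℝ) : ∃ y ∈ Set.Ico J.a (J.a + 1), ∃ k : ℤ, x = y + k :=
  ⟨x - ⌊x - J.a⌋, ⟨by linarith [Int.floor_le (x - J.a)],
    by linarith [Int.lt_floor_add_one (x - J.a)]⟩, ⌊x - J.a⌋, by ring⟩

/-- Away from the integer level sets of `h` nothing happens. -/
theorem exists_h_eq_or (x : ℝ) : (∃ k : ℤ, J.h x = k) ∨ (J.χ x = 0 ∧ J.s x = x) := by
  obtain ⟨y, hy, k, rfl⟩ := J.exists_eq_add_int x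
  rw [h_add_int, χ_add_int, s_add_int]
  rcases le_total y J.c with hyc | hyc
  · exact .inl ⟨k, by rw [J.h_eq_zero y ⟨hy.1, hyc⟩, zero_add]⟩
  · exact .inr ⟨J.χ_eq_zero_of_c_le ⟨hyc, hy.2.le⟩, by rw [J.s_eq_self y ⟨hyc, hy.2.le⟩]⟩

theorem h_s (x : ℝ) : J.h (J.s x) = J.h x := by
  obtain ⟨y, hy, k, rfl⟩ := J.exists_eq_add_int x
  rw [s_add_int, h_add_int, h_add_int]
  rcases le_total y J.c with hyc | hyc
  · rw [J.h_eq_zero y ⟨hy.1, hyc⟩, J.h_eq_zero]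
    exact ⟨J.s_a ▸ J.strictMono_s.monotone hy.1, J.s_c ▸ J.strictMono_s.monotone hyc⟩
  · rw [J.s_eq_self y ⟨hyc, hy.2.le⟩]

theorem h_a : J.h J.a = 0 := J.h_eq_zero _ ⟨le_rfl, J.a_lt_c.le⟩

theorem h_c : J.h J.c = 0 := J.h_eq_zero _ ⟨J.a_lt_c.le, le_rfl⟩

theorem abs_h_sub_le (x : ℝ) : |J.h x - (x - J.a)| ≤ 1 := by
  obtain ⟨y, hy, k, rfl⟩ := J.exists_eq_add_int x
  have h₀ := J.monotone_h hy.1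
  have h₁ := J.monotone_h hy.2.le
  rw [J.h_add_one] at h₁
  rw [h_a] at h₀ h₁
  rw [h_add_int, abs_le]
  constructor <;> linarith [hy.1, hy.2]

/-- The semiconjugacy `h` turns the iterates of `F` into translations. -/
theorem h_iterate_F (n : ℕ) (x : ℝ) : J.h (J.F^[n] x) = J.h x + n * ρ := by
  induction n with
  | zero => simp
  | succ n ih => rw [Function.iterate_succ_apply', J.h_F, ih]; push_cast; ring

theorem nat_mul_ne_int {n : ℕ} (hn : n ≠ 0) (hirr : Irrational ρ) (k : ℤ) : (n : ℝ) * ρ ≠ k :=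
  (hirr.natCast_mul hn).ne_int k

theorem lt_of_h_lt {x y : ℝ} (hxy : J.h x < J.h y) : x < y := by
  by_contra! hle
  exact absurd (J.monotone_h hle) (not_le.2 hxy)

end Junction

/-! ### Subintervals on which a function stays on one side of a value, or in a band -/

theorem exists_uIcc_ge {φ : ℝ → ℝ} (hφ : Continuous φ) {u r₀ r₁ : ℝ} (h₀ : φ r₀ ≤ u)
    (h₁ : u ≤ φ r₁) :
    ∃ r ∈ Set.uIcc r₀ r₁, φ r = u ∧ ∀ x ∈ Set.uIcc r r₁, u ≤ φ x := by
  wlog hle : r₀ ≤ r₁ generalizing φ r₀ r₁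
  · obtain ⟨r, hr, hru, hrx⟩ := this (φ := fun x => φ (-x)) (hφ.comp continuous_neg)
      (r₀ := -r₀) (r₁ := -r₁) (by simpa using h₀) (by simpa using h₁) (by linarith)
    have hneg : ∀ {x y z : ℝ}, x ∈ Set.uIcc y z → -x ∈ Set.uIcc (-y) (-z) := by
      intro x y z hx
      rw [Set.mem_uIcc] at hx ⊢
      rcases hx with hx | hx
      · exact .inr ⟨neg_le_neg hx.2, neg_le_neg hx.1⟩
      · exact .inl ⟨neg_le_neg hx.2, neg_le_neg hx.1⟩
    refine ⟨-r, by simpa using hneg hr, hru, fun x hx => ?_⟩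
    simpa using hrx (-x) (by simpa using hneg hx)
  have hcomp : IsCompact (Set.Icc r₀ r₁ ∩ {r | φ r ≤ u}) :=
    isCompact_Icc.inter_right (isClosed_le hφ continuous_const)
  obtain ⟨r, ⟨hr, hru⟩, hmax⟩ := hcomp.exists_isGreatest ⟨r₀, ⟨le_rfl, hle⟩, h₀⟩
  obtain ⟨r', hr', hr'u⟩ := intermediate_value_Icc hr.2 hφ.continuousOn ⟨hru, h₁⟩
  have hrr' : r' = r := le_antisymm (hmax ⟨⟨hr.1.trans hr'.1, hr'.2⟩, hr'u.le⟩) hr'.1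
  subst hrr'
  refine ⟨r', Set.Icc_subset_uIcc hr, hr'u, fun x hx => ?_⟩
  rw [Set.uIcc_of_le hr.2] at hx
  by_contra! hlt
  have : x = r' := le_antisymm (hmax ⟨⟨hr.1.trans hx.1, hx.2⟩, hlt.le⟩) hx.1
  rw [this, hr'u] at hlt
  exact lt_irrefl _ hlt

theorem exists_uIcc_mem_Icc {φ : ℝ → ℝ} (hφ : Continuous φ) {u v r₀ r₁ : ℝ} (huv : u ≤ v)
    (h₀ : φ r₀ ≤ u) (h₁ : v ≤ φ r₁) :
    ∃ r ∈ Set.uIcc r₀ r₁, ∃ r' ∈ Set.uIcc r₀ r₁, φ r = u ∧ φ r' = v ∧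
      ∀ x ∈ Set.uIcc r r', φ x ∈ Set.Icc u v := by
  obtain ⟨r, hr, hru, hge⟩ := exists_uIcc_ge hφ h₀ (huv.trans h₁)
  obtain ⟨r', hr', hr'v, hle⟩ := exists_uIcc_ge (φ := fun x => -φ x) hφ.neg (u := -v)
    (r₀ := r₁) (r₁ := r) (neg_le_neg h₁) (by rw [hru]; exact neg_le_neg huv)
  rw [Set.uIcc_comm] at hr'
  refine ⟨r, hr, r', Set.uIcc_subset_uIcc hr Set.right_mem_uIcc hr', hru, by linarith,
    fun x hx => ⟨hge x (Set.uIcc_subset_uIcc Set.left_mem_uIcc hr' hx), ?_⟩⟩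
  have := hle x (by rwa [Set.uIcc_comm])
  linarith

namespace Junction

variable {ρ : ℝ} (J : Junction ρ)

/-- On the parameter interval between `r₀` and `r₁`, the curve `γ` crosses the rectangle
`[a, b] × [a, c]` from bottom to top. -/
def Crosses (b : ℝ) (γ : ℝ → ℝ × ℝ) (r₀ r₁ : ℝ) : Prop :=
  (γ r₀).2 = J.a ∧ (γ r₁).2 = J.c ∧
    ∀ r ∈ Set.uIcc r₀ r₁, (γ r).1 ∈ Set.Icc J.a b ∧ (γ r).2 ∈ Set.Icc J.a J.c

/-- Every curve crossing the rectangle of width parameter `b` contains an arc which, after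
`2 n + 1` half steps, crosses the rectangle of width parameter `b'`, translated by `(0, p)`. -/
def Runs (n : ℕ) (b b' : ℝ) (p : ℕ) : Prop :=
  ∀ (γ : ℝ → ℝ × ℝ) (r₀ r₁ : ℝ), Continuous γ → J.Crosses b γ r₀ r₁ →
    ∃ r₀' ∈ Set.uIcc r₀ r₁, ∃ r₁' ∈ Set.uIcc r₀ r₁,
      J.Crosses b' (fun r => J.half (J.step^[n] (γ r)) - ((0 : ℝ), (p : ℝ))) r₀' r₁'

/-- Every curve crossing the narrow rectangle contains an arc which, after `n` steps, crosses
the narrow rectangle translated by `(p, q)`. -/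
def Realizes (n p q : ℕ) : Prop :=
  ∀ (γ : ℝ → ℝ × ℝ) (r₀ r₁ : ℝ), Continuous γ → J.Crosses (J.s J.d) γ r₀ r₁ →
    ∃ r₀' ∈ Set.uIcc r₀ r₁, ∃ r₁' ∈ Set.uIcc r₀ r₁,
      J.Crosses (J.s J.d) (fun r => J.step^[n] (γ r) - ((p : ℝ), (q : ℝ))) r₀' r₁'

theorem continuous_step_iterate (n : ℕ) : Continuous J.step^[n] :=
  J.contDiff_step.continuous.iterate n

theorem half_sub_nat (z : ℝ × ℝ) (p q : ℕ) :
    J.half (z - ((p : ℝ), (q : ℝ))) = J.half z - ((q : ℝ), (p : ℝ)) := by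
  have := J.half_add_int (z - ((p : ℝ), (q : ℝ))) p q
  simp only [Int.cast_natCast, sub_add_cancel] at this
  rw [this, add_sub_cancel_right]

theorem step_iterate_sub_nat (n : ℕ) (z : ℝ × ℝ) (p q : ℕ) :
    J.step^[n] (z - ((p : ℝ), (q : ℝ))) = J.step^[n] z - ((p : ℝ), (q : ℝ)) := by
  have := J.step_iterate_add_int n (z - ((p : ℝ), (q : ℝ))) p q
  simp only [Int.cast_natCast, sub_add_cancel] at this
  rw [this, add_sub_cancel_right]

theorem half_step_iterate (n : ℕ) (z : ℝ × ℝ) :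
    J.half (J.step^[n] z) = J.step^[n] (J.half z) :=
  ((show Function.Commute J.half J.step from fun _ => rfl).iterate_right n).eq z

variable {J}

theorem Crosses.mono {b b' : ℝ} {γ : ℝ → ℝ × ℝ} {r₀ r₁ : ℝ} (h : J.Crosses b γ r₀ r₁)
    (hb : b ≤ b') : J.Crosses b' γ r₀ r₁ :=
  ⟨h.1, h.2.1, fun r hr => ⟨⟨(h.2.2 r hr).1.1, (h.2.2 r hr).1.2.trans hb⟩, (h.2.2 r hr).2⟩⟩

theorem Runs.realizes {b : ℝ} {m n p q : ℕ} (hp : J.Runs m (J.s J.d) b p)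
    (hq : J.Runs n b (J.s J.d) q) : J.Realizes (m + n + 1) p q := by
  intro γ r₀ r₁ hγ hcross
  obtain ⟨u₀, hu₀, u₁, hu₁, hu⟩ := hp γ r₀ r₁ hγ hcross
  have hcont : Continuous fun r => J.half (J.step^[m] (γ r)) - ((0 : ℝ), (p : ℝ)) :=
    (J.continuous_half.comp ((J.continuous_step_iterate m).comp hγ)).sub continuous_const
  obtain ⟨v₀, hv₀, v₁, hv₁, hv⟩ := hq _ u₀ u₁ hcont hu
  refine ⟨v₀, Set.uIcc_subset_uIcc hu₀ hu₁ hv₀, v₁, Set.uIcc_subset_uIcc hu₀ hu₁ hv₁, ?_⟩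
  convert hv using 2 with r
  have h₁ := J.step_iterate_sub_nat n (J.half (J.step^[m] (γ r))) 0 p
  have h₂ := J.half_sub_nat (J.step^[n] (J.half (J.step^[m] (γ r)))) 0 p
  simp only [Nat.cast_zero] at h₁ h₂
  rw [h₁, h₂, half_step_iterate, show J.half (J.half (J.step^[m] (γ r))) =
    J.step (J.step^[m] (γ r)) from rfl, ← Function.iterate_succ_apply, ← Function.iterate_add_apply,
    show n.succ + m = m + n + 1 by omega, sub_sub]
  simp

theorem Realizes.add {m n p q p' q' : ℕ} (h : J.Realizes m p q) (h' : J.Realizes n p' q') :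
    J.Realizes (m + n) (p + p') (q + q') := by
  intro γ r₀ r₁ hγ hcross
  obtain ⟨u₀, hu₀, u₁, hu₁, hu⟩ := h γ r₀ r₁ hγ hcross
  obtain ⟨v₀, hv₀, v₁, hv₁, hv⟩ := h' (fun r => J.step^[m] (γ r) - ((p : ℝ), (q : ℝ))) u₀ u₁
    (((J.continuous_step_iterate m).comp hγ).sub continuous_const) hu
  refine ⟨v₀, Set.uIcc_subset_uIcc hu₀ hu₁ hv₀, v₁, Set.uIcc_subset_uIcc hu₀ hu₁ hv₁, ?_⟩
  convert hv using 2 with r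
  rw [step_iterate_sub_nat, ← Function.iterate_add_apply, add_comm m n, sub_sub]
  simp

theorem Realizes.zero : J.Realizes 0 0 0 := fun γ r₀ r₁ _ h =>
  ⟨r₀, Set.left_mem_uIcc, r₁, Set.right_mem_uIcc, by simpa [← Prod.zero_eq_mk] using h⟩

theorem Realizes.mul {n p q : ℕ} (h : J.Realizes n p q) (k : ℕ) :
    J.Realizes (k * n) (k * p) (k * q) := by
  induction k with
  | zero => simpa using Realizes.zero
  | succ k ih => simpa only [Nat.succ_mul] using ih.add h

variable (J)

theorem s_d_lt_c : J.s J.d < J.c :=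
  J.s_d_lt.trans_le <| J.d_le_t.trans <| J.t_le_s_e.trans <| J.s_e_lt.le.trans J.e_le_c

/-- A realized displacement is the displacement of an orbit, up to a bounded error. -/
theorem Realizes.exists_point {n p q : ℕ} (h : J.Realizes n p q) :
    ∃ z : ℝ × ℝ, ‖J.step^[n] z - z - ((p : ℝ), (q : ℝ))‖ ≤ 1 := by
  obtain ⟨u, hu, _, _, hcross⟩ := h (fun r => (J.a, r)) J.a J.c (by fun_prop)
    ⟨rfl, rfl, fun r hr => ⟨⟨le_rfl, J.a_le_s_d⟩, by rwa [Set.uIcc_of_le J.a_lt_c.le] at hr⟩⟩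
  rw [Set.uIcc_of_le J.a_lt_c.le] at hu
  refine ⟨(J.a, u), ?_⟩
  have hmem := hcross.2.2 u Set.left_mem_uIcc
  simp only [Prod.fst_sub, Prod.snd_sub, Set.mem_Icc] at hmem
  have := J.c_lt
  have := J.s_d_lt_c
  refine max_le ?_ ?_ <;> simp only [Prod.fst_sub, Prod.snd_sub, Real.norm_eq_abs, abs_le] <;>
    constructor <;> linarith [hmem.1.1, hmem.1.2, hmem.2.1, hmem.2.2, hu.1, hu.2]

theorem step_of_χ_eq_one {x y : ℝ} (hy : J.χ y = 1) (hx : J.χ (J.F x) = 0)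
    (hx' : J.s (J.F x) = J.F x) : J.step (x, y) = (J.F x, J.s y) := by
  simp [step, half, hy, hx, hx']

theorem step_of_χ_eq_zero {x y : ℝ} (hy : J.χ y = 0) (hx : J.χ x = 0) :
    J.step (x, y) = (J.s x, J.s y) := by
  simp [step, half, hy, hx]

theorem iterate_s_mem {x : ℝ} {u : ℝ} (hu : J.s u = u) (hx : u ≤ x) (n : ℕ) :
    J.s^[n] x ∈ Set.Icc u x := by
  induction n with
  | zero => exact ⟨hx, le_rfl⟩
  | succ n ih =>
    rw [Function.iterate_succ_apply']
    exact ⟨hu ▸ J.strictMono_s.monotone ih.1, (J.s_le _).trans ih.2⟩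

theorem iterate_s_antitone (x : ℝ) : Antitone fun n => J.s^[n] x :=
  antitone_nat_of_succ_le fun n => by
    rw [Function.iterate_succ_apply']; exact J.s_le _

theorem iterate_s_fixed {u : ℝ} (hu : J.s u = u) (n : ℕ) : J.s^[n] u = u :=
  Function.iterate_fixed hu n

/-- If the iterates of `y` have not passed `s u` after `n` steps, then the earlier ones have not
passed `u`. -/
theorem le_iterate_s {y u : ℝ} {i n : ℕ} (hin : i < n) (hy : J.s u ≤ J.s^[n] y) :
    u ≤ J.s^[i] y := by
  obtain ⟨k, rfl⟩ : ∃ k, n = k + 1 := ⟨n - 1, by omega⟩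
  rw [Function.iterate_succ_apply', J.strictMono_s.le_iff_le] at hy
  exact hy.trans (J.iterate_s_antitone y (Nat.lt_succ_iff.1 hin))

theorem le_of_iterate_s_le {y u : ℝ} {n : ℕ} (hu : J.s u = u) (hy : J.s^[n] y ≤ u) : y ≤ u := by
  rw [← J.iterate_s_fixed hu n] at hy
  exact (J.strictMono_s.iterate n).le_iff_le.1 hy

theorem idle_of_h_ne {x : ℝ} (hx : ∀ k : ℤ, J.h x ≠ k) : J.χ x = 0 ∧ J.s x = x :=
  (J.exists_h_eq_or x).resolve_left fun ⟨k, hk⟩ => hx k hk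

theorem h_a_add_nat (p : ℕ) : J.h (J.a + p) = p := by
  simpa [h_a] using J.h_add_int J.a p

theorem h_c_add_nat (p : ℕ) : J.h (J.c + p) = p := by
  simpa [h_c] using J.h_add_int J.c p

/-- The part of a normal run in which only the first coordinate is translated. -/
theorem step_iterate_eq_of_χ_eq_one {x y : ℝ} (hx : x ∈ Set.Icc J.a J.c) {m j : ℕ}
    (hy : ∀ i < m, J.s^[i] y ∈ Set.Icc J.d (J.s J.e)) (hj : j ≤ m) :
    J.step^[j] (x, y) = (J.F^[j] x, J.s^[j] y) := by
  induction j with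
  | zero => rfl
  | succ j ih =>
    have hidle := J.idle_of_h_ne (x := J.F (J.F^[j] x)) fun k => by
      rw [← Function.iterate_succ_apply' J.F, h_iterate_F, J.h_eq_zero x hx, zero_add]
      exact nat_mul_ne_int j.succ_ne_zero J.irrational k
    rw [Function.iterate_succ_apply', ih (by omega),
      J.step_of_χ_eq_one (J.χ_eq_one _ (hy j (by omega))) hidle.1 hidle.2,
      Function.iterate_succ_apply', Function.iterate_succ_apply']

/-- A normal run: a crossing curve is advanced by `p` in as few steps as possible. -/
theorem runs_normal {m p : ℕ} (hm : m * ρ < p) (hm' : (p : ℝ) < (m + 1) * ρ) :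
    J.Runs m J.c (J.s J.d) p := by
  intro γ r₀ r₁ hγ ⟨hr₀, hr₁, hr⟩
  have hsm : Continuous J.s^[m] := J.continuous_s.iterate m
  have hFm : Continuous J.F^[m] := J.continuous_F.iterate m
  have hd_le_c : J.d ≤ J.c := J.d_le_t.trans <| J.t_le_s_e.trans <| J.s_e_lt.le.trans J.e_le_c
  obtain ⟨u₀, hu₀, u₁, hu₁, hu₀d, hu₁d, hu⟩ := exists_uIcc_mem_Icc
    (φ := fun r => J.s^[m] (γ r).2) (hsm.comp (continuous_snd.comp hγ)) J.s_d_lt.le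
    (r₀ := r₀) (r₁ := r₁) (by rw [hr₀, J.iterate_s_fixed J.s_a]; exact J.a_le_s_d)
    (by rw [hr₁, J.iterate_s_fixed J.s_c]; exact hd_le_c)
  have hsub : Set.uIcc u₀ u₁ ⊆ Set.uIcc r₀ r₁ := Set.uIcc_subset_uIcc hu₀ hu₁
  have hhalf : ∀ r ∈ Set.uIcc u₀ u₁, J.half (J.step^[m] (γ r)) =
      (J.s^[m + 1] (γ r).2, J.slide (J.χ (J.s^[m] (γ r).2)) (J.F^[m] (γ r).1)) := by
    intro r hru
    have hyt := J.le_of_iterate_s_le J.s_t ((hu r hru).2.trans J.d_le_t)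
    have := J.step_iterate_eq_of_χ_eq_one (hr r (hsub hru)).1 (y := (γ r).2) (m := m)
      (fun i hi => ⟨J.le_iterate_s hi (hu r hru).1,
        (J.iterate_s_antitone (γ r).2 (Nat.zero_le i)).trans (hyt.trans J.t_le_s_e)⟩) le_rfl
    rw [show γ r = ((γ r).1, (γ r).2) from rfl, this, Function.iterate_succ_apply']
    rfl
  have hh : ∀ r ∈ Set.uIcc u₀ u₁, ∀ j : ℕ, J.h (J.F^[j] (γ r).1) = j * ρ := fun r hru j => by
    rw [h_iterate_F, J.h_eq_zero _ (hr r (hsub hru)).1, zero_add]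
  obtain ⟨v₀, hv₀, v₁, hv₁, hv₀a, hv₁c, hv⟩ := exists_uIcc_mem_Icc
    (φ := fun r => J.slide (J.χ (J.s^[m] (γ r).2)) (J.F^[m] (γ r).1))
    (J.continuous_slide (J.continuous_χ.comp (hsm.comp (continuous_snd.comp hγ)))
      (hFm.comp (continuous_fst.comp hγ)))
    (u := J.a + p) (v := J.c + p) (r₀ := u₀) (r₁ := u₁) (by linarith [J.a_lt_c])
    (by
      rw [hu₀d, J.χ_eq_zero_low _ ⟨J.a_le_s_d, le_rfl⟩, slide_zero]
      refine (J.lt_of_h_lt ?_).le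
      rw [hh _ Set.left_mem_uIcc, h_a_add_nat]
      exact hm)
    (by
      rw [hu₁d, J.χ_eq_one _ ⟨le_rfl, J.d_le_t.trans J.t_le_s_e⟩, slide_one,
        ← Function.iterate_succ_apply' J.F]
      refine (J.lt_of_h_lt ?_).le
      rw [hh _ Set.right_mem_uIcc, h_c_add_nat]
      exact_mod_cast hm')
  have hsub' : Set.uIcc v₀ v₁ ⊆ Set.uIcc u₀ u₁ := Set.uIcc_subset_uIcc hv₀ hv₁
  refine ⟨v₀, hsub hv₀, v₁, hsub hv₁, ?_, ?_, fun r hrv => ⟨?_, ?_⟩⟩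
  · simp [hhalf _ hv₀, hv₀a]
  · simp [hhalf _ hv₁, hv₁c]
  · simp only [hhalf _ (hsub' hrv), Prod.fst_sub, sub_zero]
    refine ⟨(J.iterate_s_mem J.s_a (hr r (hsub (hsub' hrv))).2.1 _).1, ?_⟩
    rw [Function.iterate_succ_apply']
    exact J.strictMono_s.monotone (hu r (hsub' hrv)).2
  · simp only [hhalf _ (hsub' hrv), Prod.snd_sub, Set.mem_Icc]
    have := hv r hrv
    constructor <;> linarith [this.1, this.2]


/-- While the second coordinate lies above `e` and the first one below `s d`, neither coordinate
is translated. -/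
theorem step_iterate_eq_of_χ_eq_zero {x y : ℝ} (hx : x ∈ Set.Icc J.a (J.s J.d)) {m j : ℕ}
    (hy : ∀ i < m, J.s^[i] y ∈ Set.Icc J.e (J.a + 1)) (hj : j ≤ m) :
    J.step^[j] (x, y) = (J.s^[j] x, J.s^[j] y) := by
  induction j with
  | zero => rfl
  | succ j ih =>
    have hxj := J.iterate_s_mem J.s_a hx.1 j
    rw [Function.iterate_succ_apply', ih (by omega),
      J.step_of_χ_eq_zero (J.χ_eq_zero_high _ (hy j (by omega)))
        (J.χ_eq_zero_low _ ⟨hxj.1, hxj.2.trans hx.2⟩),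
      Function.iterate_succ_apply', Function.iterate_succ_apply']

theorem le_iterate_F (x : ℝ) (n : ℕ) : x ≤ J.F^[n] x := by
  induction n with
  | zero => exact le_rfl
  | succ n ih => rw [Function.iterate_succ_apply']; exact ih.trans (J.lt_F _).le

/-- As long as the translates of `w` stay in the plateau-free part, they move freely. -/
theorem step_iterate_eq_of_mem_Icc {w y : ℝ} {m j : ℕ}
    (hw : ∀ i ≤ m, J.F^[i] w ∈ Set.Icc J.c (J.a + 1))
    (hy : ∀ i < m, J.s^[i] y ∈ Set.Icc J.d (J.s J.e)) (hj : j ≤ m) :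
    J.step^[j] (w, y) = (J.F^[j] w, J.s^[j] y) := by
  induction j with
  | zero => rfl
  | succ j ih =>
    have hFj := hw (j + 1) hj
    rw [Function.iterate_succ_apply'] at hFj
    rw [Function.iterate_succ_apply', ih (by omega),
      J.step_of_χ_eq_one (J.χ_eq_one _ (hy j (by omega))) (J.χ_eq_zero_of_c_le hFj)
        (J.s_eq_self _ hFj), Function.iterate_succ_apply', Function.iterate_succ_apply']

/-- A slow run: a crossing curve is advanced by `1` after resting for `l` steps. -/
theorem runs_slow {m : ℕ} (hm₀ : m * ρ < 1) (hm₁ : 1 < (m + 1) * ρ) (l : ℕ) :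
    J.Runs (l + m) (J.s J.d) J.c 1 := by
  obtain ⟨n, rfl⟩ : ∃ n, m = n + 1 := ⟨m - 1, by
    rcases m.eq_zero_or_pos with rfl | h
    · simp at hm₁; linarith [J.lt_one]
    · omega⟩
  intro γ r₀ r₁ hγ ⟨hr₀, hr₁, hr⟩
  have hsl : Continuous J.s^[l] := J.continuous_s.iterate l
  have hx : Continuous fun r => J.s^[l] (γ r).1 := hsl.comp (continuous_fst.comp hγ)
  have hy : Continuous fun r => J.s^[l] (γ r).2 := hsl.comp (continuous_snd.comp hγ)
  have hse_a : J.a ≤ J.s J.e :=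
    J.a_le_s_d.trans <| J.s_d_lt.le.trans <| J.d_le_t.trans J.t_le_s_e
  obtain ⟨u₁, hu₁, u₀, hu₀, hu₁e, hu₀e, hu⟩ := exists_uIcc_mem_Icc hy J.s_e_lt.le
    (r₀ := r₀) (r₁ := r₁) (by rw [hr₀, J.iterate_s_fixed J.s_a]; exact hse_a)
    (by rw [hr₁, J.iterate_s_fixed J.s_c]; exact J.e_le_c)
  rw [Set.uIcc_comm] at hu
  have hsub : Set.uIcc u₀ u₁ ⊆ Set.uIcc r₀ r₁ := Set.uIcc_subset_uIcc hu₀ hu₁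
  have hxmem : ∀ r ∈ Set.uIcc u₀ u₁, J.s^[l] (γ r).1 ∈ Set.Icc J.a (J.s J.d) := fun r hru => by
    have h := (hr r (hsub hru)).1
    have h' := J.iterate_s_mem J.s_a h.1 l
    exact ⟨h'.1, h'.2.trans h.2⟩
  have hplateau : ∀ x ∈ Set.Icc J.a (J.s J.d), J.h x = 0 := fun x h =>
    J.h_eq_zero x ⟨h.1, h.2.trans J.s_d_lt_c.le⟩
  set w : ℝ → ℝ := fun r => J.slide (J.χ (J.s^[l] (γ r).2)) (J.s^[l] (γ r).1) with hw
  have hwcont : Continuous w := J.continuous_slide (J.continuous_χ.comp hy) hx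
  have hrest : ∀ r ∈ Set.uIcc u₀ u₁,
      J.step^[l] (γ r) = (J.s^[l] (γ r).1, J.s^[l] (γ r).2) := fun r hru =>
    J.step_iterate_eq_of_χ_eq_zero (m := l) (hr r (hsub hru)).1
      (fun i hi => ⟨J.le_iterate_s hi (hu r hru).1,
        (J.iterate_s_antitone (γ r).2 (Nat.zero_le i)).trans
          ((hr r (hsub hru)).2.2.trans J.c_lt.le)⟩) le_rfl
  have hw_one : w u₁ = J.F (J.s^[l] (γ u₁).1) := by
    simp only [hw]
    rw [hu₁e, J.χ_eq_one _ ⟨J.d_le_t.trans J.t_le_s_e, le_rfl⟩, slide_one]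
  obtain ⟨v₀, hv₀, hv₀c, hv⟩ := exists_uIcc_ge hwcont (u := J.c) (r₀ := u₀) (r₁ := u₁)
    (by
      simp only [hw]
      rw [hu₀e, J.χ_eq_zero_high _ ⟨le_rfl, J.e_le_c.trans J.c_lt.le⟩, slide_zero]
      exact (hxmem _ Set.left_mem_uIcc).2.trans J.s_d_lt_c.le)
    (by
      rw [hw_one]
      refine (J.lt_of_h_lt ?_).le
      rw [J.h_F, h_c, hplateau _ (hxmem _ Set.right_mem_uIcc), zero_add]
      exact J.pos)
  have hsub' : Set.uIcc v₀ u₁ ⊆ Set.uIcc u₀ u₁ := Set.uIcc_subset_uIcc hv₀ Set.right_mem_uIcc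
  have hwF : ∀ r ∈ Set.uIcc v₀ u₁, ∀ i ≤ n, J.F^[i] (w r) ∈ Set.Icc J.c (J.a + 1) := by
    intro r hrv i hi
    refine ⟨(hv r hrv).trans (J.le_iterate_F _ _), (J.lt_of_h_lt ?_).le⟩
    have h₁ : J.h (w r) ≤ ρ := by
      have := J.monotone_h (J.slide_le (J.χ_le_one (J.s^[l] (γ r).2)) (J.s^[l] (γ r).1))
      rwa [J.h_F, hplateau _ (hxmem _ (hsub' hrv)), zero_add] at this
    rw [h_iterate_F, J.h_add_one, h_a, zero_add]
    have h₂ : (i : ℝ) * ρ ≤ n * ρ := by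
      have := J.pos
      gcongr
    push_cast at hm₀
    linarith
  have hymem : ∀ r ∈ Set.uIcc v₀ u₁, ∀ i, J.s^[i] (J.s (J.s^[l] (γ r).2)) ∈
      Set.Icc J.d (J.s J.e) := by
    intro r hrv i
    have h := hu r (hsub' hrv)
    have h₁ := J.strictMono_s.monotone h.2
    have h₂ : J.t ≤ J.s (J.s^[l] (γ r).2) :=
      J.s_t ▸ J.strictMono_s.monotone (J.t_le_s_e.trans h.1)
    have h₃ := J.iterate_s_mem J.s_t h₂ i
    exact ⟨J.d_le_t.trans h₃.1, h₃.2.trans h₁⟩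
  have hhalf : ∀ r ∈ Set.uIcc v₀ u₁, J.half (J.step^[l + (n + 1)] (γ r)) =
      (J.s^[n + 1] (J.s (J.s^[l] (γ r).2)), J.F^[n + 1] (w r)) := by
    intro r hrv
    have hwr := hwF r hrv 0 (Nat.zero_le _)
    have hfirst : J.step (J.s^[l] (γ r).1, J.s^[l] (γ r).2) = (w r, J.s (J.s^[l] (γ r).2)) := by
      have hχ := J.χ_eq_zero_of_c_le hwr
      have hs := J.s_eq_self _ hwr
      simp only [Function.iterate_zero, id] at hχ hs
      change (J.s (w r), J.slide (J.χ (w r)) (J.s (J.s^[l] (γ r).2))) = _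
      rw [hχ, hs, slide_zero]
    rw [show l + (n + 1) = n + 1 + l by omega, Function.iterate_add_apply, hrest r (hsub' hrv),
      Function.iterate_succ_apply, hfirst,
      J.step_iterate_eq_of_mem_Icc (m := n) (hwF r hrv) (fun i _ => hymem r hrv i) le_rfl]
    simp only [half]
    rw [J.χ_eq_one _ (hymem r hrv n), slide_one, Function.iterate_succ_apply',
      Function.iterate_succ_apply']
  obtain ⟨q₀, hq₀, q₁, hq₁, hq₀a, hq₁c, hq⟩ := exists_uIcc_mem_Icc
    (φ := fun r => J.F^[n + 1] (w r)) ((J.continuous_F.iterate (n + 1)).comp hwcont)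
    (u := J.a + 1) (v := J.c + 1) (r₀ := v₀) (r₁ := u₁) (by linarith [J.a_lt_c])
    (by
      refine (J.lt_of_h_lt ?_).le
      rw [hv₀c, h_iterate_F, h_c, J.h_add_one, h_a, zero_add, zero_add]
      exact hm₀)
    (by
      refine (J.lt_of_h_lt ?_).le
      rw [hw_one, h_iterate_F, J.h_F, hplateau _ (hxmem _ Set.right_mem_uIcc), J.h_add_one, h_c]
      linarith)
  have hsub'' : Set.uIcc q₀ q₁ ⊆ Set.uIcc v₀ u₁ := Set.uIcc_subset_uIcc hq₀ hq₁
  refine ⟨q₀, hsub (hsub' hq₀), q₁, hsub (hsub' hq₁), ?_, ?_, fun r hrq => ⟨?_, ?_⟩⟩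
  · simp [hhalf _ hq₀, hq₀a]
  · simp [hhalf _ hq₁, hq₁c]
  · simp only [hhalf _ (hsub'' hrq), Prod.fst_sub, sub_zero]
    have := hymem r (hsub'' hrq) (n + 1)
    exact ⟨J.a_le_s_d.trans (J.s_d_lt.le.trans this.1), this.2.trans (J.s_e_lt.le.trans J.e_le_c)⟩
  · simp only [hhalf _ (hsub'' hrq), Prod.snd_sub, Set.mem_Icc, Nat.cast_one]
    have := hq r hrq
    constructor <;> linarith [this.1, this.2]

theorem Runs.mono_left {n p : ℕ} {b₁ b₂ b' : ℝ} {J : Junction ρ} (h : J.Runs n b₂ b' p)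
    (hb : b₁ ≤ b₂) : J.Runs n b₁ b' p := fun γ r₀ r₁ hγ hcross =>
  h γ r₀ r₁ hγ (hcross.mono hb)

/-- The number of steps needed to advance by `p`. -/
noncomputable def advanceTime (ρ : ℝ) (p : ℕ) : ℕ := ⌊(p : ℝ) / ρ⌋₊

theorem advanceTime_mul_le (hρ : 0 < ρ) (p : ℕ) : advanceTime ρ p * ρ ≤ p :=
  (le_div_iff₀ hρ).1 (Nat.floor_le (by positivity))

theorem lt_advanceTime_add_one_mul (hρ : 0 < ρ) (p : ℕ) : (p : ℝ) < (advanceTime ρ p + 1) * ρ :=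
  (div_lt_iff₀ hρ).1 (Nat.lt_floor_add_one _)

theorem advanceTime_mul_lt (hρ : 0 < ρ) (hirr : Irrational ρ) {p : ℕ} (hp : 1 ≤ p) :
    advanceTime ρ p * ρ < p := by
  refine (advanceTime_mul_le hρ p).lt_of_ne fun h => ?_
  have hne : advanceTime ρ p ≠ 0 := fun h₀ => by
    rw [h₀, Nat.cast_zero, zero_mul] at h
    norm_cast at h
    omega
  exact nat_mul_ne_int hne hirr p (by exact_mod_cast h)

theorem advanceTime_zero : advanceTime ρ 0 = 0 := by simp [advanceTime]

theorem realizes_normal {p q : ℕ} (hp : 1 ≤ p) (hq : 1 ≤ q) :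
    J.Realizes (advanceTime ρ p + advanceTime ρ q + 1) p q :=
  ((J.runs_normal (advanceTime_mul_lt J.pos J.irrational hp)
    (lt_advanceTime_add_one_mul J.pos p)).mono_left J.s_d_lt_c.le).realizes
  ((J.runs_normal (advanceTime_mul_lt J.pos J.irrational hq)
    (lt_advanceTime_add_one_mul J.pos q)).mono_left J.s_d_lt_c.le)

theorem realizes_slow (l : ℕ) :
    J.Realizes (l + advanceTime ρ 1 + advanceTime ρ 1 + 1) 1 1 := by
  have h₁ := advanceTime_mul_lt J.pos J.irrational le_rfl
  have h₂ := lt_advanceTime_add_one_mul J.pos 1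
  exact (J.runs_slow (by simpa using h₁) (by simpa using h₂) l).realizes (J.runs_normal h₁ h₂)


theorem ceil_advanceTime_mul (hρ : 0 < ρ) (hρ₁ : ρ < 1) (p : ℕ) :
    ⌈(advanceTime ρ p : ℝ) * ρ⌉ = p := by
  rw [Int.ceil_eq_iff]
  have h₁ := advanceTime_mul_le hρ p
  have h₂ := lt_advanceTime_add_one_mul hρ p
  push_cast
  constructor <;> linarith

theorem alphaSeq_advanceTime_lt (hρ : 0 < ρ) (hρ₁ : ρ < 1) (p : ℕ) :
    alphaSeq ρ (advanceTime ρ p) < ρ := by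
  have h₂ := lt_advanceTime_add_one_mul hρ p
  rw [alphaSeq, ceil_advanceTime_mul hρ hρ₁]
  push_cast
  linarith

theorem exists_eq_advanceTime (hρ : 0 < ρ) {m : ℕ} (hm : alphaSeq ρ m < ρ) :
    ∃ p : ℕ, m = advanceTime ρ p := by
  have h₀ : 0 ≤ ⌈(m : ℝ) * ρ⌉ := Int.ceil_nonneg (by positivity)
  obtain ⟨p, hp⟩ := Int.eq_ofNat_of_zero_le h₀
  have h₁ := Int.le_ceil ((m : ℝ) * ρ)
  rw [alphaSeq, hp] at hm
  rw [hp] at h₁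
  push_cast at hm h₁
  refine ⟨p, ((Nat.floor_eq_iff (by positivity)).2 ⟨?_, ?_⟩).symm⟩
  · rwa [le_div_iff₀ hρ]
  · rw [div_lt_iff₀ hρ]; linarith

/-- The vector `(p, q)` divided by the time needed to realize it. -/
theorem vecRho_advanceTime (hρ : 0 < ρ) (hρ₁ : ρ < 1) (p q : ℕ) :
    vecRho ρ (advanceTime ρ p) (advanceTime ρ q) =
      ((advanceTime ρ p : ℝ) + advanceTime ρ q + 1)⁻¹ • ((p : ℝ), (q : ℝ)) := by
  rw [vecRho, ceil_advanceTime_mul hρ hρ₁, ceil_advanceTime_mul hρ hρ₁, Prod.smul_mk]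
  simp [div_eq_inv_mul]

theorem tendsto_advanceTime_div (hρ : 0 < ρ) :
    Tendsto (fun p : ℕ => (advanceTime ρ p : ℝ) / p) atTop (𝓝 ρ⁻¹) := by
  have h := (tendsto_nat_floor_mul_div_atTop (R := ℝ) (inv_nonneg.2 hρ.le)).comp
    tendsto_natCast_atTop_atTop
  refine h.congr fun p => ?_
  simp only [Function.comp, advanceTime, div_eq_inv_mul]

/-- The average displacements of realized vectors. -/
def directions : Set (ℝ × ℝ) :=
  {v | ∃ n p q : ℕ, 1 ≤ n ∧ J.Realizes n p q ∧ v = (n : ℝ)⁻¹ • ((p : ℝ), (q : ℝ))}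

theorem convex_closure_directions : Convex ℝ (closure J.directions) := by
  intro x hx y hy a b ha hb hab
  rw [← closure_closure]
  refine map_mem_closure₂ (f := fun x y : ℝ × ℝ => a • x + b • y) (by fun_prop) hx hy ?_
  rintro _ ⟨n₁, p₁, q₁, hn₁, h₁, rfl⟩ _ ⟨n₂, p₂, q₂, hn₂, h₂, rfl⟩
  obtain rfl : b = 1 - a := by linarith
  have ht : Tendsto (fun N : ℕ => (⌊a * (N : ℝ)⌋₊ : ℝ) / N) atTop (𝓝 a) :=
    (tendsto_nat_floor_mul_div_atTop (R := ℝ) ha).comp tendsto_natCast_atTop_atTop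
  set x := (n₁ : ℝ)⁻¹ • ((p₁ : ℝ), (q₁ : ℝ)) with hx
  set y := (n₂ : ℝ)⁻¹ • ((p₂ : ℝ), (q₂ : ℝ)) with hy
  refine mem_closure_of_tendsto ((ht.smul_const x).add ((ht.const_sub 1).smul_const y)) ?_
  filter_upwards [eventually_ge_atTop 1] with N hN
  have hle : ⌊a * (N : ℝ)⌋₊ ≤ N := Nat.floor_le_of_le (by nlinarith [Nat.cast_nonneg (α := ℝ) N])
  set i := ⌊a * (N : ℝ)⌋₊
  obtain ⟨j, hj⟩ := Nat.exists_eq_add_of_le hle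
  have hr := (h₁.mul (i * n₂)).add (h₂.mul (j * n₁))
  refine ⟨_, _, _, ?_, hr, ?_⟩
  · have : i * n₂ * n₁ + j * n₁ * n₂ = N * (n₁ * n₂) := by rw [hj]; ring
    rw [this]
    exact Nat.mul_pos hN (Nat.mul_pos hn₁ hn₂)
  · have e₁ : (n₁ : ℝ) ≠ 0 := by positivity
    have e₂ : (n₂ : ℝ) ≠ 0 := by positivity
    have e₃ : (N : ℝ) ≠ 0 := by positivity
    have hsum : ((i * n₂ * n₁ + j * n₁ * n₂ : ℕ) : ℝ) = N * (n₁ * n₂) := by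
      rw [hj]; push_cast; ring
    have hjN : (j : ℝ) = N - i := by rw [hj]; push_cast; ring
    rw [hsum]
    ext <;> simp [hx, hy, hjN] <;> field_simp

theorem smul_mem_directions {p q : ℕ} (hp : 1 ≤ p) (hq : 1 ≤ q) :
    ((advanceTime ρ p : ℝ) + advanceTime ρ q + 1)⁻¹ • ((p : ℝ), (q : ℝ)) ∈ J.directions :=
  ⟨_, p, q, by omega, J.realizes_normal hp hq, by push_cast; rfl⟩

theorem zero_mem_closure_directions : (0 : ℝ × ℝ) ∈ closure J.directions := by
  have h : Tendsto (fun l : ℕ => ((l + (advanceTime ρ 1 + advanceTime ρ 1 + 1) : ℕ) : ℝ)⁻¹ •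
      ((1 : ℝ), (1 : ℝ))) atTop (𝓝 0) := by
    have := (tendsto_inv_atTop_zero (𝕜 := ℝ)).comp <| tendsto_natCast_atTop_atTop.comp
      (tendsto_add_atTop_nat (advanceTime ρ 1 + advanceTime ρ 1 + 1))
    simpa using this.smul_const ((1 : ℝ), (1 : ℝ))
  refine mem_closure_of_tendsto h (Eventually.of_forall fun l => ?_)
  exact ⟨_, 1, 1, by omega, J.realizes_slow l, by push_cast; congr 2; ring⟩

theorem tendsto_inv_smul_axis (hρ : 0 < ρ) :
    Tendsto (fun p : ℕ => ((advanceTime ρ p : ℝ) + advanceTime ρ 1 + 1)⁻¹ * p) atTop (𝓝 ρ) ∧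
    Tendsto (fun p : ℕ => ((advanceTime ρ p : ℝ) + advanceTime ρ 1 + 1)⁻¹) atTop (𝓝 0) := by
  have h₀ : Tendsto (fun p : ℕ => (p : ℝ)⁻¹) atTop (𝓝 0) :=
    (tendsto_inv_atTop_zero (𝕜 := ℝ)).comp tendsto_natCast_atTop_atTop
  have h₁ : Tendsto (fun p : ℕ => ((advanceTime ρ p : ℝ) + advanceTime ρ 1 + 1)⁻¹ * p) atTop
      (𝓝 ρ) := by
    have := ((tendsto_advanceTime_div hρ).add (h₀.const_mul ((advanceTime ρ 1 : ℝ) + 1))).inv₀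
      (by simpa using hρ.ne')
    rw [mul_zero, add_zero, inv_inv] at this
    refine this.congr' ?_
    filter_upwards [eventually_ge_atTop 1] with p hp
    have : (p : ℝ) ≠ 0 := by positivity
    have : (advanceTime ρ p : ℝ) + advanceTime ρ 1 + 1 ≠ 0 := by positivity
    have h₂ : (advanceTime ρ p : ℝ) / p + ((advanceTime ρ 1 : ℝ) + 1) * (p : ℝ)⁻¹ =
      ((advanceTime ρ p : ℝ) + advanceTime ρ 1 + 1) / p := by ring
    rw [h₂, inv_div, div_eq_inv_mul]
  refine ⟨h₁, ?_⟩
  have := h₁.mul h₀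
  rw [mul_zero] at this
  refine this.congr' ?_
  filter_upwards [eventually_ge_atTop 1] with p hp
  have : (p : ℝ) ≠ 0 := by positivity
  rw [mul_assoc, mul_inv_cancel₀ this, mul_one]

theorem axis_fst_mem_closure_directions : ((ρ, 0) : ℝ × ℝ) ∈ closure J.directions := by
  obtain ⟨h₁, h₂⟩ := tendsto_inv_smul_axis J.pos
  refine mem_closure_of_tendsto (h₁.prodMk_nhds h₂) ?_
  filter_upwards [eventually_ge_atTop 1] with p hp
  simpa using J.smul_mem_directions hp le_rfl

theorem axis_snd_mem_closure_directions : ((0, ρ) : ℝ × ℝ) ∈ closure J.directions := by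
  obtain ⟨h₁, h₂⟩ := tendsto_inv_smul_axis J.pos
  refine mem_closure_of_tendsto (h₂.prodMk_nhds h₁) ?_
  filter_upwards [eventually_ge_atTop 1] with p hp
  simpa [add_comm (advanceTime ρ 1 : ℝ)] using J.smul_mem_directions le_rfl hp

theorem smul_mem_closure_directions (p q : ℕ) :
    ((advanceTime ρ p : ℝ) + advanceTime ρ q + 1)⁻¹ • ((p : ℝ), (q : ℝ)) ∈
      closure J.directions := by
  have hscale : ∀ p : ℕ, ((advanceTime ρ p : ℝ) + 1)⁻¹ * (p * ρ⁻¹) ∈ Set.Icc (0 : ℝ) 1 :=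
    fun p => by
      have hρ := J.pos
      refine ⟨by positivity, ?_⟩
      rw [inv_mul_le_iff₀ (by positivity), mul_one, ← div_eq_mul_inv]
      exact (Nat.lt_floor_add_one _).le
  rcases p.eq_zero_or_pos with rfl | hp
  · have := J.convex_closure_directions.smul_mem_of_zero_mem J.zero_mem_closure_directions
      J.axis_snd_mem_closure_directions (hscale q)
    simpa [advanceTime_zero, mul_assoc, J.pos.ne'] using this
  rcases q.eq_zero_or_pos with rfl | hq
  · have := J.convex_closure_directions.smul_mem_of_zero_mem J.zero_mem_closure_directions
      J.axis_fst_mem_closure_directions (hscale p)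
    simpa [advanceTime_zero, mul_assoc, J.pos.ne'] using this
  · exact subset_closure (J.smul_mem_directions hp hq)

theorem OmegaSet_subset_closure_directions : OmegaSet ρ ⊆ closure J.directions := by
  refine closure_minimal (convexHull_min ?_ J.convex_closure_directions) isClosed_closure
  rintro _ ⟨m, n, hm, hn, rfl⟩
  obtain ⟨p, rfl⟩ := exists_eq_advanceTime J.pos hm
  obtain ⟨q, rfl⟩ := exists_eq_advanceTime J.pos hn
  rw [vecRho_advanceTime J.pos J.lt_one]
  exact J.smul_mem_closure_directions p q

theorem closure_directions_subset_rotSetOn :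
    closure J.directions ⊆ rotSetOn J.step Set.univ := by
  refine closure_minimal ?_ (isClosed_iInter fun _ => isClosed_closure)
  rintro _ ⟨n, p, q, hn, h, rfl⟩
  refine Set.mem_iInter.2 fun m => Metric.mem_closure_iff.2 fun ε hε => ?_
  obtain ⟨k, hk⟩ := exists_nat_gt (max (m : ℝ) ε⁻¹)
  obtain ⟨hkm, hkε⟩ := max_lt_iff.1 hk
  obtain ⟨z, hz⟩ := (h.mul k).exists_point
  have hkn : k ≤ k * n := Nat.le_mul_of_pos_right k hn
  have hkpos : (0 : ℝ) < k := (inv_pos.2 hε).trans hkε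
  have hkn' : (k : ℝ) ≤ (k * n : ℕ) := by exact_mod_cast hkn
  have hpos : (0 : ℝ) < (k * n : ℕ) := hkpos.trans_le hkn'
  refine ⟨_, Set.mem_iUnion₂.2 ⟨k * n, ?_, z, Set.mem_univ z, rfl⟩, ?_⟩
  · exact (show m < k by exact_mod_cast hkm).trans_le hkn
  · have hrw : (n : ℝ)⁻¹ • ((p : ℝ), (q : ℝ)) =
        ((k * n : ℕ) : ℝ)⁻¹ • (((k * p : ℕ) : ℝ), ((k * q : ℕ) : ℝ)) := by
      have : (n : ℝ) ≠ 0 := by positivity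
      ext <;> simp <;> field_simp
    rw [dist_comm, dist_eq_norm, hrw, ← smul_sub, norm_smul, norm_inv,
      Real.norm_of_nonneg hpos.le]
    calc ((k * n : ℕ) : ℝ)⁻¹ * _ ≤ ((k * n : ℕ) : ℝ)⁻¹ * 1 := by gcongr
      _ ≤ (k : ℝ)⁻¹ := by rw [mul_one]; gcongr
      _ < ε := inv_lt_of_inv_lt₀ hε hkε

end Junction

theorem convex_OmegaSet (ρ : ℝ) : Convex ℝ (OmegaSet ρ) := (convex_convexHull ℝ _).closure

/-- The vector `(p, q)` is `n` times an element of `OmegaSet ρ`. -/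
def IsMultiple (ρ : ℝ) (n p q : ℕ) : Prop :=
  ∃ ω ∈ OmegaSet ρ, ((p : ℝ), (q : ℝ)) = (n : ℝ) • ω

/-- A pair of sequences advancing by at most `ρ` in each step, such that each of them may advance
only when the other one is an integer. -/
structure AlternatingAdvance (ρ : ℝ) (X Y : ℕ → ℝ) : Prop where
  le_fst : ∀ t, X t ≤ X (t + 1)
  fst_le : ∀ t, X (t + 1) ≤ X t + ρ
  le_snd : ∀ t, Y t ≤ Y (t + 1)
  snd_le : ∀ t, Y (t + 1) ≤ Y t + ρ
  fst_eq_or : ∀ t, X (t + 1) = X t ∨ ∃ k : ℤ, Y t = k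
  snd_eq_or : ∀ t, Y (t + 1) = Y t ∨ ∃ k : ℤ, X (t + 1) = k

namespace Junction

variable {ρ : ℝ}

theorem isMultiple_advanceTime (hρ : 0 < ρ) (hρ₁ : ρ < 1) (p q : ℕ) :
    IsMultiple ρ (advanceTime ρ p + advanceTime ρ q + 1) p q := by
  refine ⟨_, subset_closure (subset_convexHull ℝ _ ⟨advanceTime ρ p, advanceTime ρ q,
    alphaSeq_advanceTime_lt hρ hρ₁ p, alphaSeq_advanceTime_lt hρ hρ₁ q, rfl⟩), ?_⟩
  rw [vecRho_advanceTime hρ hρ₁, smul_smul]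
  push_cast
  rw [mul_inv_cancel₀ (by positivity), one_smul]

theorem zero_mem_OmegaSet (hρ : 0 < ρ) (hρ₁ : ρ < 1) : (0 : ℝ × ℝ) ∈ OmegaSet ρ := by
  obtain ⟨ω, hω, h⟩ := isMultiple_advanceTime hρ hρ₁ 0 0
  rw [Nat.cast_zero, ← Prod.zero_eq_mk, eq_comm, smul_eq_zero] at h
  rwa [← h.resolve_left (by positivity)]

open scoped Pointwise in
theorem _root_.IsMultiple.add {m n p q p' q' : ℕ} (h : IsMultiple ρ m p q)
    (h' : IsMultiple ρ n p' q') : IsMultiple ρ (m + n) (p + p') (q + q') := by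
  obtain ⟨ω, hω, h⟩ := h
  obtain ⟨ω', hω', h'⟩ := h'
  have hmem : (m : ℝ) • ω + (n : ℝ) • ω' ∈ ((m : ℝ) + n) • OmegaSet ρ := by
    rw [(convex_OmegaSet ρ).add_smul (Nat.cast_nonneg m) (Nat.cast_nonneg n)]
    exact Set.add_mem_add (Set.smul_mem_smul_set hω) (Set.smul_mem_smul_set hω')
  obtain ⟨υ, hυ, hsum⟩ := hmem
  refine ⟨υ, hυ, ?_⟩
  push_cast
  rw [show ((m : ℝ) + n) • υ = _ from hsum, ← h, ← h']
  simp

theorem _root_.IsMultiple.mono (hρ : 0 < ρ) (hρ₁ : ρ < 1) {m n p q : ℕ} (h : IsMultiple ρ m p q)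
    (hmn : m ≤ n) : IsMultiple ρ n p q := by
  have := h.add (⟨0, zero_mem_OmegaSet hρ hρ₁, by simp⟩ : IsMultiple ρ (n - m) 0 0)
  rwa [Nat.add_sub_cancel' hmn] at this

theorem advanceTime_add_one_le (hρ : 0 < ρ) (hirr : Irrational ρ) {p k : ℕ} (hk : 1 ≤ k)
    (hp : (p : ℝ) ≤ k * ρ) : advanceTime ρ p + 1 ≤ k := by
  rcases p.eq_zero_or_pos with rfl | h
  · simpa [advanceTime_zero] using hk
  · have := (advanceTime_mul_lt hρ hirr h).trans_le hp
    exact_mod_cast lt_of_mul_lt_mul_right this hρ.le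

/-- The first coordinate is in the middle of an advance of at most `k` steps, after an initial
part that realizes a multiple of an element of `OmegaSet ρ`. -/
def FstPhase (ρ : ℝ) (t : ℕ) (x y : ℝ) : Prop :=
  ∃ n p q k : ℕ, IsMultiple ρ n p q ∧ n + k ≤ t ∧ y = q ∧ p ≤ x ∧ x ≤ p + k * ρ

/-- The first coordinate has completed an advance by `i`, and the second one is in the middle of
an advance of at most `l` steps. -/
def SndPhase (ρ : ℝ) (t : ℕ) (x y : ℝ) : Prop :=
  ∃ n p q i l : ℕ, IsMultiple ρ n p q ∧ 1 ≤ l ∧ n + advanceTime ρ i + l ≤ t ∧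
    x = p + i ∧ q ≤ y ∧ y ≤ q + l * ρ

theorem exists_nat_eq_add {p : ℕ} {x : ℝ} (hx : p ≤ x) (hint : ∃ k : ℤ, x = k) :
    ∃ i : ℕ, x = p + i := by
  obtain ⟨k, rfl⟩ := hint
  have : (p : ℤ) ≤ k := by exact_mod_cast hx
  obtain ⟨i, rfl⟩ := Int.le.dest this
  exact ⟨i, by push_cast; rfl⟩

theorem FstPhase.step (hρ : 0 < ρ) (hirr : Irrational ρ) {t : ℕ} {x y x' y' : ℝ}
    (h : FstPhase ρ t x y) (hx : x ≤ x') (hx' : x' ≤ x + ρ) (hy : y ≤ y') (hy' : y' ≤ y + ρ)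
    (hor : y' = y ∨ ∃ k : ℤ, x' = k) : FstPhase ρ (t + 1) x' y' ∨ SndPhase ρ (t + 1) x' y' := by
  obtain ⟨n, p, q, k, hn, hnk, rfl, hpx, hxk⟩ := h
  have hxk' : x' ≤ p + (k + 1 : ℕ) * ρ := by push_cast; linarith
  rcases hor with rfl | hint
  · exact .inl ⟨n, p, q, k + 1, hn, by omega, rfl, hpx.trans hx, hxk'⟩
  · obtain ⟨i, rfl⟩ := exists_nat_eq_add (hpx.trans hx) hint
    have := advanceTime_add_one_le hρ hirr (k := k + 1) (by omega) (by linarith : (i : ℝ) ≤ _)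
    exact .inr ⟨n, p, q, i, 1, hn, le_rfl, by omega, rfl, hy, by simpa using hy'⟩

theorem SndPhase.step (hρ : 0 < ρ) (hρ₁ : ρ < 1) (hirr : Irrational ρ) {t : ℕ} {x y x' y' : ℝ}
    (h : SndPhase ρ t x y) (hx : x ≤ x') (hx' : x' ≤ x + ρ) (hy : y ≤ y') (hy' : y' ≤ y + ρ)
    (hor : x' = x ∨ ∃ k : ℤ, y = k) (hor' : y' = y ∨ ∃ k : ℤ, x' = k) :
    FstPhase ρ (t + 1) x' y' ∨ SndPhase ρ (t + 1) x' y' := by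
  obtain ⟨n, p, q, i, l, hn, hl, hnl, rfl, hqy, hyl⟩ := h
  rcases hor with rfl | hint
  · exact .inr ⟨n, p, q, i, l + 1, hn, by omega, by omega, rfl, hqy.trans hy, by
      push_cast; linarith⟩
  · obtain ⟨j, rfl⟩ := exists_nat_eq_add hqy hint
    have := advanceTime_add_one_le hρ hirr hl (by linarith : (j : ℝ) ≤ _)
    refine FstPhase.step hρ hirr ⟨_, _, _, 0, hn.add (isMultiple_advanceTime hρ hρ₁ i j),
      by omega, ?_, ?_, ?_⟩ hx hx' hy hy' hor' <;> push_cast <;> linarith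

theorem FstPhase.exists_isMultiple (hρ : 0 < ρ) (hρ₁ : ρ < 1) (hirr : Irrational ρ) {t : ℕ}
    {x y : ℝ} (h : FstPhase ρ t x y) :
    ∃ p q : ℕ, IsMultiple ρ t p q ∧ |x - p| ≤ 1 ∧ |y - q| ≤ 1 := by
  obtain ⟨n, p, q, k, hn, hnk, rfl, hpx, hxk⟩ := h
  rcases k.eq_zero_or_pos with rfl | hk
  · refine ⟨p, q, hn.mono hρ hρ₁ (by omega), ?_, by simp⟩
    rw [Nat.cast_zero, zero_mul, add_zero] at hxk
    simp [hxk.antisymm hpx]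
  · have h₁ := Nat.floor_le (sub_nonneg.2 hpx)
    have h₂ := Nat.lt_floor_add_one (x - p)
    have := advanceTime_add_one_le hρ hirr hk (by linarith : (⌊x - p⌋₊ : ℝ) ≤ _)
    refine ⟨p + ⌊x - p⌋₊, q, ?_, ?_, by simp⟩
    · refine (hn.add (isMultiple_advanceTime hρ hρ₁ ⌊x - p⌋₊ 0)).mono hρ hρ₁ ?_
      rw [advanceTime_zero]; omega
    · push_cast; rw [abs_le]; constructor <;> linarith

theorem SndPhase.exists_isMultiple (hρ : 0 < ρ) (hρ₁ : ρ < 1) (hirr : Irrational ρ) {t : ℕ}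
    {x y : ℝ} (h : SndPhase ρ t x y) :
    ∃ p q : ℕ, IsMultiple ρ t p q ∧ |x - p| ≤ 1 ∧ |y - q| ≤ 1 := by
  obtain ⟨n, p, q, i, l, hn, hl, hnl, rfl, hqy, hyl⟩ := h
  have h₁ := Nat.floor_le (sub_nonneg.2 hqy)
  have h₂ := Nat.lt_floor_add_one (y - q)
  have := advanceTime_add_one_le hρ hirr hl (by linarith : (⌊y - q⌋₊ : ℝ) ≤ _)
  refine ⟨p + i, q + ⌊y - q⌋₊, ?_, by simp, ?_⟩
  · exact (hn.add (isMultiple_advanceTime hρ hρ₁ i ⌊y - q⌋₊)).mono hρ hρ₁ (by omega)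
  · push_cast; rw [abs_le]; constructor <;> linarith

/-- Alternating sequences that start at the origin follow a multiple of an element of
`OmegaSet ρ`. -/
theorem exists_isMultiple_of_start (hρ : 0 < ρ) (hρ₁ : ρ < 1) (hirr : Irrational ρ) {X Y : ℕ → ℝ}
    (h : AlternatingAdvance ρ X Y) (hX : X 0 = 0) (hY : Y 0 = 0) (t : ℕ) :
    ∃ p q : ℕ, IsMultiple ρ t p q ∧ |X t - p| ≤ 1 ∧ |Y t - q| ≤ 1 := by
  have hphase : FstPhase ρ t (X t) (Y t) ∨ SndPhase ρ t (X t) (Y t) := by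
    induction t with
    | zero =>
      exact .inl ⟨0, 0, 0, 0, ⟨0, zero_mem_OmegaSet hρ hρ₁, by simp⟩, by simp, by simp [hY],
        by simp [hX], by simp [hX]⟩
    | succ t ih =>
      rcases ih with ih | ih
      · exact ih.step hρ hirr (h.le_fst t) (h.fst_le t) (h.le_snd t) (h.snd_le t) (h.snd_eq_or t)
      · exact ih.step hρ hρ₁ hirr (h.le_fst t) (h.fst_le t) (h.le_snd t) (h.snd_le t)
          (h.fst_eq_or t) (h.snd_eq_or t)
  rcases hphase with hphase | hphase
  · exact hphase.exists_isMultiple hρ hρ₁ hirr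
  · exact hphase.exists_isMultiple hρ hρ₁ hirr

/-- Cutting off the initial non-integer parts of alternating sequences. -/
theorem _root_.AlternatingAdvance.truncate (hρ : 0 < ρ) {X Y : ℕ → ℝ}
    (h : AlternatingAdvance ρ X Y) (k l : ℤ) :
    AlternatingAdvance ρ (fun t => max (X t) k - k) (fun t => max (Y t) l - l) where
  le_fst t := sub_le_sub_right (max_le_max_right _ (h.le_fst t)) _
  fst_le t := by
    have : max (X (t + 1)) k ≤ max (X t) k + ρ :=
      max_le ((h.fst_le t).trans (by linarith [le_max_left (X t) k]))
        (by linarith [le_max_right (X t) (k : ℝ)])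
    linarith
  le_snd t := sub_le_sub_right (max_le_max_right _ (h.le_snd t)) _
  snd_le t := by
    have : max (Y (t + 1)) l ≤ max (Y t) l + ρ :=
      max_le ((h.snd_le t).trans (by linarith [le_max_left (Y t) l]))
        (by linarith [le_max_right (Y t) (l : ℝ)])
    linarith
  fst_eq_or t := by
    refine (h.fst_eq_or t).imp (fun h => by rw [h]) fun ⟨j, hj⟩ => ⟨max j l - l, ?_⟩
    rw [hj]; push_cast; rfl
  snd_eq_or t := by
    refine (h.snd_eq_or t).imp (fun h => by rw [h]) fun ⟨j, hj⟩ => ⟨max j k - k, ?_⟩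
    rw [hj]; push_cast; rfl

variable (J : Junction ρ)

theorem alternatingAdvance (z : ℝ × ℝ) :
    AlternatingAdvance ρ (fun t => J.h (J.step^[t] z).1) (fun t => J.h (J.step^[t] z).2) := by
  have hslide : ∀ u x, J.h x ≤ J.h (J.slide (J.χ u) x) ∧ J.h (J.slide (J.χ u) x) ≤ J.h x + ρ :=
    fun u x => ⟨J.monotone_h (J.le_slide (J.χ_nonneg u) x),
      J.h_F x ▸ J.monotone_h (J.slide_le (J.χ_le_one u) x)⟩
  have hrest : ∀ u x, J.h (J.slide (J.χ u) x) = J.h x ∨ ∃ k : ℤ, J.h u = k := fun u x => by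
    rcases J.exists_h_eq_or u with hu | ⟨hu, -⟩
    · exact .inr hu
    · rw [hu, slide_zero]; exact .inl rfl
  have hfst : ∀ t, J.h (J.step^[t + 1] z).1 =
      J.h (J.slide (J.χ (J.step^[t] z).2) (J.step^[t] z).1) := fun t => by
    rw [Function.iterate_succ_apply']; exact J.h_s _
  have hsnd : ∀ t, ∃ u, J.h u = J.h (J.step^[t + 1] z).1 ∧ J.h (J.step^[t + 1] z).2 =
      J.h (J.slide (J.χ u) (J.s (J.step^[t] z).2)) := fun t => by
    refine ⟨_, (hfst t).symm, ?_⟩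
    rw [Function.iterate_succ_apply']; rfl
  refine ⟨fun t => ?_, fun t => ?_, fun t => ?_, fun t => ?_, fun t => ?_, fun t => ?_⟩
  · simp only [hfst t]; exact (hslide _ _).1
  · simp only [hfst t]; exact (hslide _ _).2
  · obtain ⟨u, -, hu⟩ := hsnd t
    simp only [hu, ← J.h_s (J.step^[t] z).2]; exact (hslide _ _).1
  · obtain ⟨u, -, hu⟩ := hsnd t
    simp only [hu, ← J.h_s (J.step^[t] z).2]; exact (hslide _ _).2
  · simp only [hfst t]; exact hrest _ _
  · obtain ⟨u, hu', hu⟩ := hsnd t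
    simp only [hu, ← hu', ← J.h_s (J.step^[t] z).2]; exact hrest _ _

theorem abs_sub_sub_truncate_le {x₀ x : ℝ} (h : x₀ ≤ x) :
    |x - x₀ - (max x ⌈x₀⌉ - ⌈x₀⌉)| ≤ 1 := by
  have h₁ := Int.le_ceil x₀
  have h₂ := Int.ceil_lt_add_one x₀
  rcases max_cases x (⌈x₀⌉ : ℝ) with ⟨h, h'⟩ | ⟨h, h'⟩ <;> rw [h, abs_le] <;>
    constructor <;> linarith

/-- Every orbit follows a multiple of an element of `OmegaSet ρ` up to a bounded error. -/
theorem exists_norm_step_iterate_sub_le (n : ℕ) (z : ℝ × ℝ) :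
    ∃ ω ∈ OmegaSet ρ, ‖J.step^[n] z - z - (n : ℝ) • ω‖ ≤ 4 := by
  have halt := J.alternatingAdvance z
  obtain ⟨p, q, ⟨ω, hω, hpq⟩, hp, hq⟩ := exists_isMultiple_of_start J.pos J.lt_one J.irrational
    (halt.truncate J.pos ⌈J.h z.1⌉ ⌈J.h z.2⌉)
    (by simp [Int.le_ceil]) (by simp [Int.le_ceil]) n
  refine ⟨ω, hω, ?_⟩
  rw [← hpq]
  have hX := abs_sub_sub_truncate_le ((monotone_nat_of_le_succ halt.le_fst) (Nat.zero_le n))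
  have hY := abs_sub_sub_truncate_le ((monotone_nat_of_le_succ halt.le_snd) (Nat.zero_le n))
  simp only [Function.iterate_zero, id] at hX hY
  have a₁ := J.abs_h_sub_le z.1
  have a₂ := J.abs_h_sub_le z.2
  have a₃ := J.abs_h_sub_le (J.step^[n] z).1
  have a₄ := J.abs_h_sub_le (J.step^[n] z).2
  rw [abs_le] at hp hq hX hY a₁ a₂ a₃ a₄
  refine max_le ?_ ?_ <;> simp only [Prod.fst_sub, Prod.snd_sub, Real.norm_eq_abs, abs_le] <;>
    constructor <;> linarith [hp.1, hp.2, hq.1, hq.2]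

theorem rotSetOn_subset_OmegaSet : rotSetOn J.step Set.univ ⊆ OmegaSet ρ := by
  intro w hw
  rw [← (show IsClosed (OmegaSet ρ) from isClosed_closure).closure_eq]
  refine Metric.mem_closure_iff.2 fun ε hε => ?_
  obtain ⟨m, hm⟩ := exists_nat_gt (8 / ε)
  obtain ⟨v, hv, hwv⟩ := Metric.mem_closure_iff.1 (Set.mem_iInter.1 hw m) (ε / 2) (half_pos hε)
  obtain ⟨n, hn, z, -, rfl⟩ := Set.mem_iUnion₂.1 hv
  obtain ⟨ω, hω, hle⟩ := J.exists_norm_step_iterate_sub_le n z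
  have hmn : (m : ℝ) < n := by exact_mod_cast hn
  have hpos : (0 : ℝ) < n := (div_pos (by norm_num) hε).trans (hm.trans hmn)
  refine ⟨ω, hω, (dist_triangle w ((n : ℝ)⁻¹ • (J.step^[n] z - z)) ω).trans_lt ?_⟩
  have hdist : dist ((n : ℝ)⁻¹ • (J.step^[n] z - z)) ω < ε / 2 := by
    have hrw : (n : ℝ)⁻¹ • (J.step^[n] z - z) - ω =
        (n : ℝ)⁻¹ • (J.step^[n] z - z - (n : ℝ) • ω) := by
      rw [smul_sub _ (J.step^[n] z - z), inv_smul_smul₀ hpos.ne']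
    rw [dist_eq_norm, hrw, norm_smul, norm_inv, Real.norm_of_nonneg hpos.le,
      inv_mul_lt_iff₀ hpos]
    have := (div_lt_iff₀ hε).1 (hm.trans hmn)
    linarith
  linarith

theorem rotSetOn_step : rotSetOn J.step Set.univ = OmegaSet ρ :=
  (J.rotSetOn_subset_OmegaSet).antisymm
    (J.OmegaSet_subset_closure_directions.trans J.closure_directions_subset_rotSetOn)

end Junction

theorem stmt15 (ρ : ℝ) (hirr : Irrational ρ) (h0 : 0 < ρ) (h1 : ρ < 1) :
    ∃ (U : Set (ℝ × ℝ)) (G : ℝ × ℝ → ℝ × ℝ),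
      IsOpen U ∧ skel ⊆ U ∧
      (∀ v : ℤ × ℤ, (fun x : ℝ × ℝ => x + ((v.1 : ℝ), (v.2 : ℝ))) '' U = U) ∧
      (∃ V : Set (ℝ × ℝ), IsOpen V ∧ closure U ⊆ V ∧ ContDiffOn ℝ 1 G V) ∧
      Set.InjOn G (closure U) ∧
      (∀ x ∈ closure U, ∃ L : (ℝ × ℝ) ≃L[ℝ] (ℝ × ℝ),
        HasFDerivAt G (L : (ℝ × ℝ) →L[ℝ] (ℝ × ℝ)) x) ∧
      Set.MapsTo G (closure U) U ∧
      (∀ (x : ℝ × ℝ) (v : ℤ × ℤ),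
        G (x + ((v.1 : ℝ), (v.2 : ℝ))) = G x + ((v.1 : ℝ), (v.2 : ℝ))) ∧
      rotSetOn G (closure U) = OmegaSet ρ := by
  obtain ⟨J⟩ := nonempty_junction hirr h0 h1
  refine ⟨Set.univ, J.step, isOpen_univ, Set.subset_univ _, fun v => ?_,
    ⟨Set.univ, isOpen_univ, Set.subset_univ _, J.contDiff_step.contDiffOn⟩,
    J.step_injective.injOn, fun x _ => J.exists_hasFDerivAt_step x, Set.mapsTo_univ _ _,
    fun x v => J.step_add_int x v.1 v.2, ?_⟩
  · rw [Set.image_univ]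
    exact (add_right_surjective _).range_eq
  · rw [closure_univ]
    exact J.rotSetOn_step
end

section
/- Let F : T² → T² be a continuous map of the torus T² = ℝ²/ℤ² homotopic to the identity, let F̃ : ℝ² → ℝ² be a lift of F (a continuous map with π ∘ F̃ = F ∘ π satisfying F̃(x+v) = F̃(x)+v for all v ∈ ℤ²), and let φ : T² → ℝ² be the displacement function, defined by φ(π(x)) = F̃(x) − x. Then the convex hull of the rotation set ρ(F̃) equals the set { ∫_{T²} φ dμ : μ an F-invariant Borel probability measure on T² }. -/
open Filter Topology MeasureTheory

/-- The two-dimensional torus `ℝ²/ℤ²`. -/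
abbrev Torus2 : Type := AddCircle (1 : ℝ) × AddCircle (1 : ℝ)

/-- The canonical projection `π : ℝ² → T²`. -/
noncomputable def torusProj (x : ℝ × ℝ) : Torus2 := ((x.1 : AddCircle (1 : ℝ)), (x.2 : AddCircle (1 : ℝ)))

/-- The Misiurewicz–Ziemian rotation set of a lift `F : ℝ² → ℝ²`. -/
def rotSet (F : ℝ × ℝ → ℝ × ℝ) : Set (ℝ × ℝ) :=
  ⋂ m : ℕ, closure (⋃ n ∈ Set.Ioi m,
    {w : ℝ × ℝ | ∃ x : ℝ × ℝ, w = ((n : ℝ))⁻¹ • (F^[n] x - x)})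

theorem IsCompact.convexHull_of_finiteDimensional {E : Type*} [NormedAddCommGroup E]
    [NormedSpace ℝ E] [FiniteDimensional ℝ E] {s : Set E} (hs : IsCompact s) :
    IsCompact (convexHull ℝ s) := by
  let comb (n : ℕ) (p : (Fin n → ℝ) × (Fin n → E)) : E := ∑ i, p.1 i • p.2 i
  have hunion : convexHull ℝ s = ⋃ n ∈ Set.Iic (Module.finrank ℝ E + 1),
      comb n '' (stdSimplex ℝ (Fin n) ×ˢ Set.univ.pi fun _ => s) := by
    ext x
    simp only [Set.mem_iUnion, Set.mem_image, Set.mem_prod, exists_prop, Set.mem_Iic]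
    constructor
    · intro hx
      obtain ⟨ι, _, z, w, hz, hind, hw, hsum, rfl⟩ := eq_pos_convex_span_of_mem_convexHull hx
      let e := (Fintype.equivFin ι).symm
      refine ⟨Fintype.card ι, ?_, (w ∘ e, z ∘ e), ⟨⟨fun i => (hw _).le, ?_⟩, ?_⟩, ?_⟩
      · exact hind.card_le_finrank_succ.trans (by gcongr; exact Submodule.finrank_le _)
      · rw [← hsum]
        exact e.sum_comp w
      · exact fun i _ => hz ⟨e i, rfl⟩
      · exact e.sum_comp fun i => w i • z i
    · rintro ⟨n, -, p, ⟨hw, hz⟩, rfl⟩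
      exact mem_convexHull_of_exists_fintype p.1 p.2 hw.1 hw.2 (fun i => hz i trivial) rfl
  rw [hunion]
  refine (Set.finite_Iic _).isCompact_biUnion fun n _ => IsCompact.image ?_ (by fun_prop)
  exact (isCompact_stdSimplex ℝ (Fin n)).prod (isCompact_univ_pi fun _ => hs)

section BirkhoffAverages

variable {X E : Type*} {F : X → X}

/-- The limit points of the Birkhoff averages of `φ` under `F`, as the length of the orbit
segments tends to infinity. -/
def birkhoffLimitSet [NormedAddCommGroup E] [NormedSpace ℝ E] (F : X → X) (φ : X → E) : Set E :=
  ⋂ m : ℕ, closure (⋃ n ∈ Set.Ioi m, Set.range (birkhoffAverage ℝ F φ n))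

theorem mem_birkhoffLimitSet_of_tendsto [NormedAddCommGroup E] [NormedSpace ℝ E] {φ : X → E}
    {l : Filter ℕ} [l.NeBot] {n : ℕ → ℕ} {x : ℕ → X} {w : E} (hn : Tendsto n l atTop)
    (h : Tendsto (fun m => birkhoffAverage ℝ F φ (n m) (x m)) l (𝓝 w)) :
    w ∈ birkhoffLimitSet F φ := by
  refine Set.mem_iInter.2 fun m => mem_closure_of_tendsto h ?_
  filter_upwards [hn.eventually_gt_atTop m] with k hk
  exact Set.mem_biUnion hk ⟨x k, rfl⟩

theorem exists_tendsto_of_mem_birkhoffLimitSet [NormedAddCommGroup E] [NormedSpace ℝ E]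
    {φ : X → E} {w : E} (hw : w ∈ birkhoffLimitSet F φ) :
    ∃ (n : ℕ → ℕ) (x : ℕ → X), (∀ m, m < n m) ∧
      Tendsto (fun m => birkhoffAverage ℝ F φ (n m) (x m)) atTop (𝓝 w) := by
  have key (m : ℕ) : ∃ n x, m < n ∧
      dist (birkhoffAverage ℝ F φ n x) w < 1 / ((m : ℝ) + 1) := by
    obtain ⟨y, hy, hyw⟩ := Metric.mem_closure_iff.1 (Set.mem_iInter.1 hw m) _
      (Nat.one_div_pos_of_nat (α := ℝ) (n := m))
    simp only [Set.mem_iUnion, exists_prop, Set.mem_Ioi] at hy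
    obtain ⟨n, hn, x, rfl⟩ := hy
    exact ⟨n, x, hn, by rwa [dist_comm]⟩
  choose n x hn hx using key
  refine ⟨n, x, hn, tendsto_iff_dist_tendsto_zero.2 ?_⟩
  exact squeeze_zero (fun _ => dist_nonneg) (fun m => (hx m).le)
    tendsto_one_div_add_atTop_nhds_zero_nat

theorem norm_birkhoffAverage_le [NormedAddCommGroup E] [NormedSpace ℝ E] {φ : X → E} {C : ℝ}
    (hC : ∀ x, ‖φ x‖ ≤ C) {n : ℕ} (hn : n ≠ 0) (x : X) : ‖birkhoffAverage ℝ F φ n x‖ ≤ C := by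
  have hsum : ‖birkhoffSum F φ n x‖ ≤ n * C := by
    simpa [birkhoffSum] using norm_sum_le_of_le (Finset.range n) fun k _ => hC (F^[k] x)
  rw [birkhoffAverage, norm_smul, norm_inv, Real.norm_natCast, inv_mul_le_iff₀ (by positivity)]
  exact hsum

theorem isCompact_birkhoffLimitSet [NormedAddCommGroup E] [NormedSpace ℝ E]
    [FiniteDimensional ℝ E] {φ : X → E} {C : ℝ} (hC : ∀ x, ‖φ x‖ ≤ C) :
    IsCompact (birkhoffLimitSet F φ) := by
  have := FiniteDimensional.proper_real E
  refine (isCompact_closedBall (0 : E) C).of_isClosed_subset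
    (isClosed_iInter fun _ => isClosed_closure) ?_
  refine (Set.iInter_subset _ 0).trans (closure_minimal ?_ Metric.isClosed_closedBall)
  refine Set.iUnion₂_subset fun n hn => ?_
  rintro _ ⟨x, rfl⟩
  exact mem_closedBall_zero_iff.2 (norm_birkhoffAverage_le hC (ne_of_gt hn) x)

section Empirical

variable [MeasurableSpace X]

/-- The uniform measure on the orbit segment `x, F x, …, F^[n-1] x`. -/
noncomputable def empiricalMeasure (F : X → X) (n : ℕ) (x : X) : Measure X :=
  (n : ENNReal)⁻¹ • ∑ k ∈ Finset.range n, Measure.dirac (F^[k] x)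

theorem isProbabilityMeasure_empiricalMeasure {n : ℕ} (hn : n ≠ 0) (x : X) :
    IsProbabilityMeasure (empiricalMeasure F n x) :=
  ⟨by simp [empiricalMeasure, ENNReal.inv_mul_cancel, hn]⟩

theorem integral_empiricalMeasure [NormedAddCommGroup E] [NormedSpace ℝ E] [CompleteSpace E]
    {g : X → E} (hg : StronglyMeasurable g) (n : ℕ) (x : X) :
    ∫ y, g y ∂empiricalMeasure F n x = birkhoffAverage ℝ F g n x := by
  rw [empiricalMeasure, integral_smul_measure, integral_finsetSum_measure]
  · simp [birkhoffAverage, birkhoffSum, integral_dirac' _ _ hg]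
  · exact fun k _ => integrable_dirac' hg (by simp)

end Empirical

section Invariant

variable [MeasurableSpace X] {μ : Measure X}

theorem integral_comp_iterate [NormedAddCommGroup E] [NormedSpace ℝ E]
    (hF : MeasurePreserving F μ μ) {g : X → E} (hg : AEStronglyMeasurable g μ) (k : ℕ) :
    ∫ x, g (F^[k] x) ∂μ = ∫ x, g x ∂μ := by
  have h := hF.iterate k
  rw [← h.map_eq] at hg
  rw [← integral_map h.measurable.aemeasurable hg, h.map_eq]

theorem integrable_birkhoffAverage [NormedAddCommGroup E] [NormedSpace ℝ E]
    (hF : MeasurePreserving F μ μ) {g : X → E} (hg : Integrable g μ) (n : ℕ) :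
    Integrable (birkhoffAverage ℝ F g n) μ :=
  (integrable_finsetSum _ fun k _ => (hF.iterate k).integrable_comp_of_integrable hg).smul _

theorem integral_birkhoffAverage [NormedAddCommGroup E] [NormedSpace ℝ E]
    (hF : MeasurePreserving F μ μ) {g : X → E} (hg : Integrable g μ) {n : ℕ} (hn : n ≠ 0) :
    ∫ x, birkhoffAverage ℝ F g n x ∂μ = ∫ x, g x ∂μ := by
  simp only [birkhoffAverage, birkhoffSum]
  rw [integral_smul, integral_finsetSum (f := fun k x => g (F^[k] x)) _ fun k _ =>
    (hF.iterate k).integrable_comp_of_integrable hg]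
  simp only [integral_comp_iterate hF hg.aestronglyMeasurable, Finset.sum_const,
    Finset.card_range, ← Nat.cast_smul_eq_nsmul ℝ]
  rw [inv_smul_smul₀ (by exact_mod_cast hn)]

/-- If `∫ φ` were outside the convex hull, some linear functional would separate it from the
limit set; but at some point the Birkhoff average of the functional is at least its integral. -/
theorem integral_mem_convexHull_birkhoffLimitSet [NormedAddCommGroup E] [NormedSpace ℝ E]
    [FiniteDimensional ℝ E] [IsProbabilityMeasure μ] (hF : MeasurePreserving F μ μ) {φ : X → E}
    {C : ℝ} (hC : ∀ x, ‖φ x‖ ≤ C) (hφ : Integrable φ μ) :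
    ∫ x, φ x ∂μ ∈ convexHull ℝ (birkhoffLimitSet F φ) := by
  have := FiniteDimensional.proper_real E
  have := FiniteDimensional.complete ℝ E
  by_contra hv
  obtain ⟨ℓ, u, hlt, hu⟩ := geometric_hahn_banach_closed_point (convex_convexHull ℝ _)
    (isCompact_birkhoffLimitSet hC).convexHull_of_finiteDimensional.isClosed hv
  have hex (m : ℕ) : ∃ x, ℓ (∫ y, φ y ∂μ) ≤ ℓ (birkhoffAverage ℝ F φ (m + 1) x) := by
    have hint := integrable_birkhoffAverage hF hφ (m + 1)
    obtain ⟨x, hx⟩ := exists_integral_le (ℓ.integrable_comp hint)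
    rw [ℓ.integral_comp_comm hint, integral_birkhoffAverage hF hφ m.succ_ne_zero] at hx
    exact ⟨x, hx⟩
  choose x hx using hex
  obtain ⟨w, -, σ, hσ, hw⟩ := (isCompact_closedBall (0 : E) C).tendsto_subseq fun m =>
    mem_closedBall_zero_iff.2 (norm_birkhoffAverage_le (F := F) hC m.succ_ne_zero (x m))
  have hmem : w ∈ birkhoffLimitSet F φ := mem_birkhoffLimitSet_of_tendsto
    (n := fun m => σ m + 1) (x := x ∘ σ)
    ((tendsto_add_atTop_nat 1).comp hσ.tendsto_atTop) hw
  have hle : ℓ (∫ y, φ y ∂μ) ≤ ℓ w :=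
    ge_of_tendsto' ((ℓ.continuous.tendsto w).comp hw) fun m => hx (σ m)
  linarith [hlt w (subset_convexHull ℝ _ hmem)]

theorem convex_setOf_integral_invariant [NormedAddCommGroup E] [NormedSpace ℝ E]
    (hF : Measurable F) {φ : X → E}
    (hφ : ∀ μ : Measure X, IsProbabilityMeasure μ → Integrable φ μ) :
    Convex ℝ {v : E | ∃ μ : Measure X, IsProbabilityMeasure μ ∧
      μ.map F = μ ∧ v = ∫ x, φ x ∂μ} := by
  rintro _ ⟨μ, hμ, hμF, rfl⟩ _ ⟨ν, hν, hνF, rfl⟩ a b ha hb hab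
  refine ⟨ENNReal.ofReal a • μ + ENNReal.ofReal b • ν, ⟨?_⟩, ?_, ?_⟩
  · simp [← ENNReal.ofReal_add ha hb, hab]
  · rw [Measure.map_add _ _ hF, Measure.map_smul, Measure.map_smul, hμF, hνF]
  · rw [integral_add_measure ((hφ μ hμ).smul_measure ENNReal.ofReal_ne_top)
      ((hφ ν hν).smul_measure ENNReal.ofReal_ne_top), integral_smul_measure,
      integral_smul_measure, ENNReal.toReal_ofReal ha, ENNReal.toReal_ofReal hb]

end Invariant

section Compact

variable [TopologicalSpace X] [CompactSpace X] [T2Space X] [HasOuterApproxClosed X]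
  [MeasurableSpace X] [BorelSpace X]

/-- Krylov–Bogolyubov: a weak limit of the empirical measures along the orbit segments
realising `w` is invariant and has `φ`-integral `w`. -/
theorem exists_invariant_integral_eq_of_mem_birkhoffLimitSet [NormedAddCommGroup E]
    [NormedSpace ℝ E] [CompleteSpace E] (hF : Continuous F)
    {φ : X → E} (hφ : Continuous φ) {w : E} (hw : w ∈ birkhoffLimitSet F φ) :
    ∃ μ : Measure X, IsProbabilityMeasure μ ∧ μ.map F = μ ∧ w = ∫ x, φ x ∂μ := by
  obtain ⟨n, x, hn, hlim⟩ := exists_tendsto_of_mem_birkhoffLimitSet hw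
  let μ (m : ℕ) : ProbabilityMeasure X := ⟨empiricalMeasure F (n m) (x m),
    isProbabilityMeasure_empiricalMeasure (Nat.ne_zero_of_lt (hn m)) _⟩
  let U : Ultrafilter ℕ := hyperfilter ℕ
  have hU : (U : Filter ℕ) ≤ atTop := Nat.hyperfilter_le_atTop
  let ν : ProbabilityMeasure X := (U.map μ).lim
  have hν : Tendsto μ U (𝓝 ν) := (U.map μ).le_nhds_lim
  have hnU : Tendsto n U atTop :=
    (tendsto_atTop_mono (fun m => (hn m).le) tendsto_id).mono_left hU
  have hconv (g : X → ℝ) (hg : Continuous g) :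
      Tendsto (fun m => birkhoffAverage ℝ F g (n m) (x m)) U (𝓝 (∫ y, g y ∂(ν : Measure X))) := by
    have h := ProbabilityMeasure.tendsto_iff_forall_integral_tendsto.1 hν
      (BoundedContinuousFunction.mkOfCompact ⟨g, hg⟩)
    simpa [μ, integral_empiricalMeasure hg.stronglyMeasurable] using h
  refine ⟨ν, inferInstance, ?_, ?_⟩
  · have := Measure.isProbabilityMeasure_map (μ := (ν : Measure X)) hF.measurable.aemeasurable
    refine ext_of_forall_integral_eq_of_IsFiniteMeasure fun g => ?_
    rw [integral_map hF.measurable.aemeasurable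
      g.continuous.stronglyMeasurable.aestronglyMeasurable]
    refine sub_eq_zero.1 (tendsto_nhds_unique ((hconv _ (g.continuous.comp hF)).sub
      (hconv _ g.continuous)) ?_)
    have hzero : Tendsto (fun k : ℕ => (k : ℝ)⁻¹ * (2 * ‖g‖)) atTop (𝓝 0) := by
      simpa using (tendsto_inv_atTop_nhds_zero_nat (𝕜 := ℝ)).mul_const (2 * ‖g‖)
    refine squeeze_zero_norm (fun m => ?_) (hzero.comp hnU)
    have hcomp : birkhoffAverage ℝ F (g ∘ F) (n m) (x m) =
        birkhoffAverage ℝ F g (n m) (F (x m)) := by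
      simp [birkhoffAverage, birkhoffSum, ← Function.iterate_succ_apply,
        Function.iterate_succ_apply']
    rw [hcomp, birkhoffAverage_apply_sub_birkhoffAverage, norm_smul, norm_inv, Real.norm_natCast]
    refine mul_le_mul_of_nonneg_left ?_ (by positivity)
    rw [← dist_eq_norm]
    exact g.dist_le_two_norm _ _
  · refine (SeparatingDual.eq_iff_forall_dual_eq (R := ℝ)).2 fun ℓ => ?_
    have hint : Integrable φ (ν : Measure X) := hφ.integrable_of_hasCompactSupport
      (HasCompactSupport.of_compactSpace φ)
    rw [← ℓ.integral_comp_comm hint]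
    refine tendsto_nhds_unique ?_ (hconv _ (ℓ.continuous.comp hφ))
    refine (((ℓ.continuous.tendsto w).comp hlim).mono_left hU).congr fun m => ?_
    exact map_birkhoffAverage ℝ ℝ ℓ F φ (n m) (x m)

theorem convexHull_birkhoffLimitSet_eq [NormedAddCommGroup E] [NormedSpace ℝ E]
    [FiniteDimensional ℝ E] (hF : Continuous F) {φ : X → E} (hφ : Continuous φ) :
    convexHull ℝ (birkhoffLimitSet F φ) =
      {v : E | ∃ μ : Measure X, IsProbabilityMeasure μ ∧ μ.map F = μ ∧ v = ∫ x, φ x ∂μ} := by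
  have := FiniteDimensional.complete ℝ E
  have hint (μ : Measure X) (_ : IsProbabilityMeasure μ) : Integrable φ μ :=
    hφ.integrable_of_hasCompactSupport (HasCompactSupport.of_compactSpace φ)
  refine (convexHull_min (fun w hw => ?_)
    (convex_setOf_integral_invariant hF.measurable hint)).antisymm ?_
  · exact exists_invariant_integral_eq_of_mem_birkhoffLimitSet hF hφ hw
  · rintro _ ⟨μ, hμ, hμF, rfl⟩
    obtain ⟨C, hC⟩ := isCompact_univ.exists_bound_of_continuousOn hφ.continuousOn
    exact integral_mem_convexHull_birkhoffLimitSet ⟨hF.measurable, hμF⟩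
      (fun x => hC x trivial) (hint μ hμ)

end Compact

end BirkhoffAverages

theorem torusProj_surjective : Function.Surjective torusProj := by
  rintro ⟨a, b⟩
  obtain ⟨s, rfl⟩ := QuotientAddGroup.mk_surjective a
  obtain ⟨t, rfl⟩ := QuotientAddGroup.mk_surjective b
  exact ⟨(s, t), rfl⟩

theorem birkhoffSum_torusProj {F : Torus2 → Torus2} {Ft : ℝ × ℝ → ℝ × ℝ} {φ : Torus2 → ℝ × ℝ}
    (hlift : Function.Semiconj torusProj Ft F) (hdisp : ∀ x, φ (torusProj x) = Ft x - x)
    (n : ℕ) (x : ℝ × ℝ) : birkhoffSum F φ n (torusProj x) = Ft^[n] x - x := by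
  simp only [birkhoffSum, ← (hlift.iterate_right _).eq, hdisp, ← Function.iterate_succ_apply']
  exact Finset.sum_range_sub (fun k => Ft^[k] x) n

theorem rotSet_eq_birkhoffLimitSet {F : Torus2 → Torus2} {Ft : ℝ × ℝ → ℝ × ℝ}
    {φ : Torus2 → ℝ × ℝ} (hlift : Function.Semiconj torusProj Ft F)
    (hdisp : ∀ x, φ (torusProj x) = Ft x - x) : rotSet Ft = birkhoffLimitSet F φ := by
  have hrange (n : ℕ) : {w : ℝ × ℝ | ∃ x, w = ((n : ℝ))⁻¹ • (Ft^[n] x - x)} =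
      Set.range (birkhoffAverage ℝ F φ n) := by
    ext w
    simp only [Set.mem_range, torusProj_surjective.exists, birkhoffAverage,
      birkhoffSum_torusProj hlift hdisp, Set.mem_ofPred_eq, eq_comm]
  simp only [rotSet, birkhoffLimitSet, hrange]

theorem stmt16 (F : Torus2 → Torus2) (hF : Continuous F)
    (Ft : ℝ × ℝ → ℝ × ℝ) (hFt : Continuous Ft)
    (hlift : ∀ x : ℝ × ℝ, torusProj (Ft x) = F (torusProj x))
    (heq : ∀ (x : ℝ × ℝ) (v : ℤ × ℤ),
      Ft (x + ((v.1 : ℝ), (v.2 : ℝ))) = Ft x + ((v.1 : ℝ), (v.2 : ℝ)))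
    (φ : Torus2 → ℝ × ℝ) (hφ : Continuous φ)
    (hdisp : ∀ x : ℝ × ℝ, φ (torusProj x) = Ft x - x) :
    convexHull ℝ (rotSet Ft) =
      {v : ℝ × ℝ | ∃ μ : Measure Torus2, IsProbabilityMeasure μ ∧
        μ.map F = μ ∧ v = ∫ x, φ x ∂μ} := by
  rw [rotSet_eq_birkhoffLimitSet hlift hdisp, convexHull_birkhoffLimitSet_eq hF hφ]
end
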